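/- Let (ψ, φ) be a solution at Fourier mode α of the linearized MHD system with initial data ψ(0,·) three times and φ(0,·) four times continuously differentiable on [−1,1]. Then φ(t,0) = φ(0,0) for every t ≥ 0, and ψ(t,0) converges, as t → +∞, to (u'(0)/b'(0))·φ(0,0). -/

import Mathlib

open Filter Set Topology

/-- A solution at Fourier mode `α` of the linearized MHD system around the steady state
`U_s = (u(y),0)`, `H_s = (b(y),0)` in the channel `[-1,1]`: the stream functions
`ψ, φ : [0,∞) × [-1,1] → ℂ`, together with their first and second `y`-derivatives,
their `t`-derivatives and the `t`-derivatives of their second `y`-derivatives, exist and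
are continuous, the linearized vorticity/current equations
`∂ₜ(∂_y²ψ − α²ψ) + iαu(∂_y²ψ − α²ψ) − iαb(∂_y²φ − α²φ) = iα(u''ψ − b''φ)` and
`∂ₜ(∂_y²φ − α²φ) + iαu(∂_y²φ − α²φ) − iαb(∂_y²ψ − α²ψ) = iα(b''ψ − u''φ − 2u'∂_yφ + 2b'∂_yψ)`
hold, and `ψ, φ` vanish on the walls `y = ±1`. -/
structure IsMHDSolution (u b : ℝ → ℝ) (α : ℤ) (ψ φ : ℝ → ℝ → ℂ) : Prop where
  cont_psi : ContinuousOn (fun p : ℝ × ℝ => ψ p.1 p.2) (Ici (0:ℝ) ×ˢ Icc (-1:ℝ) 1)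
  cont_phi : ContinuousOn (fun p : ℝ × ℝ => φ p.1 p.2) (Ici (0:ℝ) ×ˢ Icc (-1:ℝ) 1)
  cont_psi_y : ContinuousOn (fun p : ℝ × ℝ => deriv (ψ p.1) p.2) (Ici (0:ℝ) ×ˢ Icc (-1:ℝ) 1)
  cont_phi_y : ContinuousOn (fun p : ℝ × ℝ => deriv (φ p.1) p.2) (Ici (0:ℝ) ×ˢ Icc (-1:ℝ) 1)
  cont_psi_yy : ContinuousOn (fun p : ℝ × ℝ => deriv (deriv (ψ p.1)) p.2)
    (Ici (0:ℝ) ×ˢ Icc (-1:ℝ) 1)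
  cont_phi_yy : ContinuousOn (fun p : ℝ × ℝ => deriv (deriv (φ p.1)) p.2)
    (Ici (0:ℝ) ×ˢ Icc (-1:ℝ) 1)
  cont_psi_t : ContinuousOn (fun p : ℝ × ℝ => deriv (fun s => ψ s p.2) p.1)
    (Ici (0:ℝ) ×ˢ Icc (-1:ℝ) 1)
  cont_phi_t : ContinuousOn (fun p : ℝ × ℝ => deriv (fun s => φ s p.2) p.1)
    (Ici (0:ℝ) ×ˢ Icc (-1:ℝ) 1)
  cont_psi_yyt : ContinuousOn (fun p : ℝ × ℝ => deriv (fun s => deriv (deriv (ψ s)) p.2) p.1)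
    (Ici (0:ℝ) ×ˢ Icc (-1:ℝ) 1)
  cont_phi_yyt : ContinuousOn (fun p : ℝ × ℝ => deriv (fun s => deriv (deriv (φ s)) p.2) p.1)
    (Ici (0:ℝ) ×ˢ Icc (-1:ℝ) 1)
  diff_psi_y : ∀ t ∈ Ici (0:ℝ), ∀ y ∈ Icc (-1:ℝ) 1, DifferentiableAt ℝ (ψ t) y
  diff_psi_yy : ∀ t ∈ Ici (0:ℝ), ∀ y ∈ Icc (-1:ℝ) 1, DifferentiableAt ℝ (deriv (ψ t)) y
  diff_phi_y : ∀ t ∈ Ici (0:ℝ), ∀ y ∈ Icc (-1:ℝ) 1, DifferentiableAt ℝ (φ t) y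
  diff_phi_yy : ∀ t ∈ Ici (0:ℝ), ∀ y ∈ Icc (-1:ℝ) 1, DifferentiableAt ℝ (deriv (φ t)) y
  diff_psi_t : ∀ t ∈ Ici (0:ℝ), ∀ y ∈ Icc (-1:ℝ) 1, DifferentiableAt ℝ (fun s => ψ s y) t
  diff_phi_t : ∀ t ∈ Ici (0:ℝ), ∀ y ∈ Icc (-1:ℝ) 1, DifferentiableAt ℝ (fun s => φ s y) t
  eqn_psi : ∀ t ∈ Ici (0:ℝ), ∀ y ∈ Icc (-1:ℝ) 1,
    HasDerivAt (fun s => deriv (deriv (ψ s)) y - (α:ℂ)^2 * ψ s y)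
      (- Complex.I * (α:ℂ) * ((u y : ℝ) : ℂ) * (deriv (deriv (ψ t)) y - (α:ℂ)^2 * ψ t y)
        + Complex.I * (α:ℂ) * ((b y : ℝ) : ℂ) * (deriv (deriv (φ t)) y - (α:ℂ)^2 * φ t y)
        + Complex.I * (α:ℂ) *
          (((deriv (deriv u) y : ℝ) : ℂ) * ψ t y - ((deriv (deriv b) y : ℝ) : ℂ) * φ t y)) t
  eqn_phi : ∀ t ∈ Ici (0:ℝ), ∀ y ∈ Icc (-1:ℝ) 1,
    HasDerivAt (fun s => deriv (deriv (φ s)) y - (α:ℂ)^2 * φ s y)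
      (- Complex.I * (α:ℂ) * ((u y : ℝ) : ℂ) * (deriv (deriv (φ t)) y - (α:ℂ)^2 * φ t y)
        + Complex.I * (α:ℂ) * ((b y : ℝ) : ℂ) * (deriv (deriv (ψ t)) y - (α:ℂ)^2 * ψ t y)
        + Complex.I * (α:ℂ) *
          (((deriv (deriv b) y : ℝ) : ℂ) * ψ t y - ((deriv (deriv u) y : ℝ) : ℂ) * φ t y
            - 2 * ((deriv u y : ℝ) : ℂ) * deriv (φ t) y + 2 * ((deriv b y : ℝ) : ℂ) * deriv (ψ t) y)) t
  bc_psi : ∀ t ∈ Ici (0:ℝ), ψ t (-1) = 0 ∧ ψ t 1 = 0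
  bc_phi : ∀ t ∈ Ici (0:ℝ), φ t (-1) = 0 ∧ φ t 1 = 0

namespace MHD
section
open MeasureTheory FourierTransform SchwartzMap
open scoped ENNReal

theorem plancherel_bound (g : ℝ → ℂ) (hg1 : Integrable g) (hg2 : MemLp g 2 volume) (B : ℝ → ℝ)
    (hB : MemLp B 2 volume) (hle : ∀ᵐ ξ, ‖𝓕 g ξ‖ ≤ B ξ) :
    eLpNorm g 2 volume ≤ eLpNorm B 2 volume := by
  have hcont : Continuous (𝓕 g) := by
    exact VectorFourier.fourierIntegral_continuous Real.continuous_fourierChar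
      (by fun_prop) hg1
  have hF : MemLp (𝓕 g) 2 volume := by
    refine hB.mono hcont.aestronglyMeasurable ?_
    filter_upwards [hle] with x hx
    exact hx.trans (le_abs_self _)
  have key : 𝓕 (hg2.toLp g) = hF.toLp (𝓕 g) := by
    have hinj := Lp.ker_toTemperedDistributionCLM_eq_bot (E := ℝ) (F := ℂ) (μ := volume) (p := 2)
    rw [LinearMap.ker_eq_bot] at hinj
    apply hinj
    change Lp.toTemperedDistribution (μ := volume) (𝓕 (hg2.toLp g)) = Lp.toTemperedDistribution (μ := volume) (hF.toLp (𝓕 g))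
    rw [← Lp.fourier_toTemperedDistribution_eq]
    ext f
    rw [TemperedDistribution.fourier_apply, Lp.toTemperedDistribution_apply,
      Lp.toTemperedDistribution_apply]
    have h1 : ∫ x, (𝓕 f) x • (hg2.toLp g) x = ∫ x, (𝓕 f) x • g x := by
      apply integral_congr_ae
      filter_upwards [hg2.coeFn_toLp] with x hx
      rw [hx]
    have h2 : ∫ x, f x • (hF.toLp (𝓕 g)) x = ∫ x, f x • (𝓕 g) x := by
      apply integral_congr_ae
      filter_upwards [hF.coeFn_toLp] with x hx
      rw [hx]
    rw [h1, h2]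
    have := VectorFourier.integral_fourierIntegral_smul_eq_flip (μ := volume) (ν := volume)
      (L := innerₗ ℝ) Real.continuous_fourierChar (by fun_prop) (f.integrable (μ := volume)) hg1
    rw [flip_innerₗ] at this
    rw [SchwartzMap.fourier_coe]; exact this
  have hn : ‖hg2.toLp g‖ = ‖hF.toLp (𝓕 g)‖ := by
    rw [← key, Lp.norm_fourier_eq]
  rw [Lp.norm_toLp, Lp.norm_toLp, ENNReal.toReal_eq_toReal_iff' hg2.2.ne hF.2.ne] at hn
  rw [hn]
  refine eLpNorm_mono_ae ?_
  filter_upwards [hle] with x hx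
  exact hx.trans (le_abs_self _)

end
end MHD

namespace MHD
section
open MeasureTheory FourierTransform
open scoped ENNReal ComplexInnerProductSpace

variable {H : Type*} [NormedAddCommGroup H] [InnerProductSpace ℂ H] [CompleteSpace H]

noncomputable def grp (A : H →L[ℂ] H) (t : ℝ) : H →L[ℂ] H :=
  NormedSpace.exp (t • ((-Complex.I) • A))

theorem grp_hasDerivAt (A : H →L[ℂ] H) (v : H) (t : ℝ) :
    HasDerivAt (fun t => grp A t v) (grp A t ((-Complex.I) • A v)) t := by
  have h := hasDerivAt_exp_smul_const (𝕂 := ℝ) ((-Complex.I) • A) t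
  have h2 := (ContinuousLinearMap.apply ℂ H v).restrictScalars ℝ |>.hasFDerivAt.comp_hasDerivAt t h
  simpa [grp, Function.comp_def] using h2

theorem grp_zero (A : H →L[ℂ] H) : grp A 0 = 1 := by simp [grp]

theorem grp_add (A : H →L[ℂ] H) (s t : ℝ) : grp A (s + t) = grp A s * grp A t := by
  unfold grp
  rw [add_smul, NormedSpace.exp_add_of_commute_of_mem_ball (𝕂 := ℝ)]
  · exact (Commute.refl _).smul_left _ |>.smul_right _
  · rw [NormedSpace.expSeries_radius_eq_top]; simp
  · rw [NormedSpace.expSeries_radius_eq_top]; simp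

theorem grp_neg_mul (A : H →L[ℂ] H) (t : ℝ) : grp A (-t) * grp A t = 1 := by
  rw [← grp_add]; simp [grp_zero]

theorem grp_hasDerivAt' (A : H →L[ℂ] H) (v : H) (t : ℝ) :
    HasDerivAt (fun t => grp A t v) ((-Complex.I) • A (grp A t v)) t := by
  have h := hasDerivAt_exp_smul_const' (𝕂 := ℝ) ((-Complex.I) • A) t
  have h2 := (ContinuousLinearMap.apply ℂ H v).restrictScalars ℝ |>.hasFDerivAt.comp_hasDerivAt t h
  simpa [grp, Function.comp_def] using h2

theorem grp_unitary (A : H →L[ℂ] H) (hA : IsSelfAdjoint A) (t : ℝ) :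
    grp A t ∈ unitary (H →L[ℂ] H) := by
  let _ : NormedAlgebra ℚ (H →L[ℂ] H) := NormedAlgebra.restrictScalars ℚ ℂ (H →L[ℂ] H)
  apply NormedSpace.exp_mem_unitary_of_mem_skewAdjoint
  rw [skewAdjoint.mem_iff, star_smul, star_smul, hA.star_eq]
  simp

theorem grp_star (A : H →L[ℂ] H) (hA : IsSelfAdjoint A) (t : ℝ) :
    star (grp A t) = grp A (-t) := by
  have h1 := (Unitary.mem_iff.1 (grp_unitary A hA t)).2
  calc star (grp A t) = (grp A (-t) * grp A t) * star (grp A t) := by rw [grp_neg_mul, one_mul]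
    _ = _ := by rw [mul_assoc, h1, mul_one]

theorem grp_inner (A : H →L[ℂ] H) (hA : IsSelfAdjoint A) (t : ℝ) (x y : H) :
    ⟪grp A t x, y⟫ = ⟪x, grp A (-t) y⟫ := by
  rw [← grp_star A hA, ContinuousLinearMap.star_eq_adjoint, ContinuousLinearMap.adjoint_inner_right]

theorem grp_norm (A : H →L[ℂ] H) (hA : IsSelfAdjoint A) (t : ℝ) (v : H) :
    ‖grp A t v‖ = ‖v‖ := by
  have : ⟪grp A t v, grp A t v⟫ = ⟪v, v⟫ := by
    rw [grp_inner A hA, ← mul_apply_eq_comp, grp_neg_mul]; rfl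
  rw [inner_self_eq_norm_sq_to_K, inner_self_eq_norm_sq_to_K] at this
  have h2 : ‖grp A t v‖ ^ 2 = ‖v‖ ^ 2 := by exact_mod_cast this
  exact (sq_eq_sq₀ (norm_nonneg _) (norm_nonneg _)).1 h2

/-- Solutions of the ODE are given by the group. -/
theorem ode_eq_grp (A : H →L[ℂ] H) (V : ℝ → H) (a : ℝ)
    (hc : ContinuousOn V (Ici 0))
    (hV : ∀ t ≥ 0, HasDerivWithinAt V ((a : ℂ) • ((-Complex.I) • A (V t))) (Ici t) t) (t : ℝ) (ht : 0 ≤ t) :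
    V t = grp A (a * t) (V 0) := by
  have hder : ∀ s ≥ 0, HasDerivWithinAt (fun s => grp A (-(a * s)) (V s)) 0 (Ici s) s := by
    intro s hs
    have h := hasDerivAt_exp_smul_const (𝕂 := ℝ) ((-Complex.I) • A) (-(a * s))
    have h1 : HasDerivAt (fun s : ℝ => -(a * s)) (-a) s := by
      have := (hasDerivAt_id s).const_mul (-a)
      simpa using this
    have h2 := h.scomp s h1
    have h2' : HasDerivAt (fun s : ℝ => (grp A (-(a * s))).restrictScalars ℝ)
        ((ContinuousLinearMap.restrictScalarsL ℂ H H ℝ ℝ) (-a • (NormedSpace.exp (-(a * s) • -Complex.I • A) * (-Complex.I • A)))) s :=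
      (ContinuousLinearMap.restrictScalarsL ℂ H H ℝ ℝ).hasFDerivAt.comp_hasDerivAt s h2
    have h3 := h2'.hasDerivWithinAt.clm_apply (hV s hs)
    refine HasDerivWithinAt.congr_deriv h3 ?_
    change (-a • (grp A (-(a * s)) * (-Complex.I • A))) (V s) + grp A (-(a * s)) ((a:ℂ) • (-Complex.I • A (V s))) = 0
    simp
  have hcont : ContinuousOn (fun s => grp A (-(a * s)) (V s)) (Ici 0) := by
    have hg : Continuous (fun s : ℝ => grp A (-(a * s))) := by
      have : Continuous (grp A) := by
        rw [continuous_iff_continuousAt]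
        intro x
        exact (hasDerivAt_exp_smul_const (𝕂 := ℝ) ((-Complex.I) • A) x).continuousAt
      exact this.comp (by fun_prop)
    exact hg.continuousOn.clm_apply hc
  have hconst : grp A (-(a * t)) (V t) = grp A (-(a * 0)) (V 0) := by
    have := constant_of_has_deriv_right_zero (f := fun s => grp A (-(a * s)) (V s)) (a := 0) (b := t)
      (hcont.mono Icc_subset_Ici_self) (fun x hx => hder x hx.1) t ⟨ht, le_rfl⟩
    exact this
  have h0 : grp A (-(a * t)) (V t) = V 0 := by rw [hconst]; simp [grp_zero]
  rw [← h0, ← mul_apply_eq_comp, ← grp_add]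
  simp [grp_zero]

end
end MHD

namespace MHD
section
open MeasureTheory FourierTransform
open scoped ENNReal ComplexInnerProductSpace

/-- Barbalat-type lemma. -/
theorem barbalat (κ : ℝ → ℂ) (C : ℝ) (hC : 0 < C) (hL : ∀ s t, ‖κ s - κ t‖ ≤ C * |s - t|)
    (hI : MemLp ((Ioi (0:ℝ)).indicator κ) 2 volume) : Tendsto κ atTop (𝓝 0) := by
  have hcont : Continuous κ := by
    have : LipschitzWith (Real.toNNReal C) κ := by
      apply LipschitzWith.of_dist_le_mul
      intro x y
      rw [dist_eq_norm, Real.coe_toNNReal _ hC.le, Real.dist_eq]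
      exact hL x y
    exact this.continuous
  have hint : IntegrableOn (fun t => ‖κ t‖ ^ 2) (Ioi 0) volume := by
    have h1 := hI.integrable_norm_pow (by norm_num)
    rw [← integrable_indicator_iff measurableSet_Ioi]
    refine h1.congr (ae_of_all _ fun t => ?_)
    by_cases h : t ∈ Ioi (0:ℝ) <;> simp [h]
  have htail : Tendsto (fun t : ℝ => ∫ x in Ioi t, ‖κ x‖ ^ 2) atTop (𝓝 0) := by
    have h2 := intervalIntegral_tendsto_integral_Ioi (f := fun t => ‖κ t‖ ^ 2) 0 hint tendsto_id
    have h3 : Tendsto (fun t : ℝ => (∫ x in Ioi (0:ℝ), ‖κ x‖ ^ 2) - ∫ x in (0:ℝ)..t, ‖κ x‖ ^ 2) atTop (𝓝 0) := by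
      have := (tendsto_const_nhds (x := ∫ x in Ioi (0:ℝ), ‖κ x‖ ^ 2)).sub h2
      simpa using this
    refine h3.congr' ?_
    filter_upwards [eventually_ge_atTop (0:ℝ)] with t ht
    rw [← intervalIntegral.integral_Ioi_sub_Ioi hint ht]
    ring
  rw [tendsto_zero_iff_norm_tendsto_zero]
  by_contra hcon
  rw [Metric.tendsto_atTop] at hcon
  push Not at hcon
  obtain ⟨δ, hδ, hcon⟩ := hcon
  have hc : 0 < (δ / 2) ^ 2 * (δ / (2 * C)) := by positivity
  obtain ⟨T, hT⟩ := (Metric.tendsto_atTop.1 htail) _ hc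
  obtain ⟨t, htT, ht⟩ := hcon (max T 0)
  have ht' : δ ≤ ‖κ t‖ := by simpa [Real.dist_eq, abs_of_nonneg] using ht
  have hlt := hT t (le_trans (le_max_left _ _) htT)
  have hintt : IntegrableOn (fun t => ‖κ t‖ ^ 2) (Ioi t) volume :=
    hint.mono_set (Ioi_subset_Ioi (le_trans (le_max_right _ _) htT))
  have hge : (δ / 2) ^ 2 * (δ / (2 * C)) ≤ ∫ x in Ioi t, ‖κ x‖ ^ 2 := by
    calc (δ / 2) ^ 2 * (δ / (2 * C)) = ∫ x in Ioc t (t + δ / (2 * C)), (δ / 2) ^ 2 := by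
          rw [setIntegral_const]
          have : volume.real (Ioc t (t + δ / (2 * C))) = δ / (2 * C) := by
            rw [Real.volume_real_Ioc_of_le (by linarith [show 0 < δ / (2 * C) by positivity])]
            ring
          rw [this, smul_eq_mul]; ring
      _ ≤ ∫ x in Ioc t (t + δ / (2 * C)), ‖κ x‖ ^ 2 := by
          apply setIntegral_mono_on
          · exact integrableOn_const (by simp) (by simp)
          · exact hintt.mono_set Ioc_subset_Ioi_self
          · exact measurableSet_Ioc
          · intro x hx
            have h5 := hL t x
            have h6 : |t - x| ≤ δ / (2 * C) := by
              rw [abs_sub_comm, abs_of_pos (by linarith [hx.1])]; linarith [hx.2]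
            have h7 : C * |t - x| ≤ δ / 2 := by
              calc C * |t - x| ≤ C * (δ / (2 * C)) := by gcongr
                _ = δ / 2 := by field_simp
            have h8 : ‖κ t‖ ≤ ‖κ t - κ x‖ + ‖κ x‖ := by
              simpa using norm_add_le (κ t - κ x) (κ x)
            have : δ / 2 ≤ ‖κ x‖ := by linarith
            gcongr
      _ ≤ _ := by
          apply setIntegral_mono_set hintt
          · filter_upwards with x; positivity
          · exact Ioc_subset_Ioi_self.eventuallyLE
  rw [Real.dist_eq, sub_zero] at hlt
  linarith [le_abs_self (∫ x in Ioi t, ‖κ x‖ ^ 2)]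

variable {H : Type*} [NormedAddCommGroup H] [InnerProductSpace ℂ H] [CompleteSpace H]

theorem exists_resolvent (A : H →L[ℂ] H) (hA : IsSelfAdjoint A) (z : ℂ) (hz : z.im ≠ 0) (E : H) :
    ∃ v, A v - z • v = E := by
  have h : z ∉ spectrum ℂ A := by
    intro hmem
    have := hA.mem_spectrum_eq_re hmem
    apply hz
    rw [this]; simp
  rw [spectrum.notMem_iff] at h
  obtain ⟨w, hw⟩ := h
  refine ⟨- ((w⁻¹ : (H →L[ℂ] H)ˣ) : H →L[ℂ] H) E, ?_⟩
  have h1 : ((w : H →L[ℂ] H) * ((w⁻¹ : (H →L[ℂ] H)ˣ) : H →L[ℂ] H)) E = E := by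
    rw [Units.mul_inv]; rfl
  rw [hw, mul_apply_eq_comp] at h1
  simp only [_root_.sub_apply, Algebra.algebraMap_eq_smul_one] at h1
  simp only [map_neg, smul_neg]
  conv_rhs => rw [← h1]
  simp
  abel

theorem laplace_kappa (A : H →L[ℂ] H) (hA : IsSelfAdjoint A) (E v : H) (x ε : ℝ) (hε : 0 < ε)
    (hv : A v - ((x : ℂ) + ε * Complex.I) • v = E) :
    ∫ t in Ioi (0:ℝ), Complex.exp (Complex.I * ((x : ℂ) + ε * Complex.I) * t) * ⟪E, grp A t E⟫
      = - Complex.I * ⟪E, v⟫ := by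
  set z : ℂ := (x : ℂ) + ε * Complex.I with hz
  have hnorm : ∀ t : ℝ, ‖Complex.exp (Complex.I * z * t)‖ = Real.exp (-ε * t) := by
    intro t
    rw [Complex.norm_exp]
    congr 1
    simp [hz]
  have hd : ∀ t : ℝ, HasDerivAt (fun t : ℝ => Complex.exp (Complex.I * z * t) * ⟪E, grp A t v⟫)
      (-Complex.I * (Complex.exp (Complex.I * z * t) * ⟪E, grp A t E⟫)) t := by
    intro t
    have h1 : HasDerivAt (fun t : ℝ => Complex.exp (Complex.I * z * t))
        (Complex.exp (Complex.I * z * t) * (Complex.I * z)) t := by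
      have h0 : HasDerivAt (fun t : ℝ => Complex.I * z * (t:ℂ)) (Complex.I * z) t := by
        simpa using (Complex.ofRealCLM.hasDerivAt (x := t)).const_mul (Complex.I * z)
      exact h0.cexp
    have h2 := (hasDerivAt_const t E).inner ℂ (grp_hasDerivAt A v t)
    have h3 := h1.mul h2
    refine h3.congr_deriv ?_
    rw [← hv]
    simp only [inner_zero_left, add_zero, map_sub, map_smul, inner_sub_right, inner_smul_right]
    ring
  have hint : IntegrableOn (fun t : ℝ => Complex.exp (Complex.I * z * t) * ⟪E, grp A t E⟫) (Ioi 0) := by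
    have hexp : IntegrableOn (fun t : ℝ => Real.exp (-ε * t) * (‖E‖ * ‖E‖)) (Ioi 0) :=
      (integrableOn_exp_mul_Ioi (by linarith : -ε < 0) 0).mul_const _
    refine Integrable.mono' hexp ?_ ?_
    · apply Continuous.aestronglyMeasurable
      have : Continuous (fun t => grp A t E) :=
        continuous_iff_continuousAt.2 fun t => (grp_hasDerivAt A E t).continuousAt
      fun_prop
    · filter_upwards with t
      rw [norm_mul, hnorm]
      gcongr
      calc _ ≤ ‖E‖ * ‖grp A t E‖ := norm_inner_le_norm _ _
        _ = _ := by rw [grp_norm A hA]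
  have hlim : Tendsto (fun t : ℝ => Complex.exp (Complex.I * z * t) * ⟪E, grp A t v⟫) atTop (𝓝 0) := by
    have h0 : Tendsto (fun t : ℝ => Real.exp (-ε * t) * (‖E‖ * ‖v‖)) atTop (𝓝 0) := by
      have : Tendsto (fun t : ℝ => Real.exp (-ε * t)) atTop (𝓝 0) := by
        apply Real.tendsto_exp_atBot.comp
        exact tendsto_id.const_mul_atTop_of_neg (by linarith)
      simpa using this.mul_const (‖E‖ * ‖v‖)
    refine squeeze_zero_norm ?_ h0
    intro t
    rw [norm_mul, hnorm]
    gcongr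
    calc _ ≤ ‖E‖ * ‖grp A t v‖ := norm_inner_le_norm _ _
        _ = _ := by rw [grp_norm A hA]
  have hmain := integral_Ioi_of_hasDerivAt_of_tendsto' (a := 0) (fun t _ => hd t)
    (hint.const_mul (-Complex.I)) hlim
  rw [integral_const_mul] at hmain
  simp only [grp_zero] at hmain
  have h9 : Complex.I * (-Complex.I) = 1 := by simp
  calc _ = Complex.I * (-Complex.I * ∫ t in Ioi (0:ℝ), Complex.exp (Complex.I * z * t) * ⟪E, grp A t E⟫) := by
        rw [← mul_assoc, h9, one_mul]
    _ = _ := by rw [hmain]; simp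

end
end MHD

namespace MHD
section
open MeasureTheory FourierTransform
open scoped ENNReal ComplexInnerProductSpace

variable {H : Type*} [NormedAddCommGroup H] [InnerProductSpace ℂ H] [CompleteSpace H]

theorem kappa_memLp (A : H →L[ℂ] H) (hA : IsSelfAdjoint A) (E : H) (B : ℝ → ℝ)
    (hB : MemLp B 2 volume) (S : Set ℝ) (hS : S.Finite)
    (hres : ∀ ε : ℝ, 0 < ε → ε ≤ 1 → ∀ x : ℝ, x ∉ S → ∀ v : H,
      A v - ((x : ℂ) + ε * Complex.I) • v = E → ‖⟪E, v⟫‖ ≤ B x) :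
    MemLp ((Ioi (0:ℝ)).indicator (fun t => ⟪E, grp A t E⟫)) 2 volume := by
  have hκc : Continuous (fun t => ⟪E, grp A t E⟫) := by
    have : Continuous (fun t => grp A t E) :=
      continuous_iff_continuousAt.2 fun t => (grp_hasDerivAt A E t).continuousAt
    fun_prop
  have hκb : ∀ t, ‖⟪E, grp A t E⟫‖ ≤ ‖E‖ * ‖E‖ := fun t => by
    calc _ ≤ ‖E‖ * ‖grp A t E‖ := norm_inner_le_norm _ _
        _ = _ := by rw [grp_norm A hA]
  have hB' : MemLp (fun ξ => B (-(2 * Real.pi) * ξ)) 2 volume := by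
    have hq : Measure.QuasiMeasurePreserving (fun ξ : ℝ => -(2 * Real.pi) * ξ) volume volume := by
      refine ⟨by fun_prop, ?_⟩
      rw [Real.map_volume_mul_left (by have := Real.pi_pos; linarith [Real.pi_pos] : -(2 * Real.pi) ≠ 0)]
      exact Measure.smul_absolutelyContinuous
    have hm : AEStronglyMeasurable (fun ξ => B (-(2 * Real.pi) * ξ)) volume :=
      hB.1.comp_quasiMeasurePreserving hq
    rw [memLp_two_iff_integrable_sq hm]
    have h2 := (memLp_two_iff_integrable_sq hB.1).1 hB
    exact h2.comp_mul_left' (by linarith [Real.pi_pos] : -(2 * Real.pi) ≠ 0)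
  set M := eLpNorm (fun ξ => B (-(2 * Real.pi) * ξ)) 2 volume with hM
  let g : ℝ → ℝ → ℂ := fun ε => (Ioi (0:ℝ)).indicator (fun t => (Real.exp (-ε * t) : ℂ) * ⟪E, grp A t E⟫)
  have hgmeas : ∀ ε, AEStronglyMeasurable (g ε) volume := fun ε =>
    AEStronglyMeasurable.indicator (Continuous.aestronglyMeasurable (by fun_prop)) measurableSet_Ioi
  have hgle : ∀ ε : ℝ, 0 < ε → ∀ t, ‖g ε t‖ ≤ (Ioi (0:ℝ)).indicator (fun t => Real.exp (-ε * t) * (‖E‖ * ‖E‖)) t := by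
    intro ε hε t
    by_cases h : t ∈ Ioi (0:ℝ)
    · simp only [g, indicator_of_mem h, norm_mul]
      rw [Complex.norm_of_nonneg (Real.exp_pos _).le]
      gcongr
      exact hκb t
    · simp [g, h]
  have hexp : ∀ ε : ℝ, 0 < ε → Integrable ((Ioi (0:ℝ)).indicator (fun t => Real.exp (-ε * t) * (‖E‖ * ‖E‖))) volume := by
    intro ε hε
    rw [integrable_indicator_iff measurableSet_Ioi]
    exact (integrableOn_exp_mul_Ioi (by linarith : -ε < 0) 0).mul_const _
  have hg1 : ∀ ε : ℝ, 0 < ε → Integrable (g ε) volume := fun ε hε =>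
    (hexp ε hε).mono' (hgmeas ε) (ae_of_all _ (hgle ε hε))
  have hg2 : ∀ ε : ℝ, 0 < ε → MemLp (g ε) 2 volume := by
    intro ε hε
    have hinf : ∀ t, ‖g ε t‖ ≤ ‖E‖ * ‖E‖ := by
      intro t
      refine (hgle ε hε t).trans ?_
      by_cases h : t ∈ Ioi (0:ℝ)
      · simp only [indicator_of_mem h]
        have : Real.exp (-ε * t) ≤ 1 := by
          rw [Real.exp_le_one_iff]; nlinarith [mem_Ioi.1 h]
        nlinarith [mul_nonneg (norm_nonneg E) (norm_nonneg E)]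
      · simp only [indicator_of_notMem h]; positivity
    rw [memLp_two_iff_integrable_sq_norm (hgmeas ε)]
    refine ((hg1 ε hε).norm.const_mul (‖E‖ * ‖E‖)).mono' ((hgmeas ε).norm.pow 2) ?_
    filter_upwards with t
    rw [Real.norm_of_nonneg (by positivity), sq]
    exact mul_le_mul_of_nonneg_right (hinf t) (norm_nonneg _)
  have hbound : ∀ ε : ℝ, 0 < ε → ε ≤ 1 → eLpNorm (g ε) 2 volume ≤ M := by
    intro ε hε hε1
    refine plancherel_bound (g ε) (hg1 ε hε) (hg2 ε hε) _ hB' ?_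
    have hfin : ((fun ξ : ℝ => -(2 * Real.pi) * ξ) ⁻¹' S).Finite := by
      apply hS.preimage
      intro a _ b _ hab
      have : -(2 * Real.pi) ≠ 0 := by linarith [Real.pi_pos]
      exact mul_left_cancel₀ this hab
    have hae : ∀ᵐ ξ : ℝ, ξ ∉ ((fun ξ : ℝ => -(2 * Real.pi) * ξ) ⁻¹' S) :=
      measure_eq_zero_iff_ae_notMem.1 (hfin.measure_zero _)
    filter_upwards [hae] with ξ hξ
    obtain ⟨v, hv⟩ := exists_resolvent A hA (((-(2 * Real.pi) * ξ : ℝ) : ℂ) + ε * Complex.I)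
      (by simpa using hε.ne') E
    have h1 := laplace_kappa A hA E v _ ε hε hv
    have h2 : 𝓕 (g ε) ξ = - Complex.I * ⟪E, v⟫ := by
      rw [← h1, Real.fourier_eq', ← integral_indicator measurableSet_Ioi]
      congr 1
      ext t
      by_cases h : t ∈ Ioi (0:ℝ)
      · simp only [g, indicator_of_mem h, smul_eq_mul, ← mul_assoc, Complex.ofReal_exp, ← Complex.exp_add]
        congr 2
        simp only [RCLike.inner_apply, conj_trivial, Complex.ofReal_mul, Complex.ofReal_neg, Complex.ofReal_ofNat]
        ring_nf
        simp only [Complex.I_sq]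
        ring
      · simp [g, h]
    rw [h2, norm_mul]
    simp only [norm_neg, Complex.norm_I, one_mul]
    exact hres ε hε hε1 _ hξ v hv
  refine ⟨AEStronglyMeasurable.indicator hκc.aestronglyMeasurable measurableSet_Ioi, ?_⟩
  have hlim : eLpNorm ((Ioi (0:ℝ)).indicator (fun t => ⟪E, grp A t E⟫)) 2 volume ≤
      liminf (fun n : ℕ => eLpNorm (g (1 / ((n:ℝ) + 1))) 2 volume) atTop := by
    apply Lp.eLpNorm_lim_le_liminf_eLpNorm (fun n => hgmeas _)
    filter_upwards with t
    by_cases h : t ∈ Ioi (0:ℝ)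
    · simp only [g, indicator_of_mem h]
      have h0 : Tendsto (fun n : ℕ => 1 / ((n:ℝ) + 1)) atTop (𝓝 0) := tendsto_one_div_add_atTop_nhds_zero_nat
      have h1 : Continuous (fun ε : ℝ => (Real.exp (-ε * t) : ℂ) * ⟪E, grp A t E⟫) := by fun_prop
      have h2 := (h1.tendsto 0).comp h0
      simpa [Function.comp_def] using h2
    · simp only [g, indicator_of_notMem h]; exact tendsto_const_nhds
  refine lt_of_le_of_lt (hlim.trans ?_) hB'.2
  refine liminf_le_of_le ?_ ?_
  · isBoundedDefault
  intro b hb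
  obtain ⟨n, hn⟩ := hb.exists
  refine hn.trans (hbound _ (by positivity) ?_)
  rw [div_le_one (by positivity)]
  linarith [(Nat.cast_nonneg n : (0:ℝ) ≤ n)]

theorem decay_of_kappa (A : H →L[ℂ] H) (hA : IsSelfAdjoint A) (E : H) (l : Filter ℝ)
    (hl : ∀ s, Tendsto (fun t => t + s) l l)
    (hκ : Tendsto (fun t => ⟪E, grp A t E⟫) l (𝓝 0)) (V : H) :
    Tendsto (fun t => ⟪E, grp A t V⟫) l (𝓝 0) := by
  let S : Submodule ℂ H :=
    { carrier := {V | Tendsto (fun t => ⟪E, grp A t V⟫) l (𝓝 0)}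
      add_mem' := by
        intro a b ha hb
        simp only [mem_ofPred_eq, map_add, inner_add_right] at *
        simpa using ha.add hb
      zero_mem' := by simpa using tendsto_const_nhds
      smul_mem' := by
        intro c x hx
        simp only [mem_ofPred_eq, map_smul, inner_smul_right] at *
        simpa using hx.const_mul c }
  have hclosed : IsClosed (S : Set H) := by
    rw [← closure_subset_iff_isClosed]
    intro W hW
    change Tendsto (fun t => ⟪E, grp A t W⟫) l (𝓝 0)
    rw [Metric.tendsto_nhds]
    intro δ hδ
    obtain ⟨W', hW', hd⟩ := Metric.mem_closure_iff.1 hW (δ / (2 * (‖E‖ + 1))) (by positivity)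
    have h2 : Tendsto (fun t => ⟪E, grp A t W'⟫) l (𝓝 0) := hW'
    filter_upwards [(Metric.tendsto_nhds.1 h2) (δ / 2) (by positivity)] with t ht
    rw [dist_zero_right] at ht ⊢
    have h3 : ⟪E, grp A t W⟫ = ⟪E, grp A t (W - W')⟫ + ⟪E, grp A t W'⟫ := by
      rw [← inner_add_right, ← map_add]; simp
    rw [h3]
    have h4 : ‖⟪E, grp A t (W - W')⟫‖ ≤ δ / 2 := by
      calc _ ≤ ‖E‖ * ‖grp A t (W - W')‖ := norm_inner_le_norm _ _
        _ = ‖E‖ * ‖W - W'‖ := by rw [grp_norm A hA]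
        _ ≤ (‖E‖ + 1) * (δ / (2 * (‖E‖ + 1))) := by
            rw [dist_eq_norm] at hd
            gcongr
            linarith
        _ = δ / 2 := by field_simp
    linarith [norm_add_le (⟪E, grp A t (W - W')⟫) (⟪E, grp A t W'⟫)]
  let K : Submodule ℂ H := (Submodule.span ℂ (range fun s => grp A s E)).topologicalClosure
  have hK : K ≤ S := by
    apply Submodule.topologicalClosure_minimal _ _ hclosed
    rw [Submodule.span_le]
    rintro _ ⟨s, rfl⟩
    change Tendsto (fun t => ⟪E, grp A t (grp A s E)⟫) l (𝓝 0)
    refine (hκ.comp (hl s)).congr fun t => ?_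
    simp [grp_add]
  have hKo : Kᗮ ≤ S := by
    intro W hW
    change Tendsto (fun t => ⟪E, grp A t W⟫) l (𝓝 0)
    have : ∀ t, ⟪E, grp A t W⟫ = 0 := by
      intro t
      have h1 := grp_inner A hA (-t) E W
      rw [neg_neg] at h1
      rw [← h1]
      exact Submodule.inner_right_of_mem_orthogonal
        (Submodule.le_topologicalClosure _ (Submodule.subset_span (mem_range_self (f := fun s => grp A s E) (-t)))) hW
    simpa [this] using tendsto_const_nhds
  have : CompleteSpace K := by
    exact (Submodule.isClosed_topologicalClosure _).completeSpace_coe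
  have htop : K ⊔ Kᗮ = ⊤ := Submodule.sup_orthogonal_of_hasOrthogonalProjection
  have : (⊤ : Submodule ℂ H) ≤ S := htop ▸ sup_le hK hKo
  exact this (Submodule.mem_top (x := V))

theorem abstract_decay (A : H →L[ℂ] H) (hA : IsSelfAdjoint A) (E : H) (B : ℝ → ℝ)
    (hB : MemLp B 2 volume) (S : Set ℝ) (hS : S.Finite)
    (hres : ∀ ε : ℝ, 0 < ε → ε ≤ 1 → ∀ x : ℝ, x ∉ S → ∀ v : H,
      A v - ((x : ℂ) + ε * Complex.I) • v = E → ‖⟪E, v⟫‖ ≤ B x) (V : H) (a : ℝ) (ha : a ≠ 0) :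
    Tendsto (fun t => ⟪E, grp A (a * t) V⟫) atTop (𝓝 0) := by
  have hκ : Tendsto (fun t => ⟪E, grp A t E⟫) atTop (𝓝 0) := by
    refine barbalat _ (‖E‖ * ‖A E‖ + 1) (by positivity) ?_ (kappa_memLp A hA E B hB S hS hres)
    intro s t
    have hd : ∀ x ∈ (univ : Set ℝ), HasDerivWithinAt (fun t => ⟪E, grp A t E⟫)
        (⟪E, grp A x ((-Complex.I) • A E)⟫) univ x := by
      intro x _
      have := (hasDerivAt_const x E).inner ℂ (grp_hasDerivAt A E x)
      have h2 := this.hasDerivWithinAt (s := univ)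
      simpa only [inner_zero_left, add_zero] using h2
    have := convex_univ.norm_image_sub_le_of_norm_hasDerivWithin_le (C := ‖E‖ * ‖A E‖ + 1) hd ?_ (mem_univ t) (mem_univ s)
    · simpa using this
    · intro x _
      calc _ ≤ ‖E‖ * ‖grp A x ((-Complex.I) • A E)‖ := norm_inner_le_norm _ _
        _ = ‖E‖ * ‖A E‖ := by rw [grp_norm A hA, norm_smul]; simp
        _ ≤ _ := by linarith
  rcases lt_or_gt_of_ne ha with h | h
  · have hκ' : Tendsto (fun t => ⟪E, grp A t E⟫) atBot (𝓝 0) := by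
      have h1 := hκ.comp tendsto_neg_atBot_atTop
      have h2 : Tendsto (fun t => starRingEnd ℂ (⟪E, grp A (-t) E⟫)) atBot (𝓝 (starRingEnd ℂ 0)) :=
        (Complex.continuous_conj.tendsto 0).comp h1
      simp only [map_zero] at h2
      refine h2.congr fun t => ?_
      rw [inner_conj_symm, grp_inner A hA, neg_neg]
    have := decay_of_kappa A hA E atBot (fun s => tendsto_atBot_add_const_right _ _ tendsto_id) hκ' V
    exact this.comp (tendsto_id.const_mul_atTop_of_neg h)
  · have := decay_of_kappa A hA E atTop (fun s => tendsto_atTop_add_const_right _ _ tendsto_id) hκ V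
    exact this.comp (tendsto_id.const_mul_atTop h)

end
end MHD

namespace MHD
section
open ComplexConjugate

theorem le_of_deriv_nonneg {a b : ℝ} (hab : a ≤ b) {f f' : ℝ → ℝ} (hf : ContinuousOn f (Icc a b))
    (hd : ∀ x ∈ Ioo a b, HasDerivAt f (f' x) x) (h : ∀ x ∈ Ioo a b, 0 ≤ f' x) : f a ≤ f b := by
  have : MonotoneOn f (Icc a b) := by
    apply monotoneOn_of_deriv_nonneg (convex_Icc a b) hf
    · rw [interior_Icc]
      exact fun x hx => (hd x hx).differentiableAt.differentiableWithinAt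
    · rw [interior_Icc]
      intro x hx
      rw [(hd x hx).deriv]; exact h x hx
  exact this ⟨le_rfl, hab⟩ ⟨hab, le_rfl⟩ hab

theorem sub_le_sub_of_deriv_le {a b : ℝ} (hab : a ≤ b) {f f' G G' : ℝ → ℝ}
    (hf : ContinuousOn f (Icc a b)) (hG : ContinuousOn G (Icc a b))
    (hd : ∀ x ∈ Ioo a b, HasDerivAt f (f' x) x) (hdG : ∀ x ∈ Ioo a b, HasDerivAt G (G' x) x)
    (h : ∀ x ∈ Ioo a b, f' x ≤ G' x) : f b - f a ≤ G b - G a := by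
  have := le_of_deriv_nonneg hab (hG.sub hf) (fun x hx => (hdG x hx).sub (hd x hx))
    (fun x hx => sub_nonneg.2 (h x hx))
  simp only [Pi.sub_apply] at this
  linarith

theorem norm_sub_le_of_deriv_le {a b : ℝ} (hab : a ≤ b) {f f' : ℝ → ℂ} {G G' : ℝ → ℝ}
    (hf : ContinuousOn f (Icc a b)) (hG : ContinuousOn G (Icc a b))
    (hd : ∀ x ∈ Ioo a b, HasDerivAt f (f' x) x) (hdG : ∀ x ∈ Ioo a b, HasDerivAt G (G' x) x)
    (h : ∀ x ∈ Ioo a b, ‖f' x‖ ≤ G' x) : ‖f b - f a‖ ≤ G b - G a := by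
  obtain ⟨e, he, he2⟩ : ∃ e : ℂ, ‖e‖ ≤ 1 ∧ (e * (f b - f a)).re = ‖f b - f a‖ := by
    by_cases h0 : f b - f a = 0
    · exact ⟨0, by simp, by simp [h0]⟩
    · have hn : ‖f b - f a‖ ≠ 0 := by simpa using h0
      refine ⟨conj (f b - f a) / ‖f b - f a‖, ?_, ?_⟩
      · rw [norm_div, Complex.norm_conj, Complex.norm_real, norm_norm, div_self hn]
      · rw [div_mul_eq_mul_div, mul_comm, Complex.mul_conj, Complex.normSq_eq_norm_sq]
        rw [← Complex.ofReal_div, Complex.ofReal_re]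
        field_simp
  have h1 : ∀ x ∈ Ioo a b, HasDerivAt (fun x => (e * f x).re) ((e * f' x).re) x := by
    intro x hx
    exact (Complex.reCLM.hasFDerivAt.comp_hasDerivAt x ((hd x hx).const_mul e))
  have h2 : ContinuousOn (fun x => (e * f x).re) (Icc a b) :=
    Complex.continuous_re.comp_continuousOn (continuousOn_const.mul hf)
  have h3 := sub_le_sub_of_deriv_le hab h2 hG h1 hdG (fun x hx => by
    calc (e * f' x).re ≤ ‖e * f' x‖ := Complex.re_le_norm _
      _ = ‖e‖ * ‖f' x‖ := norm_mul _ _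
      _ ≤ 1 * ‖f' x‖ := by gcongr
      _ ≤ G' x := by rw [one_mul]; exact h x hx)
  rw [← he2, mul_sub, Complex.sub_re]
  exact h3

theorem sq_le_mul_of_forall {x A B : ℝ} (hx : 0 ≤ x) (hA : 0 ≤ A) (hB : 0 ≤ B)
    (h : ∀ s > 0, 2 * x ≤ s * A + B / s) : x ^ 2 ≤ A * B := by
  rcases hx.eq_or_lt with rfl | hx
  · simpa using mul_nonneg hA hB
  rcases hA.eq_or_lt with rfl | hA
  · exfalso
    rcases hB.eq_or_lt with rfl | hB
    · have := h 1 one_pos; simp at this; linarith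
    · have := h (B / x) (by positivity)
      rw [div_div_eq_mul_div] at this
      field_simp at this
      have := pow_pos hx 2
      linarith
  · have := h (x / A) (by positivity)
    field_simp at this
    nlinarith

/-- Cauchy–Schwarz in ODE form. -/
theorem cs_ode {a b : ℝ} (hab : a ≤ b) {f f' : ℝ → ℂ} {N N' W W' : ℝ → ℝ} (w : ℝ → ℝ)
    (hf : ContinuousOn f (Icc a b)) (hN : ContinuousOn N (Icc a b)) (hW : ContinuousOn W (Icc a b))
    (hd : ∀ x ∈ Ioo a b, HasDerivAt f (f' x) x) (hdN : ∀ x ∈ Ioo a b, HasDerivAt N (N' x) x)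
    (hdW : ∀ x ∈ Ioo a b, HasDerivAt W (W' x) x) (hw : ∀ x ∈ Ioo a b, 0 < w x)
    (h1 : ∀ x ∈ Ioo a b, w x * ‖f' x‖ ^ 2 ≤ N' x) (h2 : ∀ x ∈ Ioo a b, 1 / w x ≤ W' x) :
    ‖f b - f a‖ ^ 2 ≤ (N b - N a) * (W b - W a) := by
  apply sq_le_mul_of_forall (norm_nonneg _)
  · have := le_of_deriv_nonneg hab hN hdN (fun x hx => le_trans (by have := hw x hx; positivity) (h1 x hx))
    linarith
  · have := le_of_deriv_nonneg hab hW hdW (fun x hx => le_trans (by have := hw x hx; positivity) (h2 x hx))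
    linarith
  · intro s hs
    have := norm_sub_le_of_deriv_le hab (G := fun x => (s * N x + W x / s) / 2)
      (G' := fun x => (s * N' x + W' x / s) / 2) hf
      (((continuousOn_const.mul hN).add (hW.div_const s)).div_const 2) hd
      (fun x hx => (((hdN x hx).const_mul s).add ((hdW x hx).div_const s)).div_const 2) ?_
    · calc 2 * ‖f b - f a‖ ≤ 2 * ((s * N b + W b / s) / 2 - (s * N a + W a / s) / 2) := by gcongr
        _ = _ := by ring
    · intro x hx
      have hwx := hw x hx
      have e1 := h1 x hx
      have e2 := h2 x hx
      have e3 : 2 * ‖f' x‖ ≤ s * (w x * ‖f' x‖ ^ 2) + 1 / w x / s := by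
        have : s * (w x * ‖f' x‖ ^ 2) + 1 / w x / s - 2 * ‖f' x‖ = (s * w x * ‖f' x‖ - 1) ^ 2 / (s * w x) := by
          field_simp
          ring
        have h5 : 0 ≤ (s * w x * ‖f' x‖ - 1) ^ 2 / (s * w x) := by positivity
        linarith
      have e4 : s * (w x * ‖f' x‖ ^ 2) ≤ s * N' x := by gcongr
      have e5 : 1 / w x / s ≤ W' x / s := by gcongr
      linarith

end
end MHD

namespace MHD
section
open ComplexConjugate

structure HD (g k g' k' g'' k'' : ℝ → ℝ) (c C : ℝ) : Prop where
  hc : 0 < c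
  g0 : g 0 = 0
  k0 : k 0 = 0
  gc : ContinuousOn g (Icc 0 1)
  kc : ContinuousOn k (Icc 0 1)
  gc' : ContinuousOn g' (Icc 0 1)
  kc' : ContinuousOn k' (Icc 0 1)
  gd : ∀ y ∈ Ioo (0:ℝ) 1, HasDerivAt g (g' y) y
  kd : ∀ y ∈ Ioo (0:ℝ) 1, HasDerivAt k (k' y) y
  gdd : ∀ y ∈ Ioo (0:ℝ) 1, HasDerivAt g' (g'' y) y
  kdd : ∀ y ∈ Ioo (0:ℝ) 1, HasDerivAt k' (k'' y) y
  gl : ∀ y ∈ Icc (0:ℝ) 1, c ≤ g' y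
  gu : ∀ y ∈ Icc (0:ℝ) 1, g' y ≤ C
  kl : ∀ y ∈ Icc (0:ℝ) 1, c ≤ k' y
  ku : ∀ y ∈ Icc (0:ℝ) 1, k' y ≤ C
  g2 : ∀ y ∈ Ioo (0:ℝ) 1, |g'' y| ≤ C
  k2 : ∀ y ∈ Ioo (0:ℝ) 1, |k'' y| ≤ C

theorem HD.swap {g k g' k' g'' k'' : ℝ → ℝ} {c C : ℝ} (h : HD g k g' k' g'' k'' c C) :
    HD k g k' g' k'' g'' c C :=
  ⟨h.hc, h.k0, h.g0, h.kc, h.gc, h.kc', h.gc', h.kd, h.gd, h.kdd, h.gdd, h.kl, h.ku, h.gl, h.gu, h.k2, h.g2⟩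

noncomputable def ZZ (g k : ℝ → ℝ) (z : ℂ) (y : ℝ) : ℂ := (z + k y) * (z - g y) / z

structure HS (g k : ℝ → ℝ) (α : ℝ) (z : ℂ) (X P : ℝ → ℂ) : Prop where
  Xc : ContinuousOn X (Icc 0 1)
  Pc : ContinuousOn P (Icc 0 1)
  Xd : ∀ y ∈ Ioo (0:ℝ) 1, HasDerivAt X (P y / ZZ g k z y) y
  Pd : ∀ y ∈ Ioo (0:ℝ) 1, HasDerivAt P (α ^ 2 * ZZ g k z y * X y) y
  X1 : X 1 = 0

variable {g k g' k' g'' k'' : ℝ → ℝ} {c C : ℝ} 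

theorem HD.cC (h : HD g k g' k' g'' k'' c C) : c ≤ C :=
  (h.gl 0 (by simp)).trans (h.gu 0 (by simp))

theorem HD.gsub (h : HD g k g' k' g'' k'' c C) {x y : ℝ} (hx : 0 ≤ x) (hxy : x ≤ y) (hy : y ≤ 1) :
    c * (y - x) ≤ g y - g x ∧ g y - g x ≤ C * (y - x) := by
  have hs : Icc x y ⊆ Icc 0 1 := Icc_subset_Icc hx hy
  have hs2 : ∀ t, t ∈ Ioo x y → t ∈ Ioo (0:ℝ) 1 := fun t ht => ⟨lt_of_le_of_lt hx ht.1, lt_of_lt_of_le ht.2 hy⟩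
  have hl : ∀ a : ℝ, ∀ t ∈ Ioo x y, HasDerivAt (fun t => a * t) a t := fun a t _ => by
    simpa using (hasDerivAt_id t).const_mul a
  have hcl : ∀ a : ℝ, ContinuousOn (fun t => a * t) (Icc x y) := fun a => by fun_prop
  constructor
  · have := sub_le_sub_of_deriv_le hxy (hcl c) (h.gc.mono hs) (hl c) (fun t ht => h.gd t (hs2 t ht))
      (fun t ht => h.gl t (Ioo_subset_Icc_self (hs2 t ht)))
    linarith
  · have := sub_le_sub_of_deriv_le hxy (h.gc.mono hs) (hcl C) (fun t ht => h.gd t (hs2 t ht)) (hl C)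
      (fun t ht => h.gu t (Ioo_subset_Icc_self (hs2 t ht)))
    linarith

theorem HD.gb (h : HD g k g' k' g'' k'' c C) {y : ℝ} (hy : y ∈ Icc (0:ℝ) 1) :
    c * y ≤ g y ∧ g y ≤ C * y := by
  have := h.gsub le_rfl hy.1 hy.2
  rw [h.g0] at this
  simpa using this

theorem HD.kb (h : HD g k g' k' g'' k'' c C) {y : ℝ} (hy : y ∈ Icc (0:ℝ) 1) :
    c * y ≤ k y ∧ k y ≤ C * y := h.swap.gb hy

theorem HD.gnn (h : HD g k g' k' g'' k'' c C) {y : ℝ} (hy : y ∈ Icc (0:ℝ) 1) : 0 ≤ g y :=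
  le_trans (mul_nonneg h.hc.le hy.1) (h.gb hy).1
theorem HD.knn (h : HD g k g' k' g'' k'' c C) {y : ℝ} (hy : y ∈ Icc (0:ℝ) 1) : 0 ≤ k y :=
  h.swap.gnn hy

theorem ZZ_im (x ε : ℝ) (hε : 0 < ε) (y : ℝ) :
    (ZZ g k (x + ε * Complex.I) y).im = ε * (1 + g y * k y / (x ^ 2 + ε ^ 2)) := by
  have : x ^ 2 + ε ^ 2 ≠ 0 := by positivity
  have hn : Complex.normSq (x + ε * Complex.I) = x ^ 2 + ε ^ 2 := by
    simp [Complex.normSq_apply]; ring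
  rw [ZZ, Complex.div_im, hn]
  simp
  field_simp
  ring

theorem ZZ_re (x ε : ℝ) (hε : 0 < ε) (y : ℝ) :
    (x ^ 2 + ε ^ 2) * (ZZ g k (x + ε * Complex.I) y).re =
      (x - g y) * (x ^ 2 + ε ^ 2) + k y * (x * (x - g y) + ε ^ 2) := by
  have : x ^ 2 + ε ^ 2 ≠ 0 := by positivity
  have hn : Complex.normSq (x + ε * Complex.I) = x ^ 2 + ε ^ 2 := by
    simp [Complex.normSq_apply]; ring
  rw [ZZ, Complex.div_re, hn]
  simp
  field_simp
  ring

theorem ZZ_im_ge (h : HD g k g' k' g'' k'' c C) (x ε : ℝ) (hε : 0 < ε) {y : ℝ}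
    (hy : y ∈ Icc (0:ℝ) 1) : ε ≤ (ZZ g k (x + ε * Complex.I) y).im := by
  rw [ZZ_im x ε hε]
  have := h.gnn hy
  have := h.knn hy
  have : 0 ≤ g y * k y / (x ^ 2 + ε ^ 2) := by positivity
  nlinarith

theorem ZZ_ne (h : HD g k g' k' g'' k'' c C) (x ε : ℝ) (hε : 0 < ε) {y : ℝ}
    (hy : y ∈ Icc (0:ℝ) 1) : ZZ g k (x + ε * Complex.I) y ≠ 0 := by
  intro h0
  have := ZZ_im_ge h x ε hε hy
  rw [h0] at this
  simp at this; linarith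

/-- derivative of `P * conj X` -/
theorem HS.Md {α : ℝ} {z : ℂ} {X P : ℝ → ℂ} (hs : HS g k α z X P)
    {y : ℝ} (hy : y ∈ Ioo (0:ℝ) 1) (hz : ZZ g k z y ≠ 0) :
    HasDerivAt (fun y => P y * conj (X y))
      (ZZ g k z y * ((α ^ 2 * ‖X y‖ ^ 2 + ‖P y / ZZ g k z y‖ ^ 2 : ℝ) : ℂ)) y := by
  have h1 := (hs.Pd y hy).mul ((hs.Xd y hy).star)
  refine HasDerivAt.congr_deriv h1 ?_
  simp only [Complex.star_def]
  push_cast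
  rw [← Complex.mul_conj', ← Complex.mul_conj']
  have : P y = ZZ g k z y * (P y / ZZ g k z y) := by field_simp
  calc _ = α ^ 2 * ZZ g k z y * X y * conj (X y) + (ZZ g k z y * (P y / ZZ g k z y)) * conj (P y / ZZ g k z y) := by
        rw [← this]
    _ = _ := by ring

theorem HS.Mc {α : ℝ} {z : ℂ} {X P : ℝ → ℂ} (hs : HS g k α z X P) :
    ContinuousOn (fun y => P y * conj (X y)) (Icc 0 1) :=
  hs.Pc.mul (Complex.continuous_conj.comp_continuousOn hs.Xc)

theorem HS.Mim {α : ℝ} {z : ℂ} {X P : ℝ → ℂ} (hs : HS g k α z X P)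
    {y : ℝ} (hy : y ∈ Ioo (0:ℝ) 1) (hz : ZZ g k z y ≠ 0) :
    HasDerivAt (fun y => (P y * conj (X y)).im)
      ((ZZ g k z y).im * (α ^ 2 * ‖X y‖ ^ 2 + ‖P y / ZZ g k z y‖ ^ 2)) y := by
  have := Complex.imCLM.hasFDerivAt.comp_hasDerivAt y (hs.Md hy hz)
  refine HasDerivAt.congr_deriv this ?_
  rw [Complex.imCLM_apply, Complex.im_mul_ofReal]

theorem HS.Mre {α : ℝ} {z : ℂ} {X P : ℝ → ℂ} (hs : HS g k α z X P)
    {y : ℝ} (hy : y ∈ Ioo (0:ℝ) 1) (hz : ZZ g k z y ≠ 0) :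
    HasDerivAt (fun y => (P y * conj (X y)).re)
      ((ZZ g k z y).re * (α ^ 2 * ‖X y‖ ^ 2 + ‖P y / ZZ g k z y‖ ^ 2)) y := by
  have := Complex.reCLM.hasFDerivAt.comp_hasDerivAt y (hs.Md hy hz)
  refine HasDerivAt.congr_deriv this ?_
  rw [Complex.reCLM_apply, Complex.re_mul_ofReal]

noncomputable def JJ (X P : ℝ → ℂ) : ℂ := - (P 0 * conj (X 0))

theorem J_im_nonneg (h : HD g k g' k' g'' k'' c C) {α x ε : ℝ} (hε : 0 < ε) {X P : ℝ → ℂ}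
    (hs : HS g k α (x + ε * Complex.I) X P) : 0 ≤ (JJ X P).im := by
  have := le_of_deriv_nonneg zero_le_one (Complex.continuous_im.comp_continuousOn hs.Mc)
    (fun y hy => hs.Mim hy (ZZ_ne h x ε hε (Ioo_subset_Icc_self hy))) (fun y hy => by
      have := ZZ_im_ge h x ε hε (Ioo_subset_Icc_self hy)
      have := hε.le.trans this
      positivity)
  simp only [Function.comp_apply, hs.X1, map_zero, mul_zero, Complex.zero_im] at this
  rw [JJ, Complex.neg_im]
  linarith

/-- generic bound: if `w = s * Re Z + r * Im Z > 0` -/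
theorem half_cs (h : HD g k g' k' g'' k'' c C) {α x ε : ℝ} (hε : 0 < ε) {X P : ℝ → ℂ}
    (hs : HS g k α (x + ε * Complex.I) X P) (s r : ℝ) (w W W' : ℝ → ℝ)
    (hw : ∀ y ∈ Ioo (0:ℝ) 1, 0 < w y)
    (hw2 : ∀ y ∈ Ioo (0:ℝ) 1, w y ≤ s * (ZZ g k (x + ε * Complex.I) y).re +
      r * (ZZ g k (x + ε * Complex.I) y).im)
    (hW : ContinuousOn W (Icc 0 1)) (hdW : ∀ y ∈ Ioo (0:ℝ) 1, HasDerivAt W (W' y) y)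
    (h2 : ∀ y ∈ Ioo (0:ℝ) 1, 1 / w y ≤ W' y) :
    ‖X 0‖ ^ 2 ≤ (s * (JJ X P).re + r * (JJ X P).im) * (W 1 - W 0) := by
  have := cs_ode zero_le_one (N := fun y => s * (P y * conj (X y)).re + r * (P y * conj (X y)).im)
    w hs.Xc ((continuousOn_const.mul (Complex.continuous_re.comp_continuousOn hs.Mc)).add
      (continuousOn_const.mul (Complex.continuous_im.comp_continuousOn hs.Mc))) hW
    hs.Xd (fun y hy => ((hs.Mre hy (ZZ_ne h x ε hε (Ioo_subset_Icc_self hy))).const_mul s).add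
      ((hs.Mim hy (ZZ_ne h x ε hε (Ioo_subset_Icc_self hy))).const_mul r)) hdW hw (fun y hy => by
        have h1 := hw y hy
        have h2 := hw2 y hy
        rw [← mul_assoc, ← mul_assoc, ← add_mul]
        have h3 : 0 ≤ s * (ZZ g k (x + ε * Complex.I) y).re + r * (ZZ g k (x + ε * Complex.I) y).im := h1.le.trans h2
        apply mul_le_mul h2 _ (by positivity) h3
        have : 0 ≤ α ^ 2 * ‖X y‖ ^ 2 := by positivity
        linarith) h2
  simp only [hs.X1, map_zero, mul_zero, Complex.zero_im, Complex.zero_re, zero_sub, norm_neg, add_zero] at this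
  rw [JJ, Complex.neg_im, Complex.neg_re]
  calc _ ≤ _ := this
    _ = _ := by ring

end
end MHD

namespace MHD
section
open ComplexConjugate
variable {g k g' k' g'' k'' : ℝ → ℝ} {c C : ℝ} 

theorem half_R0 (h : HD g k g' k' g'' k'' c C) {α x ε : ℝ} (hε : 0 < ε) (hx : 0 ≤ x)
    (hxe : x ≤ 2 * ε) {X P : ℝ → ℂ}
    (hs : HS g k α (x + ε * Complex.I) X P) : ‖X 0‖ ^ 2 ≤ 6 / c * (JJ X P).im := by
  have hc := h.hc
  have hJ := J_im_nonneg h hε hs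
  have hder : ∀ y : ℝ, HasDerivAt (fun y => 3 / c * Real.arctan (c / (3 * ε) * y))
      (3 / c * (1 / (1 + (c / (3 * ε) * y) ^ 2) * (c / (3 * ε)))) y := by
    intro y
    have h1 : HasDerivAt (fun y => c / (3 * ε) * y) (c / (3 * ε)) y := by
      simpa using (hasDerivAt_id y).const_mul (c / (3 * ε))
    exact h1.arctan.const_mul _
  have := half_cs h hε hs 0 1 (fun y => ε * (1 + (c / (3 * ε) * y) ^ 2))
    (fun y => 3 / c * Real.arctan (c / (3 * ε) * y))
    (fun y => 3 / c * (1 / (1 + (c / (3 * ε) * y) ^ 2) * (c / (3 * ε))))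
    (fun y hy => by positivity) (fun y hy => by
      rw [zero_mul, zero_add, one_mul, ZZ_im x ε hε]
      have hy' := Ioo_subset_Icc_self hy
      have e1 := (h.gb hy').1
      have e2 := (h.kb hy').1
      have hy0 := hy.1
      have e3 : (c * y) * (c * y) ≤ g y * k y := by
        apply mul_le_mul e1 e2 (by positivity) (h.gnn hy')
      gcongr
      rw [show (c / (3 * ε) * y) ^ 2 = (c * y) * (c * y) / (9 * ε ^ 2) by field_simp; ring]
      have h5 : 0 < x ^ 2 + ε ^ 2 := by positivity
      gcongr
      all_goals nlinarith)
    (continuous_iff_continuousAt.2 fun y => (hder y).continuousAt).continuousOn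
    (fun y _ => hder y) (fun y _ => by
      apply le_of_eq
      field_simp)
  simp only [zero_mul, one_mul, zero_add, mul_zero, Real.arctan_zero, sub_zero, mul_one] at this
  refine this.trans ?_
  rw [mul_comm]
  gcongr
  have h1 := Real.arctan_lt_pi_div_two (c / (3 * ε))
  have h2 := Real.pi_lt_four
  calc 3 / c * Real.arctan (c / (3 * ε)) ≤ 3 / c * 2 := by gcongr; linarith
    _ = 6 / c := by ring

theorem ReZ_add (h : HD g k g' k' g'' k'' c C) {x ε : ℝ} (hε : 0 < ε) (hx : 0 ≤ x)
    (hxe : g 1 ≤ x + 2 * ε) {y : ℝ} (hy : y ∈ Icc (0:ℝ) 1) :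
    x - g y + 3 * ε ≤ 1 * (ZZ g k (x + ε * Complex.I) y).re + 3 * (ZZ g k (x + ε * Complex.I) y).im := by
  have h1 := ZZ_re (g := g) (k := k) x ε hε y
  have hp : 0 < x ^ 2 + ε ^ 2 := by positivity
  have h2 : (ZZ g k (x + ε * Complex.I) y).re = (x - g y) + k y * (x * (x - g y) + ε ^ 2) / (x ^ 2 + ε ^ 2) := by
    field_simp
    linarith
  rw [h2, ZZ_im x ε hε]
  have hg := (h.gsub hy.1 hy.2 le_rfl).1
  have hg2 : g y ≤ g 1 := by nlinarith [h.hc, hy.2]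
  have hk := h.knn hy
  have hgn := h.gnn hy
  have h3 : 0 ≤ x * (x - g y) + ε ^ 2 + 3 * ε * g y := by
    rcases le_total (g y) x with h' | h'
    · have := mul_nonneg hx (sub_nonneg.2 h'); positivity
    · nlinarith [mul_nonneg hx (by linarith : 0 ≤ x + 2 * ε - g y), mul_nonneg hε.le (sub_nonneg.2 h')]
  have h4 : 0 ≤ k y * (x * (x - g y) + ε ^ 2 + 3 * ε * g y) / (x ^ 2 + ε ^ 2) := by positivity
  have : 1 * (x - g y + k y * (x * (x - g y) + ε ^ 2) / (x ^ 2 + ε ^ 2)) + 3 * (ε * (1 + g y * k y / (x ^ 2 + ε ^ 2)))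
     = x - g y + 3 * ε + k y * (x * (x - g y) + ε ^ 2 + 3 * ε * g y) / (x ^ 2 + ε ^ 2) := by
    ring
  rw [this]
  linarith

theorem half_R1_nonneg (h : HD g k g' k' g'' k'' c C) {α x ε : ℝ} (hε : 0 < ε) (hx : 0 ≤ x)
    (hxe : g 1 ≤ x + 2 * ε) {X P : ℝ → ℂ}
    (hs : HS g k α (x + ε * Complex.I) X P) : 0 ≤ (JJ X P).re + 3 * (JJ X P).im := by
  have := le_of_deriv_nonneg zero_le_one
    (f := fun y => 1 * (P y * conj (X y)).re + 3 * (P y * conj (X y)).im)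
    ((continuousOn_const.mul (Complex.continuous_re.comp_continuousOn hs.Mc)).add
      (continuousOn_const.mul (Complex.continuous_im.comp_continuousOn hs.Mc)))
    (fun y hy => ((hs.Mre hy (ZZ_ne h x ε hε (Ioo_subset_Icc_self hy))).const_mul 1).add
      ((hs.Mim hy (ZZ_ne h x ε hε (Ioo_subset_Icc_self hy))).const_mul 3)) (fun y hy => by
        rw [← mul_assoc, ← mul_assoc, ← add_mul]
        have hy' := Ioo_subset_Icc_self hy
        have h1 := ReZ_add h hε hx hxe hy'
        have hg2 : g y ≤ g 1 := by nlinarith [h.hc, hy.2, (h.gsub hy'.1 hy'.2 le_rfl).1]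
        apply mul_nonneg _ (by positivity)
        linarith)
  simp only [hs.X1, map_zero, mul_zero, Complex.zero_im, Complex.zero_re, add_zero] at this
  rw [JJ, Complex.neg_im, Complex.neg_re]
  linarith

theorem half_R1 (h : HD g k g' k' g'' k'' c C) {α x ε : ℝ} (hε : 0 < ε) (hx : 0 ≤ x)
    (hxe : g 1 ≤ x + 2 * ε) (hne : x ≠ g 1) {X P : ℝ → ℂ}
    (hs : HS g k α (x + ε * Complex.I) X P) :
    ‖X 0‖ ^ 2 ≤ ((JJ X P).re + 3 * (JJ X P).im) * (Real.log (1 + c / (|x - g 1| / 2)) / c) := by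
  have hc := h.hc
  set δ := |x - g 1| / 2 with hδ
  have hδ0 : 0 < δ := by
    have : 0 < |x - g 1| := abs_pos.2 (sub_ne_zero.2 hne)
    positivity
  have hpos : ∀ y : ℝ, y ≤ 1 → 0 < c * (1 - y) + δ := fun y hy => by
    have := mul_nonneg hc.le (sub_nonneg.2 hy); linarith
  have hder : ∀ y : ℝ, y ≤ 1 → HasDerivAt (fun y => - (Real.log (c * (1 - y) + δ) / c))
      (-(-c / (c * (1 - y) + δ) / c)) y := by
    intro y hy
    have h1 : HasDerivAt (fun y => c * (1 - y) + δ) (-c) y := by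
      simpa using (((hasDerivAt_id y).const_sub 1).const_mul c).add_const δ
    exact ((h1.log (hpos y hy).ne').div_const c).neg
  have := half_cs h hε hs 1 3 (fun y => c * (1 - y) + δ)
    (fun y => - (Real.log (c * (1 - y) + δ) / c)) (fun y => (-(-c / (c * (1 - y) + δ) / c)))
    (fun y hy => hpos y hy.2.le) (fun y hy => by
      have hy' := Ioo_subset_Icc_self hy
      refine le_trans ?_ (ReZ_add h hε hx hxe hy')
      have h1 := (h.gsub hy'.1 hy'.2 le_rfl).1
      rcases le_total (x - g 1) 0 with h' | h'
      · rw [abs_of_nonpos h'] at hδ; linarith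
      · rw [abs_of_nonneg h'] at hδ; linarith)
    (fun y hy => (hder y hy.2).continuousAt.continuousWithinAt)
    (fun y hy => hder y hy.2.le) (fun y hy => by
      have := hpos y hy.2.le
      apply le_of_eq
      field_simp)
  rw [one_mul] at this
  refine this.trans (le_of_eq ?_)
  congr 1
  have : 1 + c / δ = (c + δ) / δ := by field_simp; ring
  rw [this, Real.log_div (by positivity) hδ0.ne']
  simp
  ring

end
end MHD

namespace MHD
section
open ComplexConjugate
variable {g k g' k' g'' k'' : ℝ → ℝ} {c C : ℝ} 

theorem HD.gmono (h : HD g k g' k' g'' k'' c C) {s t : ℝ} (hs : 0 ≤ s) (hst : s ≤ t) (ht : t ≤ 1) :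
    g s ≤ g t := by
  have := (h.gsub hs hst ht).1
  nlinarith [h.hc, mul_nonneg h.hc.le (sub_nonneg.2 hst)]

theorem HD.exists_eq (h : HD g k g' k' g'' k'' c C) {v : ℝ} (h0 : 0 ≤ v) (h1 : v ≤ g 1) :
    ∃ y ∈ Icc (0:ℝ) 1, g y = v := by
  have := intermediate_value_Icc (zero_le_one (α := ℝ)) h.gc
  rw [h.g0] at this
  obtain ⟨y, hy, rfl⟩ := this ⟨h0, h1⟩
  exact ⟨y, hy, rfl⟩

theorem HD.lt_of_lt (h : HD g k g' k' g'' k'' c C) {s t : ℝ} (hs : s ∈ Icc (0:ℝ) 1)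
    (ht : t ∈ Icc (0:ℝ) 1) (hg : g s < g t) : s < t := by
  by_contra hcon
  have := h.gmono ht.1 (not_lt.1 hcon) hs.2
  linarith

theorem ReZ_nonpos (h : HD g k g' k' g'' k'' c C) {x ε : ℝ} (hε : 0 < ε)
    (hxe : 2 * ε < x) {y : ℝ} (hy : y ∈ Icc (0:ℝ) 1) (hg : x + ε ≤ g y) :
    (ZZ g k (x + ε * Complex.I) y).re ≤ 0 := by
  have h1 := ZZ_re (g := g) (k := k) x ε hε y
  have hp : 0 < x ^ 2 + ε ^ 2 := by positivity
  have hk := h.knn hy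
  have h2 : x * (x - g y) + ε ^ 2 ≤ 0 := by nlinarith
  have h3 : (x - g y) * (x ^ 2 + ε ^ 2) ≤ 0 := mul_nonpos_of_nonpos_of_nonneg (by linarith) hp.le
  have h4 := mul_nonpos_of_nonneg_of_nonpos hk h2
  by_contra hcon
  have := mul_pos hp (not_le.1 hcon)
  linarith

theorem outer_sign (h : HD g k g' k' g'' k'' c C) {α x ε : ℝ} (hε : 0 < ε)
    (hxe : 2 * ε < x) {X P : ℝ → ℂ} (hs : HS g k α (x + ε * Complex.I) X P)
    {y : ℝ} (hy : y ∈ Icc (0:ℝ) 1) (hg : x + ε ≤ g y) :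
    0 ≤ (P y * conj (X y)).re ∧ (P y * conj (X y)).im ≤ 0 := by
  have hsub : Icc y 1 ⊆ Icc 0 1 := Icc_subset_Icc hy.1 le_rfl
  have hsub2 : ∀ t ∈ Ioo y 1, t ∈ Ioo (0:ℝ) 1 := fun t ht => ⟨lt_of_le_of_lt hy.1 ht.1, ht.2⟩
  constructor
  · have := le_of_deriv_nonneg hy.2 ((Complex.continuous_re.comp_continuousOn hs.Mc).mono hsub).neg
      (fun t ht => (hs.Mre (hsub2 t ht) (ZZ_ne h x ε hε (Ioo_subset_Icc_self (hsub2 t ht)))).neg)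
      (fun t ht => by
        have ht' := Ioo_subset_Icc_self (hsub2 t ht)
        have := ReZ_nonpos h hε hxe ht' (hg.trans (h.gmono hy.1 ht.1.le ht.2.le))
        rw [← neg_mul]
        exact mul_nonneg (by linarith) (by positivity))
    simp only [Function.comp_apply, hs.X1, map_zero, mul_zero, Complex.zero_re, Pi.neg_apply] at this
    linarith
  · have := le_of_deriv_nonneg hy.2 ((Complex.continuous_im.comp_continuousOn hs.Mc).mono hsub)
      (fun t ht => (hs.Mim (hsub2 t ht) (ZZ_ne h x ε hε (Ioo_subset_Icc_self (hsub2 t ht)))))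
      (fun t ht => by
        have ht' := Ioo_subset_Icc_self (hsub2 t ht)
        have := ZZ_im_ge h x ε hε ht'
        exact mul_nonneg (by linarith) (by positivity))
    simp only [Function.comp_apply, hs.X1, map_zero, mul_zero, Complex.zero_im] at this
    linarith

theorem outer_anti (h : HD g k g' k' g'' k'' c C) {α x ε : ℝ} (hε : 0 < ε)
    (hxe : 2 * ε < x) {X P : ℝ → ℂ} (hs : HS g k α (x + ε * Complex.I) X P)
    {s t : ℝ} (hs0 : 0 ≤ s) (hst : s ≤ t) (ht : t ≤ 1) (hg : x + ε ≤ g s) : ‖P t‖ ≤ ‖P s‖ := by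
  have hsub : Icc s t ⊆ Icc 0 1 := Icc_subset_Icc hs0 ht
  have hsub2 : ∀ y ∈ Ioo s t, y ∈ Ioo (0:ℝ) 1 := fun y hy => ⟨lt_of_le_of_lt hs0 hy.1, lt_of_lt_of_le hy.2 ht⟩
  have := le_of_deriv_nonneg hst (f := fun y => - ‖P y‖ ^ 2)
    (f' := fun y => -(2 * inner ℝ (P y) (α ^ 2 * ZZ g k (x + ε * Complex.I) y * X y)))
    ((hs.Pc.mono hsub).norm.pow 2).neg
    (fun y hy => (HasDerivAt.norm_sq (hs.Pd y (hsub2 y hy))).neg) (fun y hy => by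
      have hy' := Ioo_subset_Icc_self (hsub2 y hy)
      have hgy : x + ε ≤ g y := hg.trans (h.gmono hs0 hy.1.le hy'.2)
      obtain ⟨h1, h2⟩ := outer_sign h hε hxe hs hy' hgy
      have h3 := ReZ_nonpos h hε hxe hy' hgy
      have h4 := ZZ_im_ge h x ε hε hy'
      set Z := ZZ g k (x + ε * Complex.I) y
      have : inner ℝ (P y) (α ^ 2 * Z * X y) = α ^ 2 * (Z.re * (P y * conj (X y)).re + Z.im * (P y * conj (X y)).im) := by
        rw [Complex.inner]
        have : ((α : ℂ) ^ 2 * Z * X y) * conj (P y) = ((α ^ 2 : ℝ) : ℂ) * (Z * conj (P y * conj (X y))) := by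
          simp; ring
        rw [this, Complex.re_ofReal_mul, Complex.mul_re, Complex.conj_re, Complex.conj_im]
        ring
      rw [this]
      have h5 : Z.re * (P y * conj (X y)).re ≤ 0 := mul_nonpos_of_nonpos_of_nonneg h3 h1
      have h6 : Z.im * (P y * conj (X y)).im ≤ 0 := mul_nonpos_of_nonneg_of_nonpos (by linarith) h2
      have h7 : α ^ 2 * (Z.re * (P y * conj (X y)).re + Z.im * (P y * conj (X y)).im) ≤ 0 :=
        mul_nonpos_of_nonneg_of_nonpos (sq_nonneg _) (by linarith)
      linarith)
  exact abs_le_of_sq_le_sq' (by linarith) (norm_nonneg _) |>.2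

theorem norm_ZZ (z : ℂ) (y : ℝ) : ‖ZZ g k z y‖ = ‖z + k y‖ * ‖z - g y‖ / ‖z‖ := by
  rw [ZZ, norm_div, norm_mul]

/-- Bound for P at y1 -/
theorem outer_P (h : HD g k g' k' g'' k'' c C) {α x ε : ℝ} (hε : 0 < ε)
    (hxe : 2 * ε < x) (hx1 : x < g 1 - 2 * ε) {X P : ℝ → ℂ} (hs : HS g k α (x + ε * Complex.I) X P)
    {y1 : ℝ} (hy1 : y1 ∈ Icc (0:ℝ) 1) (hg : x + 2 * ε ≤ g y1) :
    ‖P y1‖ ^ 2 ≤ 9 * (1 + 2 * C / c) ^ 2 * C * (JJ X P).im := by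
  have hc := h.hc
  have hC : 0 < C := hc.trans_le h.cC
  obtain ⟨yp, hyp, hgp⟩ := h.exists_eq (v := x + ε) (by linarith) (by linarith)
  obtain ⟨y2, hy2, hg2⟩ := h.exists_eq (v := x + 2 * ε) (by linarith) (by linarith)
  have h12 : yp < y2 := h.lt_of_lt hyp hy2 (by linarith)
  have h2y : y2 ≤ y1 := by
    by_contra hcon
    have h3 := (h.gsub hy1.1 (not_le.1 hcon).le hy2.2).1
    nlinarith [mul_pos hc (sub_pos.2 (not_le.1 hcon))]
  have hlen := (h.gsub hyp.1 h12.le hy2.2).2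
  set K := 1 + 2 * C / c with hK
  have hK0 : 0 < K := by positivity
  -- on [yp,y2]
  have hsub : Icc yp y2 ⊆ Icc 0 1 := Icc_subset_Icc hyp.1 hy2.2
  have hsub2 : ∀ y ∈ Ioo yp y2, y ∈ Ioo (0:ℝ) 1 := fun y hy => ⟨lt_of_le_of_lt hyp.1 hy.1, lt_of_lt_of_le hy.2 hy2.2⟩
  have hm := sub_le_sub_of_deriv_le h12.le (f := fun y => (‖P y1‖ ^ 2 / (9 * K ^ 2 * ε)) * y)
    (f' := fun _ => ‖P y1‖ ^ 2 / (9 * K ^ 2 * ε)) (by fun_prop)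
    ((Complex.continuous_im.comp_continuousOn hs.Mc).mono hsub)
    (fun y _ => by simpa using (hasDerivAt_id y).const_mul (‖P y1‖ ^ 2 / (9 * K ^ 2 * ε)))
    (fun t ht => (hs.Mim (hsub2 t ht) (ZZ_ne h x ε hε (Ioo_subset_Icc_self (hsub2 t ht)))))
    (fun y hy => by
      have hy' := Ioo_subset_Icc_self (hsub2 y hy)
      have hgy : x + ε ≤ g y := hgp ▸ (h.gmono hyp.1 hy.1.le hy'.2)
      have hgy2 : g y ≤ x + 2 * ε := hg2 ▸ (h.gmono hy'.1 hy.2.le hy2.2)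
      have hP := outer_anti h hε hxe hs hy'.1 (hy.2.le.trans h2y) hy1.2 hgy
      have hZi := ZZ_im_ge h x ε hε hy'
      have hZn : ‖ZZ g k (x + ε * Complex.I) y‖ ≤ 3 * K * ε := by
        rw [norm_ZZ]
        have hz : x ≤ ‖(x + ε * Complex.I : ℂ)‖ := by
          have := Complex.re_le_norm (x + ε * Complex.I : ℂ)
          simpa using this
        have hzpos : 0 < ‖(x + ε * Complex.I : ℂ)‖ := lt_of_lt_of_le (by linarith) hz
        have e1 : ‖(x + ε * Complex.I : ℂ) - g y‖ ≤ 3 * ε := by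
          have : (x + ε * Complex.I : ℂ) - g y = ((x - g y : ℝ) : ℂ) + ε * Complex.I := by push_cast; ring
          rw [this]
          refine (norm_add_le _ _).trans ?_
          rw [norm_mul, Complex.norm_I, Complex.norm_real, Complex.norm_real, Real.norm_eq_abs, Real.norm_eq_abs,
            abs_of_nonpos (by linarith), abs_of_pos hε]
          linarith
        have hyx : y ≤ 2 * x / c := by
          rw [le_div_iff₀ hc]
          nlinarith [(h.gb hy').1]
        have hk : k y ≤ 2 * C / c * x := by
          calc k y ≤ C * y := (h.kb hy').2
            _ ≤ C * (2 * x / c) := by gcongr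
            _ = _ := by ring
        have e2 : ‖(x + ε * Complex.I : ℂ) + k y‖ ≤ K * ‖(x + ε * Complex.I : ℂ)‖ := by
          refine (norm_add_le _ _).trans ?_
          rw [Complex.norm_real, Real.norm_eq_abs, abs_of_nonneg (h.knn hy'), hK, add_mul, one_mul]
          have : 2 * C / c * x ≤ 2 * C / c * ‖(x + ε * Complex.I : ℂ)‖ := by gcongr
          linarith
        rw [div_le_iff₀ hzpos]
        calc _ ≤ (K * ‖(x + ε * Complex.I : ℂ)‖) * (3 * ε) := by gcongr
          _ = _ := by ring
      have hZ0 := ZZ_ne h x ε hε hy'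
      have hZp : 0 < ‖ZZ g k (x + ε * Complex.I) y‖ := norm_pos_iff.2 hZ0
      calc ‖P y1‖ ^ 2 / (9 * K ^ 2 * ε) = ε * (‖P y1‖ / (3 * K * ε)) ^ 2 := by
            field_simp; ring
        _ ≤ (ZZ g k (x + ε * Complex.I) y).im * (‖P y‖ / ‖ZZ g k (x + ε * Complex.I) y‖) ^ 2 := by
            gcongr
            linarith
        _ ≤ _ := by
            rw [norm_div]
            have h1 : 0 ≤ α ^ 2 * ‖X y‖ ^ 2 := by positivity
            have h2 : 0 ≤ (ZZ g k (x + ε * Complex.I) y).im := by linarith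
            exact mul_le_mul_of_nonneg_left (by linarith) h2)
  have h3 : (P y2 * conj (X y2)).im ≤ 0 := (outer_sign h hε hxe hs hy2 (by linarith)).2
  have h4 : (P 0 * conj (X 0)).im ≤ (P yp * conj (X yp)).im :=
    le_of_deriv_nonneg hyp.1 ((Complex.continuous_im.comp_continuousOn hs.Mc).mono (Icc_subset_Icc le_rfl hyp.2))
      (fun t ht => (hs.Mim ⟨ht.1, lt_of_lt_of_le ht.2 hyp.2⟩ (ZZ_ne h x ε hε ⟨ht.1.le, ht.2.le.trans hyp.2⟩)))
      (fun t ht => mul_nonneg (by linarith [ZZ_im_ge h x ε hε ⟨ht.1.le, ht.2.le.trans hyp.2⟩]) (by positivity))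
  simp only [Function.comp_apply] at hm
  have h5 : (‖P y1‖ ^ 2 / (9 * K ^ 2 * ε)) * (y2 - yp) ≤ (JJ X P).im := by
    rw [JJ, Complex.neg_im]; linarith
  have h6 : ε / C ≤ y2 - yp := by
    rw [div_le_iff₀ hC]; linarith
  have h7 : (‖P y1‖ ^ 2 / (9 * K ^ 2 * ε)) * (ε / C) ≤ (JJ X P).im :=
    le_trans (by gcongr) h5
  have h8 : (‖P y1‖ ^ 2 / (9 * K ^ 2 * ε)) * (ε / C) = ‖P y1‖ ^ 2 / (9 * K ^ 2 * C) := by field_simp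
  rw [h8, div_le_iff₀ (by positivity)] at h7
  linarith

/-- Bound for X at y1 -/
theorem outer_X (h : HD g k g' k' g'' k'' c C) {α x ε : ℝ} (hε : 0 < ε)
    (hxe : 2 * ε < x) {X P : ℝ → ℂ} (hs : HS g k α (x + ε * Complex.I) X P)
    {y1 : ℝ} (hy1 : y1 ∈ Icc (0:ℝ) 1) (hg : g y1 = 2 * x) :
    ‖X y1‖ ≤ 2 * C / c ^ 2 * ‖P y1‖ := by
  have hc := h.hc
  have hC : 0 < C := hc.trans_le h.cC
  have hx : 0 < x := by linarith
  have hy1p : 2 * x / C ≤ y1 := by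
    rw [div_le_iff₀ hC]; linarith [(h.gb hy1).2]
  have hy10 : 0 < y1 := lt_of_lt_of_le (by positivity) hy1p
  have hsub : Icc y1 1 ⊆ Icc 0 1 := Icc_subset_Icc hy1.1 le_rfl
  have hsub2 : ∀ t ∈ Ioo y1 1, t ∈ Ioo (0:ℝ) 1 := fun t ht => ⟨lt_of_le_of_lt hy1.1 ht.1, ht.2⟩
  set D := ‖P y1‖ * (4 * x / c ^ 2) with hD
  have hm := norm_sub_le_of_deriv_le hy1.2 (G := fun y => - (D * y⁻¹))
    (G' := fun y => -(D * (-(y ^ 2)⁻¹))) (hs.Xc.mono hsub)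
    (((continuousOn_const.mul (continuousOn_id.inv₀ (fun y hy => (hy10.trans_le hy.1).ne')))).neg)
    (fun y hy => hs.Xd y (hsub2 y hy))
    (fun y hy => (((hasDerivAt_inv (hsub2 y hy).1.ne').const_mul D)).neg) (fun y hy => by
      have hy' := Ioo_subset_Icc_self (hsub2 y hy)
      have hy0 := (hsub2 y hy).1
      have hgy : 2 * x ≤ g y := hg ▸ (h.gmono hy1.1 hy.1.le hy'.2)
      have hP := outer_anti h hε hxe hs hy1.1 hy.1.le hy'.2 (by linarith)
      have hz : ‖(x + ε * Complex.I : ℂ)‖ ≤ 2 * x := by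
        refine (norm_add_le _ _).trans ?_
        rw [norm_mul, Complex.norm_I, Complex.norm_real, Complex.norm_real, Real.norm_eq_abs, Real.norm_eq_abs,
            abs_of_pos hε, abs_of_pos hx]
        linarith
      have hz0 : 0 < ‖(x + ε * Complex.I : ℂ)‖ := by
        have := Complex.re_le_norm (x + ε * Complex.I : ℂ)
        simp at this; linarith
      have e1 : c * y ≤ ‖(x + ε * Complex.I : ℂ) + k y‖ := by
        have := Complex.re_le_norm ((x + ε * Complex.I : ℂ) + k y)
        simp at this; linarith [(h.kb hy').1]
      have e2 : c * y / 2 ≤ ‖(x + ε * Complex.I : ℂ) - g y‖ := by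
        have := Complex.abs_re_le_norm ((x + ε * Complex.I : ℂ) - g y)
        simp at this
        rw [abs_of_nonpos (by linarith)] at this
        linarith [(h.gb hy').1]
      have e3 : c ^ 2 * y ^ 2 / (4 * x) ≤ ‖ZZ g k (x + ε * Complex.I) y‖ := by
        rw [norm_ZZ]
        calc c ^ 2 * y ^ 2 / (4 * x) = (c * y) * (c * y / 2) / (2 * x) := by field_simp; ring
          _ ≤ _ := by gcongr
      rw [norm_div]
      calc ‖P y‖ / ‖ZZ g k (x + ε * Complex.I) y‖ ≤ ‖P y1‖ / (c ^ 2 * y ^ 2 / (4 * x)) := by gcongr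
        _ = _ := by rw [hD]; field_simp)
  rw [hs.X1, zero_sub, norm_neg] at hm
  have hD0 : 0 ≤ D := by positivity
  have : D * y1⁻¹ ≤ D * (2 * x / C)⁻¹ := by gcongr
  calc ‖X y1‖ ≤ D * (2 * x / C)⁻¹ := by
        simp only [inv_one, mul_one] at hm; linarith
    _ = _ := by rw [hD]; field_simp; ring

end
end MHD

namespace MHD
section
open ComplexConjugate
variable {g k g' k' g'' k'' : ℝ → ℝ} {c C : ℝ} 

theorem gron_back {a b : ℝ} (hab : a ≤ b) {E E' A A' : ℝ → ℝ} {κ : ℝ}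
    (hE : ContinuousOn E (Icc a b)) (hA : ContinuousOn A (Icc a b))
    (hd : ∀ x ∈ Ioo a b, HasDerivAt E (E' x) x) (hdA : ∀ x ∈ Ioo a b, HasDerivAt A (A' x) x)
    (h : ∀ x ∈ Ioo a b, 0 ≤ E' x + κ * A' x * E x) : E a ≤ E b * Real.exp (κ * (A b - A a)) := by
  have := le_of_deriv_nonneg hab (f := fun y => E y * Real.exp (κ * A y))
    (f' := fun y => E' y * Real.exp (κ * A y) + E y * (Real.exp (κ * A y) * (κ * A' y)))
    (hE.mul (Real.continuous_exp.comp_continuousOn (continuousOn_const.mul hA)))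
    (fun y hy => (hd y hy).mul ((hdA y hy).const_mul κ).exp) (fun y hy => by
      have h1 := h y hy
      have h2 := Real.exp_pos (κ * A y)
      have := mul_nonneg h1 h2.le
      nlinarith)
  have e : Real.exp (κ * (A b - A a)) = Real.exp (κ * A b) / Real.exp (κ * A a) := by
    rw [← Real.exp_sub]; congr 1; ring
  rw [e, ← mul_div_assoc, le_div_iff₀ (Real.exp_pos _)]
  exact this

theorem norm_log_le {q : ℂ} : ‖Complex.log q‖ ≤ |Real.log ‖q‖| + Real.pi := by
  have h1 := Complex.norm_le_abs_re_add_abs_im (Complex.log q)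
  rw [Complex.log_re, Complex.log_im] at h1
  linarith [Complex.abs_arg_le_pi q]

theorem log_le_one {r : ℝ} (hr : 0 < r) (h2 : r ≤ 2) : Real.log r ≤ 1 := by
  have := Real.log_le_sub_one_of_pos hr; linarith

theorem r_log {r : ℝ} (hr : 0 < r) (h2 : r ≤ 2) : r * |Real.log r| ≤ 2 := by
  rcases le_total r 1 with h | h
  · have := Real.abs_log_mul_self_lt r hr h
    rw [abs_mul, abs_of_pos hr] at this
    linarith
  · rw [abs_of_nonneg (Real.log_nonneg h)]
    have := log_le_one hr h2
    have := Real.log_nonneg h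
    nlinarith

theorem r_L {q : ℂ} (hr : 0 < ‖q‖) (h2 : ‖q‖ ≤ 2) : ‖q‖ * ‖Complex.log q‖ ≤ 10 := by
  have h1 := r_log hr h2
  have h3 := @norm_log_le q
  have := Real.pi_lt_four
  have := Real.pi_pos
  calc ‖q‖ * ‖Complex.log q‖ ≤ ‖q‖ * (|Real.log ‖q‖| + Real.pi) := by gcongr
    _ ≤ 10 := by nlinarith

theorem L_l {q : ℂ} : ‖Complex.log q‖ ≤ 4 * (1 + |Real.log ‖q‖|) := by
  have h3 := @norm_log_le q
  have := Real.pi_lt_four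
  have := abs_nonneg (Real.log ‖q‖)
  linarith

set_option maxHeartbeats 1000000 in
/-- pointwise algebra for the inner region -/
theorem inner_point {Z Ψ Ψ' L X P Y : ℂ} {α x r l c C K0 : ℝ} (hc : 0 < c) (hx : 0 < x) (hxC : x ≤ C)
    (hK0 : 0 ≤ K0) (hr0 : 0 ≤ r) (hr2 : r ≤ 2)
    (hl : 1 ≤ l) (hL : ‖L‖ ≤ 4 * l) (hrL : r * ‖L‖ ≤ 10) (hΨ : ‖Ψ‖ ≤ 1 / c) (hΨ' : ‖Ψ'‖ ≤ K0 / x)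
    (hZ : ‖Z‖ ≤ K0 * x * r) (hY : Y = X + P * Ψ * L) :
    -(4 * (40 * α ^ 2 * K0 * C ^ 2 * (1 + 1 / c) ^ 2 + 4 * K0) * (l / x)) * (‖Y‖ ^ 2 + ‖P‖ ^ 2) ≤
      2 * inner ℝ Y (α ^ 2 * Z * X * (Ψ * L) + P * Ψ' * L) + 2 * inner ℝ P (α ^ 2 * Z * X) := by
  set κ := 40 * α ^ 2 * K0 * C ^ 2 * (1 + 1 / c) ^ 2 + 4 * K0
  have hC : 0 < C := hx.trans_le hxC
  have hXn : ‖X‖ ≤ ‖Y‖ + 1 / c * ‖L‖ * ‖P‖ := by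
    have : X = Y - P * Ψ * L := by rw [hY]; ring
    rw [this]
    refine (norm_sub_le _ _).trans ?_
    rw [norm_mul, norm_mul]
    have : ‖P‖ * ‖Ψ‖ * ‖L‖ ≤ ‖P‖ * (1 / c) * ‖L‖ := by gcongr
    linarith
  have hxx : x ≤ C ^ 2 / x := by rw [le_div_iff₀ hx]; nlinarith
  have hi : 0 < 1 / c := by positivity
  set i := 1 / c
  -- bound for Z * X
  have hs : 0 ≤ ‖Y‖ + ‖P‖ := by positivity
  have h1 : ‖Z‖ * ‖X‖ ≤ K0 * x * (10 * (1 + i)) * (‖Y‖ + ‖P‖) := by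
    calc ‖Z‖ * ‖X‖ ≤ (K0 * x * r) * (‖Y‖ + i * ‖L‖ * ‖P‖) := by gcongr
      _ = K0 * x * (r * ‖Y‖ + i * (r * ‖L‖) * ‖P‖) := by ring
      _ ≤ K0 * x * (2 * ‖Y‖ + i * 10 * ‖P‖) := by gcongr
      _ ≤ K0 * x * ((10 * (1 + i)) * (‖Y‖ + ‖P‖)) := by
        gcongr
        have := norm_nonneg Y
        have := norm_nonneg P
        nlinarith [mul_nonneg hi.le this, mul_nonneg hi.le (norm_nonneg Y)]
      _ = _ := by ring
  have hKi : (K0 * C ^ 2 * (10 * (1 + i))) * (4 * i) + 4 * K0 * 0 ≤ 40 * K0 * C ^ 2 * (1 + i) ^ 2 := by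
    have : 0 ≤ K0 * C ^ 2 := by positivity
    nlinarith [mul_nonneg this hi.le]
  have hKi2 : (K0 * C ^ 2 * (10 * (1 + i))) ≤ 40 * K0 * C ^ 2 * (1 + i) ^ 2 := by
    have : 0 ≤ K0 * C ^ 2 := by positivity
    nlinarith [mul_nonneg this hi.le, mul_nonneg this (sq_nonneg i)]
  have h2 : ‖Z‖ * ‖X‖ ≤ K0 * C ^ 2 * (10 * (1 + i)) * (1 / x) * (‖Y‖ + ‖P‖) := by
    refine h1.trans ?_
    have : K0 * x * (10 * (1 + i)) ≤ K0 * (C ^ 2 / x) * (10 * (1 + i)) := by gcongr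
    calc _ ≤ K0 * (C ^ 2 / x) * (10 * (1 + i)) * (‖Y‖ + ‖P‖) := by gcongr
      _ = _ := by ring
  have hlx : 0 ≤ l / x := by positivity
  have hP' : ‖(α : ℂ) ^ 2 * Z * X‖ ≤ κ * (l / x) * (‖Y‖ + ‖P‖) := by
    rw [mul_assoc, norm_mul, norm_mul, norm_pow, Complex.norm_real, Real.norm_eq_abs, sq_abs]
    calc _ ≤ α ^ 2 * (K0 * C ^ 2 * (10 * (1 + i)) * (1 / x) * (‖Y‖ + ‖P‖)) := by gcongr
      _ ≤ α ^ 2 * (40 * K0 * C ^ 2 * (1 + i) ^ 2 * (l / x) * (‖Y‖ + ‖P‖)) := by gcongr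
      _ ≤ κ * (l / x) * (‖Y‖ + ‖P‖) := by
        rw [← mul_assoc, ← mul_assoc]
        gcongr
        have : 0 ≤ 4 * K0 := by positivity
        simp only [κ]; nlinarith
  have hY' : ‖(α : ℂ) ^ 2 * Z * X * (Ψ * L) + P * Ψ' * L‖ ≤ κ * (l / x) * (‖Y‖ + ‖P‖) := by
    refine (norm_add_le _ _).trans ?_
    rw [mul_assoc _ Z X]
    simp only [norm_mul]
    rw [norm_pow, Complex.norm_real, Real.norm_eq_abs, sq_abs]
    calc _ ≤ α ^ 2 * (K0 * C ^ 2 * (10 * (1 + i)) * (1 / x) * (‖Y‖ + ‖P‖)) * (i * (4 * l)) +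
          ‖P‖ * (K0 / x) * (4 * l) := by gcongr
      _ = α ^ 2 * ((K0 * C ^ 2 * (10 * (1 + i))) * (4 * i) + 4 * K0 * 0) * (l / x) * (‖Y‖ + ‖P‖) + 4 * K0 * (l / x) * ‖P‖ := by
        field_simp; ring
      _ ≤ α ^ 2 * (40 * K0 * C ^ 2 * (1 + i) ^ 2) * (l / x) * (‖Y‖ + ‖P‖) + 4 * K0 * (l / x) * (‖Y‖ + ‖P‖) := by
        gcongr
        have := norm_nonneg Y
        linarith
      _ = _ := by simp only [κ]; ring
  have i1 := abs_le.1 (abs_real_inner_le_norm Y (α ^ 2 * Z * X * (Ψ * L) + P * Ψ' * L))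
  have i2 := abs_le.1 (abs_real_inner_le_norm P (α ^ 2 * Z * X))
  have i3 : ‖Y‖ * ‖(α : ℂ) ^ 2 * Z * X * (Ψ * L) + P * Ψ' * L‖ ≤ ‖Y‖ * (κ * (l / x) * (‖Y‖ + ‖P‖)) := by gcongr
  have i4 : ‖P‖ * ‖(α : ℂ) ^ 2 * Z * X‖ ≤ ‖P‖ * (κ * (l / x) * (‖Y‖ + ‖P‖)) := by gcongr
  have hκ : 0 ≤ κ * (l / x) := by positivity
  have i5 : (‖Y‖ + ‖P‖) ^ 2 ≤ 2 * (‖Y‖ ^ 2 + ‖P‖ ^ 2) := by nlinarith [sq_nonneg (‖Y‖ - ‖P‖)]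
  have i6 := mul_le_mul_of_nonneg_left i5 hκ
  nlinarith
end
end MHD

namespace MHD
section
open ComplexConjugate
variable {g k g' k' g'' k'' : ℝ → ℝ} {c C : ℝ} 

noncomputable def qq (g : ℝ → ℝ) (x ε : ℝ) (y : ℝ) : ℂ := ((x + ε * Complex.I : ℂ) - g y) / x

noncomputable def Psi (k g' : ℝ → ℝ) (z : ℂ) (y : ℝ) : ℂ := z / ((z + k y) * g' y)
noncomputable def Psi' (k g' k' g'' : ℝ → ℝ) (z : ℂ) (y : ℝ) : ℂ :=
  - Psi k g' z y * (k' y / (z + k y) + g'' y / g' y)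

theorem qq_re (x ε : ℝ) (hx : 0 < x) (y : ℝ) : (qq g x ε y).re = (x - g y) / x := by
  simp [qq, Complex.div_re, Complex.normSq_apply]; field_simp
theorem qq_im (x ε : ℝ) (hx : 0 < x) (y : ℝ) : (qq g x ε y).im = ε / x := by
  simp [qq, Complex.div_im, Complex.normSq_apply]; field_simp

theorem qq_pos {x ε : ℝ} (hx : 0 < x) (hε : 0 < ε) (y : ℝ) : 0 < ‖qq g x ε y‖ := by
  rw [norm_pos_iff]
  intro h
  have := qq_im (g := g) x ε hx y
  rw [h] at this
  have h2 : 0 < ε / x := by positivity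
  simp at this; linarith

theorem qq_slit {x ε : ℝ} (hx : 0 < x) (hε : 0 < ε) (y : ℝ) : qq g x ε y ∈ Complex.slitPlane := by
  right
  rw [qq_im x ε hx]; positivity

theorem qq_le {x ε : ℝ} (hx : 0 < x) (hε : 0 < ε) (hxe : 2 * ε < x) {y : ℝ} (h0 : 0 ≤ g y) (h1 : g y ≤ 2 * x) :
    ‖qq g x ε y‖ ≤ 2 := by
  have h := Complex.norm_le_abs_re_add_abs_im (qq g x ε y)
  rw [qq_re x ε hx, qq_im x ε hx] at h
  have a1 : |(x - g y) / x| ≤ 1 := by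
    rw [abs_div, abs_of_pos hx, div_le_one hx, abs_le]; constructor <;> linarith
  have a2 : |ε / x| ≤ 1 := by
    rw [abs_div, abs_of_pos hx, abs_of_pos hε, div_le_one hx]; linarith
  linarith

theorem qq_cont {x ε : ℝ} {s : Set ℝ} (h : ContinuousOn g s) : ContinuousOn (qq g x ε) s := by
  unfold qq
  exact (continuousOn_const.sub (Complex.continuous_ofReal.comp_continuousOn h)).div_const _

theorem qq_deriv {x ε y d : ℝ} (h : HasDerivAt g d y) : HasDerivAt (qq g x ε) (-(d:ℂ) / x) y := by
  unfold qq
  have := ((hasDerivAt_const y (x + ε * Complex.I : ℂ)).sub h.ofReal_comp).div_const (x:ℂ)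
  simpa using this

theorem zk_norm {x ε κ : ℝ} (hx : 0 < x) (hk : 0 ≤ κ) :
    ‖(x + ε * Complex.I : ℂ)‖ ≤ ‖(x + ε * Complex.I : ℂ) + κ‖ ∧ x ≤ ‖(x + ε * Complex.I : ℂ) + κ‖ := by
  constructor
  · rw [← sq_le_sq₀ (norm_nonneg _) (norm_nonneg _), Complex.sq_norm, Complex.sq_norm, Complex.normSq_apply, Complex.normSq_apply]
    simp
    nlinarith
  · have := Complex.abs_re_le_norm ((x + ε * Complex.I : ℂ) + κ)
    simp at this
    have := le_abs_self (x + κ)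
    linarith

theorem inner_main (h : HD g k g' k' g'' k'' c C) {α x ε : ℝ} (hε : 0 < ε)
    (hxe : 2 * ε < x) (hxC : x ≤ C) {X P : ℝ → ℂ} (hs : HS g k α (x + ε * Complex.I) X P)
    {y1 : ℝ} (hy1 : y1 ∈ Icc (0:ℝ) 1) (hg : g y1 ≤ 2 * x) (Y : ℝ → ℂ)
    (hY : ∀ y, Y y = X y + P y * Psi k g' (x + ε * Complex.I) y * Complex.log (qq g x ε y)) (K0 : ℝ)
    (hK0 : K0 = (C + C ^ 2 / c) / c + (1 + 2 * C / c)) :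
    ‖Y 0‖ ^ 2 + ‖P 0‖ ^ 2 ≤ (‖Y y1‖ ^ 2 + ‖P y1‖ ^ 2) *
      Real.exp ((4 * (40 * α ^ 2 * K0 * C ^ 2 * (1 + 1 / c) ^ 2 + 4 * K0)) * (28 / c)) := by
  have hc := h.hc
  have hC : 0 < C := hc.trans_le h.cC
  have hx : 0 < x := by linarith
  have hK0' : 0 ≤ K0 := by rw [hK0]; positivity
  set z : ℂ := x + ε * Complex.I with hz
  have hz0 : z ≠ 0 := by
    intro h0
    have : z.re = x := by simp [hz]
    rw [h0] at this; simp at this; linarith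
  have hsub : Icc 0 y1 ⊆ Icc 0 1 := Icc_subset_Icc_right hy1.2
  have hsub2 : Ioo 0 y1 ⊆ Ioo 0 1 := Ioo_subset_Ioo_right hy1.2
  have hzk : ∀ y ∈ Icc (0:ℝ) 1, z + k y ≠ 0 := fun y hy h0 => by
    have := (zk_norm (ε := ε) hx (h.knn hy)).2
    rw [← hz, h0] at this; simp at this; linarith
  have hg'0 : ∀ y ∈ Icc (0:ℝ) 1, ((g' y : ℝ) : ℂ) ≠ 0 := fun y hy h0 => by
    have := h.gl y hy
    rw [Complex.ofReal_eq_zero] at h0; linarith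
  have hgy : ∀ y ∈ Icc 0 y1, g y ≤ 2 * x := fun y hy => (h.gmono hy.1 hy.2 hy1.2).trans hg
  have hΨc : ContinuousOn (Psi k g' z) (Icc 0 1) := by
    unfold Psi
    refine continuousOn_const.div (((continuousOn_const.add (Complex.continuous_ofReal.comp_continuousOn h.kc))).mul
      (Complex.continuous_ofReal.comp_continuousOn h.gc')) ?_
    exact fun y hy => mul_ne_zero (hzk y hy) (hg'0 y hy)
  have hΨd : ∀ y ∈ Ioo (0:ℝ) 1, HasDerivAt (Psi k g' z) (Psi' k g' k' g'' z y) y := fun y hy => by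
    have hy' := Ioo_subset_Icc_self hy
    have a1 := ((hasDerivAt_const y z).add (h.kd y hy).ofReal_comp).mul (h.gdd y hy).ofReal_comp
    have a2 := (hasDerivAt_const y z).div a1 (mul_ne_zero (hzk y hy') (hg'0 y hy'))
    refine HasDerivAt.congr_deriv a2 ?_
    have b1 := hzk y hy'
    have b2 := hg'0 y hy'
    simp only [Psi', Psi, Pi.add_apply, Pi.mul_apply]
    field_simp
    ring
  have hqc : ContinuousOn (qq g x ε) (Icc 0 1) := qq_cont h.gc
  have hLc : ContinuousOn (fun y => Complex.log (qq g x ε y)) (Icc 0 1) :=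
    hqc.clog (fun y _ => qq_slit hx hε y)
  have hLd : ∀ y ∈ Ioo (0:ℝ) 1, HasDerivAt (fun y => Complex.log (qq g x ε y))
      ((-(g' y : ℂ) / x) / qq g x ε y) y := fun y hy =>
    (qq_deriv (h.gd y hy)).clog_real (qq_slit hx hε y)
  have hYc : ContinuousOn Y (Icc 0 1) := by
    have : ContinuousOn (fun y => X y + P y * Psi k g' z y * Complex.log (qq g x ε y)) (Icc 0 1) :=
      hs.Xc.add ((hs.Pc.mul hΨc).mul hLc)
    exact this.congr (fun y _ => hY y)
  have hYd : ∀ y ∈ Ioo (0:ℝ) 1, HasDerivAt Y (α ^ 2 * ZZ g k z y * X y * (Psi k g' z y * Complex.log (qq g x ε y))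
      + P y * Psi' k g' k' g'' z y * Complex.log (qq g x ε y)) y := fun y hy => by
    have hy' := Ioo_subset_Icc_self hy
    have a1 := (hs.Xd y hy).add (((hs.Pd y hy).mul (hΨd y hy)).mul (hLd y hy))
    have a2 : Y = X + (P * Psi k g' z) * (fun y => Complex.log (qq g x ε y)) := funext hY
    rw [a2]
    refine HasDerivAt.congr_deriv a1 ?_
    have b1 := hzk y hy'
    have b2 := hg'0 y hy'
    have b3 : z - g y ≠ 0 := by
      have := qq_pos (g := g) hx hε y
      rw [norm_pos_iff, qq] at this
      exact fun h0 => this (by rw [← hz, h0]; simp)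
    have b4 : (x : ℂ) ≠ 0 := by exact_mod_cast hx.ne'
    have : P y / ZZ g k z y + P y * Psi k g' z y * ((-(g' y : ℂ) / x) / qq g x ε y) = 0 := by
      simp only [ZZ, Psi, qq, ← hz]
      field_simp
      ring
    simp only [Pi.mul_apply]
    linear_combination this
  have hgron := gron_back hy1.1 (E := fun y => ‖Y y‖ ^ 2 + ‖P y‖ ^ 2)
    (A := fun y => (1 / c) * ((qq g x ε y * Complex.log (qq g x ε y)).re + 4 * (g y / x)))
    (A' := fun y => (1 / c) * ((-(g' y) / x) * (Real.log ‖qq g x ε y‖ + 1) + 4 * (g' y / x)))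
    (κ := 4 * (40 * α ^ 2 * K0 * C ^ 2 * (1 + 1 / c) ^ 2 + 4 * K0))
    (((hYc.norm.pow 2).add (hs.Pc.norm.pow 2)).mono hsub)
    ((continuousOn_const.mul ((Complex.continuous_re.comp_continuousOn (hqc.mul hLc)).add
      (continuousOn_const.mul (h.gc.div_const _)))).mono hsub)
    (fun y hy => (hYd y (hsub2 hy)).norm_sq.add (hs.Pd y (hsub2 hy)).norm_sq)
    (fun y hy => by
      have a1 := (qq_deriv (ε := ε) (x := x) (h.gd y (hsub2 hy))).mul (hLd y (hsub2 hy))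
      have a2 := (Complex.reCLM.hasFDerivAt.comp_hasDerivAt y a1).add (((h.gd y (hsub2 hy)).div_const x).const_mul 4)
      refine (a2.const_mul (1 / c)).congr_deriv ?_
      congr 2
      have : qq g x ε y ≠ 0 := norm_pos_iff.1 (qq_pos hx hε y)
      rw [Complex.reCLM_apply, mul_div_cancel₀ _ this, ← Complex.log_re]
      have : -(g' y : ℂ) / x * Complex.log (qq g x ε y) + -(g' y : ℂ) / x = ((-(g' y) / x : ℝ) : ℂ) * (Complex.log (qq g x ε y) + 1) := by
        push_cast; ring
      rw [this, Complex.re_ofReal_mul]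
      simp)
    (fun y hy => by
      have hy0 := Ioo_subset_Icc_self hy
      have hy' := Ioo_subset_Icc_self (hsub2 hy)
      set r := ‖qq g x ε y‖ with hr
      have hr0 : 0 < r := qq_pos hx hε y
      have hr2 : r ≤ 2 := qq_le hx hε hxe (h.gnn hy') (hgy y hy0)
      have hk0 := h.knn hy'
      have hzk1 := zk_norm (ε := ε) hx hk0
      rw [← hz] at hzk1
      have hzx : x ≤ ‖z‖ := by
        have := Complex.abs_re_le_norm z
        have e : z.re = x := by simp [hz]
        rw [e] at this
        exact (le_abs_self x).trans this
      have hg' := h.gl y hy'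
      have hΨ : ‖Psi k g' z y‖ ≤ 1 / c := by
        rw [Psi, norm_div, norm_mul, Complex.norm_real, Real.norm_of_nonneg (by linarith),
          div_le_div_iff₀ (by have := hx.trans_le hzk1.2; have := hc.trans_le hg'; positivity) hc, one_mul]
        exact mul_le_mul hzk1.1 hg' hc.le (norm_nonneg _)
      have key := inner_point (Z := ZZ g k z y) (Ψ := Psi k g' z y) (Ψ' := Psi' k g' k' g'' z y)
        (L := Complex.log (qq g x ε y)) (X := X y) (P := P y) (Y := Y y) (α := α) (x := x)
        (r := r) (l := 1 + |Real.log r|) (c := c) (C := C) (K0 := K0) hc hx hxC hK0' hr0.le hr2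
        (by linarith [abs_nonneg (Real.log r)]) L_l (r_L hr0 hr2) hΨ
        (by
          rw [Psi', norm_mul, norm_neg]
          have e1 : ‖(k' y : ℂ) / (z + k y) + (g'' y : ℂ) / g' y‖ ≤ C / x + C / c := by
            refine (norm_add_le _ _).trans ?_
            rw [norm_div, norm_div, Complex.norm_real, Complex.norm_real, Complex.norm_real,
              Real.norm_of_nonneg (hc.le.trans (h.kl y hy')), Real.norm_of_nonneg (hc.le.trans hg'), Real.norm_eq_abs]
            have := h.ku y hy'
            have := h.g2 y (hsub2 hy)
            gcongr
            exact hzk1.2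
          calc _ ≤ 1 / c * (C / x + C / c) := by gcongr
            _ ≤ 1 / c * (C / x + C * (C / x) / c) := by
              gcongr
              have : 1 ≤ C / x := by rw [le_div_iff₀ hx]; linarith
              nlinarith
            _ = ((C + C ^ 2 / c) / c) / x := by field_simp
            _ ≤ K0 / x := by
              gcongr; rw [hK0]
              have : 0 ≤ (1 + 2 * C / c) := by positivity
              linarith)
        (by
          rw [norm_ZZ]
          have e1 : ‖z + k y‖ ≤ (1 + 2 * C / c) * ‖z‖ := by
            refine (norm_add_le _ _).trans ?_
            rw [Complex.norm_real, Real.norm_of_nonneg hk0]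
            have e2 := (h.kb hy').2
            have e3 := (h.gb hy').1
            have e4 := hgy y hy0
            have e5 : y ≤ 2 * x / c := by rw [le_div_iff₀ hc]; linarith
            have e6 : C * y ≤ C * (2 * x / c) := by gcongr
            have e7 : C * (2 * x / c) ≤ C * (2 * ‖z‖ / c) := by gcongr
            have e8 : C * (2 * ‖z‖ / c) = 2 * C / c * ‖z‖ := by ring
            linarith
          have e2 : ‖z - g y‖ = x * r := by
            rw [hr, qq, norm_div, Complex.norm_real, Real.norm_of_nonneg hx.le]; field_simp
            rfl
          have hzp : 0 < ‖z‖ := norm_pos_iff.2 hz0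
          rw [div_le_iff₀ hzp, e2]
          calc _ ≤ ((1 + 2 * C / c) * ‖z‖) * (x * r) := by gcongr
            _ = (1 + 2 * C / c) * x * r * ‖z‖ := by ring
            _ ≤ K0 * x * r * ‖z‖ := by
              gcongr; rw [hK0]
              have : 0 ≤ (C + C ^ 2 / c) / c := by positivity
              linarith)
        (hY y)
      set κ := 4 * (40 * α ^ 2 * K0 * C ^ 2 * (1 + 1 / c) ^ 2 + 4 * K0)
      have hκ : 0 ≤ κ := by positivity
      have hl : (1 + |Real.log r|) / x ≤ (1 / c) * ((-(g' y) / x) * (Real.log r + 1) + 4 * (g' y / x)) := by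
        have e0 := log_le_one hr0 hr2
        have e1 : |Real.log r| ≤ 2 - Real.log r := by
          rw [abs_le]; constructor <;> linarith
        have e2 : 1 ≤ g' y / c := by rw [le_div_iff₀ hc]; linarith
        have e3 : 0 ≤ 3 - Real.log r := by linarith
        calc _ ≤ (3 - Real.log r) / x := by gcongr; linarith
          _ ≤ (g' y / c * (3 - Real.log r)) / x := by gcongr; nlinarith
          _ = _ := by field_simp; ring
      have hE : 0 ≤ ‖Y y‖ ^ 2 + ‖P y‖ ^ 2 := by positivity
      have := mul_le_mul_of_nonneg_right (mul_le_mul_of_nonneg_left hl hκ) hE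
      linarith)
  refine hgron.trans ?_
  have hb : ∀ y ∈ Icc (0:ℝ) y1, |(qq g x ε y * Complex.log (qq g x ε y)).re| ≤ 10 := fun y hy => by
    refine (Complex.abs_re_le_norm _).trans ?_
    rw [norm_mul]
    exact r_L (qq_pos hx hε y) (qq_le hx hε hxe (h.gnn (hsub hy)) (hgy y hy))
  have b0 := abs_le.1 (hb 0 ⟨le_rfl, hy1.1⟩)
  have b1 := abs_le.1 (hb y1 ⟨hy1.1, le_rfl⟩)
  have b2 : g y1 / x ≤ 2 := by rw [div_le_iff₀ hx]; exact hg
  rw [h.g0]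
  gcongr
  rw [← mul_sub]
  have : 0 < 1 / c := by positivity
  have e : 28 / c = 1 / c * 28 := by ring
  rw [e]
  gcongr
  simp only [zero_div]
  linarith
end
end MHD

namespace MHD
section
open ComplexConjugate
variable {g k g' k' g'' k'' : ℝ → ℝ} {c C : ℝ} 

theorem alg1 {A B Λ Y P : ℝ} (hY0 : 0 ≤ Y) (hΛ : 1 ≤ Λ) (hY : Y ≤ (A + B * Λ) * P) :
    Y ^ 2 + P ^ 2 ≤ (2 * A ^ 2 + 2 * B ^ 2 + 1) * Λ ^ 2 * P ^ 2 := by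
  have hsq : 1 ≤ Λ ^ 2 := by nlinarith
  have t1 := mul_le_mul_of_nonneg_left hsq (sq_nonneg A)
  have e1 : Y ^ 2 ≤ ((A + B * Λ) * P) ^ 2 := pow_le_pow_left₀ hY0 hY 2
  have e2 : (A + B * Λ) ^ 2 + 1 ≤ (2 * A ^ 2 + 2 * B ^ 2 + 1) * Λ ^ 2 := by
    nlinarith [sq_nonneg (A - B * Λ)]
  have e3 := mul_le_mul_of_nonneg_right e2 (sq_nonneg P)
  linarith [mul_pow (A + B * Λ) P 2]

set_option maxHeartbeats 1000000 in
theorem half_R2 (h : HD g k g' k' g'' k'' c C) (α : ℝ) : ∃ K > 0, ∀ x ε : ℝ, 0 < ε →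
    2 * ε < x → x < g 1 - 2 * ε → ∀ X P : ℝ → ℂ, HS g k α (x + ε * Complex.I) X P →
    ‖X 0‖ ^ 2 ≤ K * (1 + |Real.log (g 1 - x)|) ^ 2 * (JJ X P).im := by
  have hc := h.hc
  have hC : 0 < C := hc.trans_le h.cC
  obtain ⟨K0, hK0⟩ : ∃ K0, K0 = (C + C ^ 2 / c) / c + (1 + 2 * C / c) := ⟨_, rfl⟩
  set Ex := Real.exp ((4 * (40 * α ^ 2 * K0 * C ^ 2 * (1 + 1 / c) ^ 2 + 4 * K0)) * (28 / c)) with hEx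
  set K1 := 2 * (2 * C / c ^ 2) ^ 2 + 2 * ((5 + C) / c) ^ 2 + 1 with hK1
  refine ⟨2 * (1 + (5 / c) ^ 2) * (K1 * (9 * (1 + 2 * C / c) ^ 2 * C) * Ex), by positivity, ?_⟩
  intro x ε hε hxe hx1 X P hs
  have hx : 0 < x := by linarith
  have hg1 : g 1 ≤ C := by simpa using (h.gb (y := 1) (by simp)).2
  have hxC : x ≤ C := by linarith
  have hJ := J_im_nonneg h hε hs
  set Λ := 1 + |Real.log (g 1 - x)| with hΛ
  have hΛ1 : 1 ≤ Λ := by linarith [abs_nonneg (Real.log (g 1 - x))]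
  have hpi := Real.pi_lt_four
  -- choose y1
  have hL1 : ∀ q : ℂ, 1 ≤ ‖q‖ → ‖q‖ ≤ 2 → ‖Complex.log q‖ ≤ 5 := fun q h1 h2 => by
    have e1 := @norm_log_le q
    rw [abs_of_nonneg (Real.log_nonneg h1)] at e1
    have e2 := log_le_one (by linarith) h2
    linarith
  have hΨ : ∀ y ∈ Icc (0:ℝ) 1, ‖Psi k g' (x + ε * Complex.I) y‖ ≤ 1 / c := fun y hy => by
    have hzk1 := zk_norm (ε := ε) hx (h.knn hy)
    have hg' := h.gl y hy
    rw [Psi, norm_div, norm_mul, Complex.norm_real, Real.norm_of_nonneg (by linarith),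
          div_le_div_iff₀ (by have := hx.trans_le hzk1.2; have := hc.trans_le hg'; positivity) hc, one_mul]
    exact mul_le_mul hzk1.1 hg' hc.le (norm_nonneg _)
  obtain ⟨y1, hy1, hgy1, hgy2, hXy, hLy⟩ : ∃ y1 ∈ Icc (0:ℝ) 1, g y1 ≤ 2 * x ∧ x + 2 * ε ≤ g y1 ∧
      ‖X y1‖ ≤ 2 * C / c ^ 2 * ‖P y1‖ ∧ ‖Complex.log (qq g x ε y1)‖ ≤ (5 + C) * Λ := by
    rcases le_total (g 1) (2 * x) with h2 | h2
    · refine ⟨1, by simp, h2, by linarith, ?_, ?_⟩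
      · rw [hs.X1]; simp; positivity
      · have hq2 := qq_le hx hε hxe (h.gnn (y := 1) (by simp)) h2
        have hq0 := qq_pos (g := g) hx hε 1
        have e1 := @norm_log_le (qq g x ε 1)
        have hd : 0 < g 1 - x := by linarith
        have e2 : (g 1 - x) / x ≤ ‖qq g x ε 1‖ := by
          have := Complex.abs_re_le_norm (qq g x ε 1)
          rw [qq_re x ε hx] at this
          refine le_trans ?_ this
          rw [abs_div, abs_of_pos hx, abs_sub_comm]
          gcongr; exact le_abs_self _
        have e3 : Real.log (g 1 - x) - Real.log x ≤ Real.log ‖qq g x ε 1‖ := by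
          rw [← Real.log_div hd.ne' hx.ne']
          exact Real.log_le_log (by positivity) e2
        have e4 := log_le_one hq0 hq2
        have e5 := Real.log_le_sub_one_of_pos hx
        have e6 := neg_abs_le (Real.log (g 1 - x))
        have e7 : |Real.log ‖qq g x ε 1‖| ≤ C + |Real.log (g 1 - x)| + 1 := by
          rw [abs_le]; constructor
          · linarith
          · linarith [abs_nonneg (Real.log (g 1 - x))]
        have : 0 ≤ |Real.log (g 1 - x)| := abs_nonneg _
        nlinarith
    · obtain ⟨y1, hy1, hgy⟩ := h.exists_eq (v := 2 * x) (by linarith) h2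
      refine ⟨y1, hy1, hgy.le, by linarith, outer_X h hε hxe hs hy1 hgy, ?_⟩
      have := hL1 (qq g x ε y1) ?_ (qq_le hx hε hxe (h.gnn hy1) hgy.le)
      · nlinarith
      · have := Complex.abs_re_le_norm (qq g x ε y1)
        rw [qq_re x ε hx, hgy] at this
        have e : (x - 2 * x) / x = -1 := by field_simp; ring
        rw [e] at this
        simpa using this
  have hP := outer_P h hε hxe hx1 hs hy1 hgy2
  have hmain := inner_main h hε hxe hxC hs hy1 hgy1 _ (fun y => rfl) K0 hK0
  rw [← hEx] at hmain
  have hL0 : ‖Complex.log (qq g x ε 0)‖ ≤ 5 := by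
    apply hL1 _ ?_ (qq_le hx hε hxe (by rw [h.g0]) (by rw [h.g0]; linarith))
    have := Complex.abs_re_le_norm (qq g x ε 0)
    rw [qq_re x ε hx, h.g0] at this
    have e : (x - 0) / x = 1 := by field_simp; ring
    rw [e] at this
    simpa using this
  set Y : ℝ → ℂ := fun y => X y + P y * Psi k g' (x + ε * Complex.I) y * Complex.log (qq g x ε y) with hY
  have hX0 : ‖X 0‖ ≤ ‖Y 0‖ + 5 / c * ‖P 0‖ := by
    have e : X 0 = Y 0 - P 0 * Psi k g' (x + ε * Complex.I) 0 * Complex.log (qq g x ε 0) := by simp [hY]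
    rw [e]
    refine (norm_sub_le _ _).trans ?_
    rw [norm_mul, norm_mul]
    have := hΨ 0 (by simp)
    have e2 : ‖P 0‖ * ‖Psi k g' (x + ε * Complex.I) 0‖ * ‖Complex.log (qq g x ε 0)‖ ≤ ‖P 0‖ * (1 / c) * 5 := by gcongr
    have e3 : ‖P 0‖ * (1 / c) * 5 = 5 / c * ‖P 0‖ := by ring
    linarith
  have hX0' : ‖X 0‖ ^ 2 ≤ 2 * (1 + (5 / c) ^ 2) * (‖Y 0‖ ^ 2 + ‖P 0‖ ^ 2) := by
    calc ‖X 0‖ ^ 2 ≤ (‖Y 0‖ + 5 / c * ‖P 0‖) ^ 2 := by gcongr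
      _ ≤ _ := by
        nlinarith [sq_nonneg (‖Y 0‖ - 5 / c * ‖P 0‖), sq_nonneg (5 / c * ‖Y 0‖), sq_nonneg (‖P 0‖)]
  have hY1 : ‖Y y1‖ ≤ (2 * C / c ^ 2 + (5 + C) / c * Λ) * ‖P y1‖ := by
    refine (norm_add_le _ _).trans ?_
    rw [norm_mul, norm_mul]
    have := hΨ y1 hy1
    have e2 : ‖P y1‖ * ‖Psi k g' (x + ε * Complex.I) y1‖ * ‖Complex.log (qq g x ε y1)‖ ≤ ‖P y1‖ * (1 / c) * ((5 + C) * Λ) := by gcongr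
    have e3 : ‖P y1‖ * (1 / c) * ((5 + C) * Λ) = (5 + C) / c * Λ * ‖P y1‖ := by ring
    linarith
  have hY1' : ‖Y y1‖ ^ 2 + ‖P y1‖ ^ 2 ≤ K1 * Λ ^ 2 * ‖P y1‖ ^ 2 := by
    exact alg1 (norm_nonneg _) hΛ1 hY1
  calc ‖X 0‖ ^ 2 ≤ _ := hX0'
    _ ≤ 2 * (1 + (5 / c) ^ 2) * ((‖Y y1‖ ^ 2 + ‖P y1‖ ^ 2) * Ex) := by gcongr
    _ ≤ 2 * (1 + (5 / c) ^ 2) * ((K1 * Λ ^ 2 * (9 * (1 + 2 * C / c) ^ 2 * C * (JJ X P).im)) * Ex) := by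
      gcongr
      exact hY1'.trans (by gcongr)
    _ = _ := by ring
end
end MHD

namespace MHD
section
open ComplexConjugate

theorem le_of_sq_le_mul {a L : ℝ} (ha : 0 ≤ a) (hL : 0 ≤ L) (h : a ^ 2 ≤ L * a) : a ≤ L := by
  rcases ha.eq_or_lt with rfl | h0
  · exact hL
  · nlinarith

theorem pos_side {g k g' k' g'' k'' G K G' K' G'' K'' : ℝ → ℝ} {c C : ℝ} (h1 : HD g k g' k' g'' k'' c C)
    (h2 : HD G K G' K' G'' K'' c C) (hge : G 1 ≤ g 1) (α : ℝ) :
    ∃ M > 0, ∀ x ε : ℝ, 0 ≤ x → x ≠ g 1 → 0 < ε → ε ≤ 1 → ∀ X P X2 P2 : ℝ → ℂ,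
      HS g k α (x + ε * Complex.I) X P → HS G K α (x + ε * Complex.I) X2 P2 → X2 0 = X 0 →
      ‖JJ X P + JJ X2 P2‖ ≤ ‖X 0‖ →
      (x ≤ C + 2 → ‖X 0‖ ≤ M * (1 + |Real.log (|x - g 1|)|) ^ 2) ∧ (C + 2 < x → ‖X 0‖ ≤ M / x) := by
  obtain ⟨M0, hM0, hR2⟩ := half_R2 h1 α
  have hc := h1.hc
  have hC : 0 < C := hc.trans_le h1.cC
  have hg1 : g 1 ≤ C := by simpa using (h1.gb (y := 1) (by simp)).2
  have hg10 : 0 ≤ g 1 := h1.gnn (by simp)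
  refine ⟨6 / c + M0 + (4 / c) * (2 * C + 3 + 2 * c) + 4 * (C + 2), by positivity, ?_⟩
  intro x ε hx hxne hε hε1 X P X2 P2 hs1 hs2 h0 hJ
  set M := 6 / c + M0 + (4 / c) * (2 * C + 3 + 2 * c) + 4 * (C + 2) with hM
  have p1 : 0 < 6 / c := by positivity
  have p2 : 0 < (4 / c) * (2 * C + 3 + 2 * c) := by positivity
  have p3 : 0 < 4 * (C + 2) := by positivity
  have j1 := J_im_nonneg h1 hε hs1
  have j2 := J_im_nonneg h2 hε hs2
  have him : (JJ X P).im ≤ ‖X 0‖ := by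
    have := (Complex.abs_im_le_norm (JJ X P + JJ X2 P2)).trans hJ
    rw [Complex.add_im] at this
    linarith [le_abs_self ((JJ X P).im + (JJ X2 P2).im)]
  set Λ := 1 + |Real.log (|x - g 1|)| with hΛ
  have hΛ1 : 1 ≤ Λ := by linarith [abs_nonneg (Real.log (|x - g 1|))]
  have hΛ2 : 1 ≤ Λ ^ 2 := by nlinarith
  have hd : 0 < |x - g 1| := abs_pos.2 (sub_ne_zero.2 hxne)
  rcases le_or_gt x (2 * ε) with r0 | r0
  · have := half_R0 h1 hε hx r0 hs1
    have hb : ‖X 0‖ ≤ 6 / c := le_of_sq_le_mul (norm_nonneg _) p1.le (this.trans (by gcongr))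
    constructor
    · intro _
      nlinarith
    · intro hh; linarith
  rcases lt_or_ge x (g 1 - 2 * ε) with r2 | r1
  · have := hR2 x ε hε r0 r2 X P hs1
    have e : |x - g 1| = g 1 - x := by rw [abs_sub_comm, abs_of_pos (by linarith)]
    rw [← e, ← hΛ] at this
    have hb : ‖X 0‖ ≤ M0 * Λ ^ 2 := le_of_sq_le_mul (norm_nonneg _) (by positivity) (this.trans (by gcongr))
    constructor
    · intro _
      refine hb.trans ?_
      gcongr
      linarith
    · intro hh; linarith
  · have a1 := half_R1 h1 hε hx (by linarith) hxne hs1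
    have a2 := half_R1_nonneg h2 hε hx (by linarith) hs2
    have a3 : (JJ X P).re + 3 * (JJ X P).im ≤ 4 * ‖X 0‖ := by
      have e1 := (Complex.abs_im_le_norm (JJ X P + JJ X2 P2)).trans hJ
      have e2 := (Complex.abs_re_le_norm (JJ X P + JJ X2 P2)).trans hJ
      rw [Complex.add_im] at e1
      rw [Complex.add_re] at e2
      linarith [le_abs_self ((JJ X P).im + (JJ X2 P2).im), le_abs_self ((JJ X P).re + (JJ X2 P2).re)]
    set ℓ := Real.log (1 + c / (|x - g 1| / 2)) with hℓ
    have hp : 0 < c / (|x - g 1| / 2) := by positivity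
    have hℓ0 : 0 ≤ ℓ := Real.log_nonneg (by linarith)
    have hb : ‖X 0‖ ≤ 4 / c * ℓ := by
      apply le_of_sq_le_mul (norm_nonneg _) (by positivity)
      calc _ ≤ _ := a1
        _ ≤ 4 * ‖X 0‖ * (ℓ / c) := by gcongr
        _ = _ := by ring
    constructor
    · intro hxR
      have e1 : ℓ ≤ (2 * C + 3 + 2 * c) * Λ := by
        have : 1 + c / (|x - g 1| / 2) = (|x - g 1| + 2 * c) / |x - g 1| := by field_simp
        rw [hℓ, this, Real.log_div (by positivity) hd.ne']
        have e2 := Real.log_le_sub_one_of_pos (x := |x - g 1| + 2 * c) (by positivity)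
        have e3 : |x - g 1| ≤ 2 * C + 2 := by rw [abs_le]; constructor <;> linarith
        have e4 := neg_abs_le (Real.log (|x - g 1|))
        have : 0 ≤ |Real.log (|x - g 1|)| := abs_nonneg _
        nlinarith
      have e2 : Λ ≤ Λ ^ 2 := by nlinarith
      calc _ ≤ _ := hb
        _ ≤ 4 / c * ((2 * C + 3 + 2 * c) * Λ ^ 2) := by gcongr; exact e1.trans (by gcongr)
        _ = (4 / c * (2 * C + 3 + 2 * c)) * Λ ^ 2 := by ring
        _ ≤ _ := by gcongr; linarith
    · intro hxR
      have e1 : ℓ ≤ c / (|x - g 1| / 2) := by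
        have := Real.log_le_sub_one_of_pos (x := 1 + c / (|x - g 1| / 2)) (by positivity)
        linarith
      have hx0 : 0 < x := by linarith
      have e2 : 2 * x / (C + 2) ≤ |x - g 1| := by
        refine le_trans ?_ (le_abs_self _)
        rw [div_le_iff₀ (by positivity)]
        nlinarith
      have e3 : 0 < 2 * x / (C + 2) := by positivity
      calc _ ≤ _ := hb
        _ ≤ 4 / c * (c / (|x - g 1| / 2)) := by gcongr
        _ ≤ 4 / c * (c / ((2 * x / (C + 2)) / 2)) := by gcongr
        _ = 4 * (C + 2) / x := by field_simp
        _ ≤ M / x := by gcongr; linarith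

theorem pos_side' {g k g' k' g'' k'' G K G' K' G'' K'' : ℝ → ℝ} {c C : ℝ} (h1 : HD g k g' k' g'' k'' c C)
    (h2 : HD G K G' K' G'' K'' c C) (α : ℝ) :
    ∃ M > 0, ∃ θ : ℝ, ∀ x ε : ℝ, 0 ≤ x → x ≠ θ → 0 < ε → ε ≤ 1 → ∀ X P X2 P2 : ℝ → ℂ,
      HS g k α (x + ε * Complex.I) X P → HS G K α (x + ε * Complex.I) X2 P2 → X2 0 = X 0 →
      ‖JJ X P + JJ X2 P2‖ ≤ ‖X 0‖ →
      (x ≤ C + 2 → ‖X 0‖ ≤ M * (1 + |Real.log (|x - θ|)|) ^ 2) ∧ (C + 2 < x → ‖X 0‖ ≤ M / x) := by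
  rcases le_total (G 1) (g 1) with hge | hge
  · obtain ⟨M, hM, hh⟩ := pos_side h1 h2 hge α
    exact ⟨M, hM, g 1, hh⟩
  · obtain ⟨M, hM, hh⟩ := pos_side h2 h1 hge α
    refine ⟨M, hM, G 1, fun x ε hx hxn hε hε1 X P X2 P2 hs1 hs2 h0 hJ => ?_⟩
    rw [← h0]
    exact hh x ε hx hxn hε hε1 X2 P2 X P hs2 hs1 h0.symm (by rw [h0, add_comm]; exact hJ)

theorem HS.conj {g k : ℝ → ℝ} {α x ε : ℝ} {X P : ℝ → ℂ} (hs : HS g k α (x + ε * Complex.I) X P) :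
    HS k g α (((-x : ℝ) : ℂ) + ε * Complex.I) (fun y => conj (X y)) (fun y => - conj (P y)) := by
  have hZ : ∀ y, ZZ k g (((-x : ℝ) : ℂ) + ε * Complex.I) y = - conj (ZZ g k (x + ε * Complex.I) y) := fun y => by
    have e : (((-x : ℝ) : ℂ) + ε * Complex.I) = - conj (x + ε * Complex.I) := by
      simp [Complex.ext_iff]
    rw [e]
    set z : ℂ := x + ε * Complex.I
    simp only [ZZ, map_div₀, map_mul, map_add, map_sub, Complex.conj_ofReal]
    rw [div_neg]; congr 2; ring
  refine ⟨Complex.continuous_conj.comp_continuousOn hs.Xc, (Complex.continuous_conj.comp_continuousOn hs.Pc).neg,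
    fun y hy => ?_, fun y hy => ?_, by simp [hs.X1]⟩
  · rw [hZ, neg_div_neg_eq, ← map_div₀]
    exact (hs.Xd y hy).star
  · rw [hZ]
    refine (hs.Pd y hy).star.neg.congr_deriv ?_
    simp

theorem JJ_conj (X P : ℝ → ℂ) : JJ (fun y => conj (X y)) (fun y => - conj (P y)) = - conj (JJ X P) := by
  simp [JJ]

theorem log_rpow (R : ℝ) (hR : 0 < R) : ∃ M > 0, ∀ s, 0 < s → s ≤ R → (1 + |Real.log s|) ^ 2 ≤ M * s ^ (-(1/4) : ℝ) := by
  refine ⟨((1 + R) * R ^ ((1/8) : ℝ) + 8) ^ 2, by positivity, fun s hs hsR => ?_⟩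
  have h1 : |Real.log s| ≤ R + 8 * s ^ (-(1/8) : ℝ) := by
    have hp : 0 < s ^ (-(1/8) : ℝ) := by positivity
    rw [abs_le]; constructor
    · have := Real.log_le_rpow_div (x := s⁻¹) (ε := 1/8) (by positivity) (by norm_num)
      rw [Real.log_inv, Real.inv_rpow hs.le, ← Real.rpow_neg hs.le] at this
      linarith
    · have := Real.log_le_sub_one_of_pos hs
      linarith
  have h2 : 1 ≤ R ^ ((1/8) : ℝ) * s ^ (-(1/8) : ℝ) := by
    rw [Real.rpow_neg hs.le, ← div_eq_mul_inv, le_div_iff₀ (by positivity), one_mul]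
    gcongr
  have h3 : 1 + |Real.log s| ≤ ((1 + R) * R ^ ((1/8) : ℝ) + 8) * s ^ (-(1/8) : ℝ) := by
    have := mul_le_mul_of_nonneg_left h2 (by positivity : 0 ≤ 1 + R)
    nlinarith
  have h4 : s ^ (-(1/4) : ℝ) = (s ^ (-(1/8) : ℝ)) ^ 2 := by
    rw [← Real.rpow_natCast, ← Real.rpow_mul hs.le]; norm_num
  rw [h4, ← mul_pow]
  gcongr
end
end MHD

namespace MHD
section
open ComplexConjugate MeasureTheory

theorem memLp_abs_rpow (R θ : ℝ) (hR : 0 < R) :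
    MemLp ((Icc (-R) R).indicator (fun x : ℝ => |x - θ| ^ (-(1/4) : ℝ))) 2 volume := by
  have hm : Measurable (fun x : ℝ => |x - θ| ^ (-(1/4) : ℝ)) := by fun_prop
  have hm2 : AEStronglyMeasurable ((Icc (-R) R).indicator (fun x : ℝ => |x - θ| ^ (-(1/4) : ℝ))) volume :=
    (hm.indicator measurableSet_Icc).aestronglyMeasurable
  rw [memLp_two_iff_integrable_sq hm2]
  have h1 : IntervalIntegrable (fun x : ℝ => |x| ^ (-(1/2) : ℝ)) volume (-R - θ) (R - θ) := by
    have := (intervalIntegral.intervalIntegrable_cpow' (r := ((-(1/2) : ℝ) : ℂ)) (a := -R - θ) (b := R - θ) (by norm_num)).norm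
    simpa only [Complex.norm_cpow_real, Complex.norm_real, Real.norm_eq_abs] using this
  have h2 := (h1.comp_sub_right θ)
  simp only [sub_add_cancel] at h2
  rw [intervalIntegrable_iff_integrableOn_Icc_of_le (by linarith)] at h2
  rw [← integrable_indicator_iff measurableSet_Icc] at h2
  refine h2.congr (Eventually.of_forall fun x => ?_)
  by_cases hx : x ∈ Icc (-R) R
  · simp only [indicator_of_mem hx]
    rw [← Real.rpow_natCast, ← Real.rpow_mul (abs_nonneg _)]; norm_num
  · simp only [indicator_of_notMem hx]; norm_num

theorem memLp_inv : MemLp (fun x : ℝ => (√(1 + x ^ 2))⁻¹) 2 volume := by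
  rw [memLp_two_iff_integrable_sq (by
    have : Continuous (fun x : ℝ => (√(1 + x ^ 2))⁻¹) := by
      refine Continuous.inv₀ (by fun_prop) (fun x => by positivity)
    exact this.aestronglyMeasurable)]
  refine integrable_inv_one_add_sq.congr (Eventually.of_forall fun x => ?_)
  simp only
  rw [inv_pow, Real.sq_sqrt (by positivity)]

theorem full_bound {g k g' k' g'' k'' G K G' K' G'' K'' : ℝ → ℝ} {c C : ℝ} (h1 : HD g k g' k' g'' k'' c C)
    (h2 : HD G K G' K' G'' K'' c C) (α : ℝ) :
    ∃ B : ℝ → ℝ, MemLp B 2 volume ∧ ∃ S : Set ℝ, S.Finite ∧ 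
      ∀ ε : ℝ, 0 < ε → ε ≤ 1 → ∀ x ∉ S, ∀ X P X2 P2 : ℝ → ℂ,
      HS g k α (x + ε * Complex.I) X P → HS G K α (x + ε * Complex.I) X2 P2 → X2 0 = X 0 →
      ‖JJ X P + JJ X2 P2‖ ≤ ‖X 0‖ → ‖X 0‖ ≤ B x := by
  obtain ⟨M, hM, θ, H1⟩ := pos_side' h1 h2 α
  obtain ⟨N, hN, η, H2⟩ := pos_side' h1.swap h2.swap α
  have hC : 0 < C := h1.hc.trans_le h1.cC
  set R := C + 2 with hR
  have hR0 : 0 < R := by linarith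
  obtain ⟨Q, hQ, H3⟩ := log_rpow (R + |θ|) (by positivity)
  obtain ⟨Q', hQ', H4⟩ := log_rpow (R + |η|) (by positivity)
  have hsq : ∀ x : ℝ, R < x → 1 / x ≤ 2 * (√(1 + x ^ 2))⁻¹ := fun x hx => by
    have hx0 : 0 < x := hR0.trans hx
    rw [← div_eq_mul_inv, div_le_div_iff₀ hx0 (by positivity), one_mul]
    rw [Real.sqrt_le_iff]; constructor
    · positivity
    · nlinarith
  refine ⟨fun x => (M * Q) * (Icc (-R) R).indicator (fun x : ℝ => |x - θ| ^ (-(1/4) : ℝ)) x +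
    (N * Q') * (Icc (-R) R).indicator (fun x : ℝ => |x - (-η)| ^ (-(1/4) : ℝ)) x +
    (2 * M + 2 * N) * (√(1 + x ^ 2))⁻¹, ?_, {θ, -η}, by simp, ?_⟩
  · exact (((memLp_abs_rpow R θ hR0).const_mul _).add ((memLp_abs_rpow R (-η) hR0).const_mul _)).add
      (memLp_inv.const_mul _)
  intro ε hε hε1 x hxS X P X2 P2 hs1 hs2 h0 hJ
  simp only [mem_insert_iff, mem_singleton_iff, not_or] at hxS
  have n1 : 0 ≤ (M * Q) * (Icc (-R) R).indicator (fun x : ℝ => |x - θ| ^ (-(1/4) : ℝ)) x :=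
    mul_nonneg (by positivity) (indicator_nonneg (fun x _ => by positivity) _)
  have n2 : 0 ≤ (N * Q') * (Icc (-R) R).indicator (fun x : ℝ => |x - (-η)| ^ (-(1/4) : ℝ)) x :=
    mul_nonneg (by positivity) (indicator_nonneg (fun x _ => by positivity) _)
  have n3 : 0 ≤ M * (√(1 + x ^ 2))⁻¹ := by positivity
  have n4 : 0 ≤ N * (√(1 + x ^ 2))⁻¹ := by positivity
  rcases le_or_gt 0 x with hx | hx
  · obtain ⟨a, b⟩ := H1 x ε hx hxS.1 hε hε1 X P X2 P2 hs1 hs2 h0 hJ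
    rcases le_or_gt x R with hxR | hxR
    · have hb := a hxR
      have hin : x ∈ Icc (-R) R := ⟨by linarith, hxR⟩
      simp only [indicator_of_mem hin] at n1 n2 ⊢
      have := H3 (|x - θ|) (abs_pos.2 (sub_ne_zero.2 hxS.1)) (by
        refine (abs_sub _ _).trans ?_
        rw [abs_of_nonneg hx]; linarith)
      have := mul_le_mul_of_nonneg_left this hM.le
      linarith
    · have hb := b hxR
      have := mul_le_mul_of_nonneg_left (hsq x hxR) hM.le
      have e : M / x = M * (1 / x) := by ring
      linarith
  · obtain ⟨a, b⟩ := H2 (-x) ε (by linarith) (fun h => hxS.2 (by linarith)) hε hε1 _ _ _ _ hs1.conj hs2.conj (by simp [h0])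
      (by rw [JJ_conj, JJ_conj, ← neg_add, norm_neg, ← map_add, RCLike.norm_conj, RCLike.norm_conj]; exact hJ)
    simp only [RCLike.norm_conj] at a b
    rcases le_or_gt (-x) R with hxR | hxR
    · have hb := a hxR
      have hin : x ∈ Icc (-R) R := ⟨by linarith, by linarith⟩
      have e : |-x - η| = |x - -η| := by rw [← abs_neg]; congr 1; ring
      rw [e] at hb
      simp only [indicator_of_mem hin] at n1 n2 ⊢
      have := H4 (|x - -η|) (abs_pos.2 (sub_ne_zero.2 hxS.2)) (by
        rw [← e]
        refine (abs_sub _ _).trans ?_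
        rw [abs_of_nonneg (by linarith)]; linarith)
      have := mul_le_mul_of_nonneg_left this hN.le
      linarith
    · have hb := b hxR
      have := mul_le_mul_of_nonneg_left (hsq (-x) hxR) hN.le
      rw [neg_sq] at this
      have e : N / -x = N * (1 / -x) := by ring
      linarith
end
end MHD

namespace MHD
section
open MeasureTheory
open scoped ComplexInnerProductSpace

variable {Y : Type*} [NormedAddCommGroup Y] [InnerProductSpace ℂ Y] [CompleteSpace Y]

noncomputable def opA (P U N : Y →L[ℂ] Y) : WithLp 2 (Y × Y) →L[ℂ] WithLp 2 (Y × Y) :=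
  ((WithLp.prodContinuousLinearEquiv 2 ℂ Y Y).symm : Y × Y →L[ℂ] WithLp 2 (Y × Y)) ∘L
    ((P ∘L ((2:ℂ) • (U ∘L P ∘L ContinuousLinearMap.fst ℂ Y Y) + N ∘L ContinuousLinearMap.snd ℂ Y Y)).prod
      (N ∘L P ∘L ContinuousLinearMap.fst ℂ Y Y)) ∘L
    ((WithLp.prodContinuousLinearEquiv 2 ℂ Y Y) : WithLp 2 (Y × Y) →L[ℂ] Y × Y)

theorem opA_apply (P U N : Y →L[ℂ] Y) (v : WithLp 2 (Y × Y)) :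
    opA P U N v = WithLp.toLp 2 (P ((2:ℂ) • U (P v.fst) + N v.snd), N (P v.fst)) := by
  simp [opA]

theorem opA_sa (P U N : Y →L[ℂ] Y) (hP : IsSelfAdjoint P) (hU : IsSelfAdjoint U) (hN : IsSelfAdjoint N) :
    IsSelfAdjoint (opA P U N) := by
  have hP := ContinuousLinearMap.isSelfAdjoint_iff_isSymmetric.1 hP
  have hU := ContinuousLinearMap.isSelfAdjoint_iff_isSymmetric.1 hU
  have hN := ContinuousLinearMap.isSelfAdjoint_iff_isSymmetric.1 hN
  have hP : ∀ a b, ⟪P a, b⟫ = ⟪a, P b⟫ := hP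
  have hU : ∀ a b, ⟪U a, b⟫ = ⟪a, U b⟫ := hU
  have hN : ∀ a b, ⟪N a, b⟫ = ⟪a, N b⟫ := hN
  rw [ContinuousLinearMap.isSelfAdjoint_iff_isSymmetric]
  intro v w
  simp only [ContinuousLinearMap.coe_coe, opA_apply, WithLp.prod_inner_apply]
  simp only [hP, hN, inner_add_left, inner_add_right, inner_smul_left, inner_smul_right, map_ofNat, map_add, map_smul, hU]
  change 2 * ⟪v.fst, P (U (P w.fst))⟫ + ⟪v.snd, N (P w.fst)⟫ + ⟪v.fst, P (N w.snd)⟫ = 2 * ⟪v.fst, P (U (P w.fst))⟫ + ⟪v.fst, P (N w.snd)⟫ + ⟪v.snd, N (P w.fst)⟫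
  ring

theorem center_decay (P U N : Y →L[ℂ] Y) (hP : IsSelfAdjoint P) (hPP : ∀ v, P (P v) = P v)
    (hU : IsSelfAdjoint U) (hN : IsSelfAdjoint N) (χ : Y) (B : ℝ → ℝ)
    (hB : MemLp B 2 volume) (S : Set ℝ) (hS : S.Finite)
    (hres : ∀ ε : ℝ, 0 < ε → ε ≤ 1 → ∀ x : ℝ, x ∉ S → ∀ w : Y, P w = w → 
      P (((x : ℂ) + ε * Complex.I) • w - (2:ℂ) • U w - ((x : ℂ) + ε * Complex.I)⁻¹ • N (N w) + χ) = 0 →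
      ‖⟪χ, w⟫‖ ≤ B x) (a : ℝ) (ha : a ≠ 0) (w r : ℝ → Y) (hw : ∀ t ≥ 0, P (w t) = w t)
    (hwc : ContinuousOn w (Ici 0)) (hrc : ContinuousOn r (Ici 0))
    (hwd : ∀ t ≥ 0, HasDerivWithinAt w ((a:ℂ) • ((-Complex.I) • P ((2:ℂ) • U (w t) + N (r t)))) (Ici t) t)
    (hrd : ∀ t ≥ 0, HasDerivWithinAt r ((a:ℂ) • ((-Complex.I) • N (w t))) (Ici t) t) :
    Tendsto (fun t => ⟪χ, w t⟫) atTop (𝓝 0) := by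
  have hPs : ∀ a b, ⟪P a, b⟫ = ⟪a, P b⟫ := ContinuousLinearMap.isSelfAdjoint_iff_isSymmetric.1 hP
  set E : WithLp 2 (Y × Y) := WithLp.toLp 2 (P χ, 0) with hE
  set J : Y × Y →L[ℂ] WithLp 2 (Y × Y) := ((WithLp.prodContinuousLinearEquiv 2 ℂ Y Y).symm : Y × Y →L[ℂ] WithLp 2 (Y × Y))
  have hJ : ∀ p, J p = WithLp.toLp 2 p := fun p => rfl
  have key := abstract_decay (opA P U N) (opA_sa P U N hP hU hN) E B hB S hS (fun ε hε hε1 x hx v hv => by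
    set z : ℂ := (x : ℂ) + ε * Complex.I with hz
    have hz0 : z ≠ 0 := by
      intro h0
      have : z.im = ε := by simp [hz]
      rw [h0] at this; simp at this; linarith
    rw [opA_apply] at hv
    have e1 : P ((2:ℂ) • U (P v.fst) + N v.snd) - z • v.fst = P χ := congrArg WithLp.fst hv
    have e2 : N (P v.fst) - z • v.snd = 0 := congrArg WithLp.snd hv
    have e3 : P v.fst = v.fst := by
      have : v.fst = z⁻¹ • P ((2:ℂ) • U (P v.fst) + N v.snd - χ) := by
        rw [map_sub, ← e1, sub_sub_cancel, smul_smul, inv_mul_cancel₀ hz0, one_smul]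
      rw [this, map_smul, hPP]
    have e4 : v.snd = z⁻¹ • N v.fst := by
      rw [e3] at e2
      rw [sub_eq_zero.1 e2, smul_smul, inv_mul_cancel₀ hz0, one_smul]
    have := hres ε hε hε1 x hx v.fst e3 (by
      rw [e3, e4, map_smul] at e1
      rw [map_add, ← e1, map_sub, map_sub, map_add, map_smul, e3]
      abel)
    rw [WithLp.prod_inner_apply]
    simp only [hE, inner_zero_left, add_zero, hPs]
    have e3' : P v.ofLp.1 = v.ofLp.1 := e3
    rw [e3']
    exact this) (WithLp.toLp 2 (w 0, r 0)) a ha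
  refine key.congr' ?_
  filter_upwards [eventually_ge_atTop 0] with t ht
  have := ode_eq_grp (opA P U N) (fun t => J (w t, r t)) a (J.continuous.comp_continuousOn (hwc.prodMk hrc))
    (fun t ht => by
      have h5 : HasFDerivAt (𝕜 := ℝ) J (J.restrictScalars ℝ) (w t, r t) := (J.restrictScalars ℝ).hasFDerivAt
      have := h5.comp_hasDerivWithinAt t ((hwd t ht).prodMk (hrd t ht))
      refine this.congr_deriv ?_
      rw [ContinuousLinearMap.coe_restrictScalars', hJ, hJ, opA_apply]
      have h6 : P (WithLp.toLp 2 (w t, r t)).fst = w t := hw t ht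
      rw [h6]
      rfl) t ht
  simp only [hJ] at this
  rw [← this, WithLp.prod_inner_apply]
  simp only [hE, inner_zero_left, add_zero, hPs, hw t ht]
end
end MHD

namespace MHD
section
open MeasureTheory
open scoped ComplexInnerProductSpace

noncomputable abbrev mu : Measure ℝ := volume.restrict (Ioc (-1) 1)
noncomputable abbrev LL := Lp ℂ 2 mu
noncomputable abbrev YY := WithLp 2 (LL × LL)

noncomputable def MM (f : ℝ → ℝ) (hf : MemLp f ⊤ mu) : LL →L[ℂ] LL :=
  (ContinuousLinearMap.mul ℂ ℂ).holderL mu ⊤ 2 2 ((hf.ofReal (K := ℂ)).toLp)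

theorem MM_coe (f : ℝ → ℝ) (hf : MemLp f ⊤ mu) (w : LL) : MM f hf w =ᵐ[mu] fun y => (f y : ℂ) * w y := by
  have h1 := (ContinuousLinearMap.mul ℂ ℂ).coeFn_holder (p := ⊤) (q := 2) (r := 2) (μ := mu) ((hf.ofReal (K := ℂ)).toLp) w
  have h2 := (hf.ofReal (K := ℂ)).coeFn_toLp
  filter_upwards [h1, h2] with y h1 h2
  change (ContinuousLinearMap.holder 2 (ContinuousLinearMap.mul ℂ ℂ) ((hf.ofReal (K := ℂ)).toLp) w) y = _
  rw [h1, h2]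
  rfl

theorem MM_sa (f : ℝ → ℝ) (hf : MemLp f ⊤ mu) : IsSelfAdjoint (MM f hf) := by
  rw [ContinuousLinearMap.isSelfAdjoint_iff_isSymmetric]
  intro v w
  change ⟪MM f hf v, w⟫ = ⟪v, MM f hf w⟫
  rw [L2.inner_def, L2.inner_def]
  apply integral_congr_ae
  filter_upwards [MM_coe f hf v, MM_coe f hf w] with y h1 h2
  rw [h1, h2]
  simp
  ring

noncomputable def one : LL := (memLp_const (1:ℂ)).toLp

theorem one_coe : one =ᵐ[mu] fun _ => (1:ℂ) := MemLp.coeFn_toLp _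

noncomputable def prim (f : ℝ → ℂ) (y : ℝ) : ℂ := ∫ s in (-1)..y, f s ∂mu

theorem LL_int (f : LL) : Integrable f mu := (Lp.memLp f).integrable (by norm_num)

theorem prim_cont {f : ℝ → ℂ} (hf : Integrable f mu) : Continuous (prim f) := hf.continuous_primitive _

theorem prim_eq {f F : ℝ → ℂ} (h : f =ᵐ[mu] F) {y : ℝ} (hy : y ∈ Icc (-1:ℝ) 1) :
    prim f y = ∫ s in (-1)..y, F s := by
  rw [prim, intervalIntegral.integral_of_le hy.1, intervalIntegral.integral_of_le hy.1,
    Measure.restrict_restrict measurableSet_Ioc, inter_eq_left.2 (Ioc_subset_Ioc_right hy.2)]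
  exact integral_congr_ae (ae_restrict_of_ae_restrict_of_subset (Ioc_subset_Ioc_right hy.2) h)

theorem memV {f : ℝ → ℂ} (hf : Integrable f mu) : MemLp (prim f) 2 mu := by
  have hc := prim_cont hf
  obtain ⟨C, hC⟩ := (isCompact_Icc (a := (-1:ℝ)) (b := 1)).exists_bound_of_continuousOn hc.continuousOn
  refine MemLp.of_bound hc.aestronglyMeasurable C ?_
  filter_upwards [ae_restrict_mem measurableSet_Ioc] with y hy
  exact hC y (Ioc_subset_Icc_self hy)

theorem inner_one (f : LL) : ⟪one, f⟫ = ∫ y, f y ∂mu := by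
  rw [L2.inner_def]
  apply integral_congr_ae
  filter_upwards [one_coe] with y h
  rw [h]; simp

theorem prim_one (f : ℝ → ℂ) : prim f 1 = ∫ y, f y ∂mu := by
  rw [prim, intervalIntegral.integral_of_le (by norm_num), Measure.restrict_restrict measurableSet_Ioc, inter_self]

noncomputable def chi (y : ℝ) : LL := indicatorConstLp 2 (measurableSet_Ioc (a := (-1:ℝ)) (b := y)) (measure_ne_top mu _) (1:ℂ)

theorem inner_chi (f : LL) {y : ℝ} (hy : -1 ≤ y) : ⟪chi y, f⟫ = prim f y := by
  rw [prim, chi, L2.inner_indicatorConstLp_one, intervalIntegral.integral_of_le hy]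

theorem norm_chi (y : ℝ) : ‖chi y‖ ≤ ‖one‖ := by
  apply Lp.norm_le_norm_of_ae_le
  filter_upwards [one_coe, indicatorConstLp_coeFn (p := 2) (s := Ioc (-1) y) (hs := measurableSet_Ioc) (hμs := measure_ne_top mu _) (c := (1:ℂ))] with s h1 h2
  rw [h1, chi, h2]
  by_cases h : s ∈ Ioc (-1) y <;> simp [h]

noncomputable def VV : LL →L[ℂ] LL :=
  LinearMap.mkContinuous
    { toFun := fun f => (memV (LL_int f)).toLp
      map_add' := fun f g => by
        rw [← MemLp.toLp_add]
        apply MemLp.toLp_congr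
        filter_upwards [ae_restrict_mem measurableSet_Ioc] with y hy
        rw [Pi.add_apply, prim, prim, prim, ← intervalIntegral.integral_add (LL_int f).intervalIntegrable (LL_int g).intervalIntegrable]
        apply intervalIntegral.integral_congr_ae
        filter_upwards [Lp.coeFn_add f g] with s hs _
        rw [hs, Pi.add_apply]
      map_smul' := fun c f => by
        rw [RingHom.id_apply, ← MemLp.toLp_const_smul]
        apply MemLp.toLp_congr
        filter_upwards [ae_restrict_mem measurableSet_Ioc] with y hy
        rw [Pi.smul_apply, prim, prim, ← intervalIntegral.integral_smul]
        apply intervalIntegral.integral_congr_ae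
        filter_upwards [Lp.coeFn_smul c f] with s hs _
        rw [hs, Pi.smul_apply] } (‖one‖ * ‖one‖) (fun f => by
    rw [show ‖one‖ * ‖one‖ * ‖f‖ = (‖one‖ * ‖f‖) * ‖one‖ by ring]
    apply Lp.norm_le_mul_norm_of_ae_le_mul
    filter_upwards [ae_restrict_mem measurableSet_Ioc, one_coe, (memV (LL_int f)).coeFn_toLp] with y hy h1 h2
    rw [h1, norm_one, mul_one]
    change ‖((memV (LL_int f)).toLp : LL) y‖ ≤ _
    rw [h2, ← inner_chi f hy.1.le]
    exact (norm_inner_le_norm _ _).trans (by gcongr; exact norm_chi y))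

theorem VV_coe (f : LL) : VV f =ᵐ[mu] prim f := MemLp.coeFn_toLp (memV (LL_int f))

theorem VV_adj (f g : LL) : ⟪VV f, g⟫ = ⟪f, ⟪one, g⟫ • one - VV g⟫ := by
  have hfi := LL_int f
  have hgi := LL_int g
  set F : ℝ → ℝ → ℂ := fun y s => if s ≤ y then (starRingEnd ℂ) (f s) * g y else 0 with hF
  have hint : Integrable (Function.uncurry F) (mu.prod mu) := by
    have h0 : Integrable (fun p : ℝ × ℝ => g p.1 * (starRingEnd ℂ) (f p.2)) (mu.prod mu) :=
      hgi.mul_prod (ContinuousLinearMap.integrable_comp (Complex.conjCLE : ℂ →L[ℝ] ℂ) hfi)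
    have hm : MeasurableSet {p : ℝ × ℝ | p.2 ≤ p.1} := measurableSet_le measurable_snd measurable_fst
    have := h0.indicator hm
    refine this.congr (Eventually.of_forall fun p => ?_)
    simp only [indicator, Function.uncurry, hF, mem_ofPred_eq]
    split_ifs <;> ring
  have hsw := integral_integral_swap hint
  have hrm : ∀ᵐ y ∂mu, y ∈ Ioc (-1:ℝ) 1 := ae_restrict_mem measurableSet_Ioc
  have e1 : ⟪VV f, g⟫ = ∫ y, ∫ s, F y s ∂mu ∂mu := by
    rw [L2.inner_def]
    apply integral_congr_ae
    filter_upwards [VV_coe f, hrm] with y hy hy1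
    have : (∫ s, F y s ∂mu) = (∫ s in Ioc (-1) y, (starRingEnd ℂ) (f s) ∂mu) * g y := by
      rw [← integral_mul_const, ← integral_indicator (μ := mu) measurableSet_Ioc]
      apply integral_congr_ae
      filter_upwards [hrm] with s hs
      simp only [hF, indicator, mem_Ioc, hs.1, true_and]
    rw [this, hy, prim, intervalIntegral.integral_of_le hy1.1.le, integral_conj]
    simp [mul_comm]
  have e2 : ⟪f, ⟪one, g⟫ • one - VV g⟫ = ∫ s, ∫ y, F y s ∂mu ∂mu := by
    rw [L2.inner_def]
    apply integral_congr_ae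
    filter_upwards [VV_coe g, hrm, one_coe, Lp.coeFn_sub (⟪one, g⟫ • one) (VV g), Lp.coeFn_smul ⟪one, g⟫ one] with s hs hs1 h1 h2 h3
    have : (∫ y, F y s ∂mu) = (starRingEnd ℂ) (f s) * (∫ y in Ici s, g y ∂mu) := by
      rw [← integral_const_mul, ← integral_indicator (μ := mu) measurableSet_Ici]
      apply integral_congr_ae
      filter_upwards [hrm] with y hy
      simp only [hF, indicator, mem_Ici]
    have h4 : (∫ y in Ici s, g y ∂mu) = ∫ y in (Iic s)ᶜ, g y ∂mu := by
      rw [compl_Iic]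
      exact integral_Ici_eq_integral_Ioi
    have h5 : (∫ y in Iic s, g y ∂mu) = prim g s := by
      rw [prim, intervalIntegral.integral_of_le hs1.1.le, Measure.restrict_restrict measurableSet_Ioc,
        Measure.restrict_restrict measurableSet_Iic]
      congr 2
      ext y; simp only [mem_inter_iff, mem_Iic, mem_Ioc]; tauto
    have h6 := integral_add_compl (measurableSet_Iic (a := s)) hgi
    rw [this, h2, Pi.sub_apply, h3, Pi.smul_apply, h1, hs, ← h5, h4, inner_one, ← h6]
    simp [mul_comm]
  rw [e1, e2, hsw]
end
end MHD

namespace MHD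
section
open MeasureTheory
open scoped ComplexInnerProductSpace

noncomputable def fstL : YY →L[ℂ] LL := ContinuousLinearMap.fst ℂ LL LL ∘L ((WithLp.prodContinuousLinearEquiv 2 ℂ LL LL) : YY →L[ℂ] LL × LL)
noncomputable def sndL : YY →L[ℂ] LL := ContinuousLinearMap.snd ℂ LL LL ∘L ((WithLp.prodContinuousLinearEquiv 2 ℂ LL LL) : YY →L[ℂ] LL × LL)
noncomputable def mkL : LL × LL →L[ℂ] YY := ((WithLp.prodContinuousLinearEquiv 2 ℂ LL LL).symm : LL × LL →L[ℂ] YY)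

theorem fst_mk (p : LL × LL) : fstL (mkL p) = p.1 := rfl
theorem snd_mk (p : LL × LL) : sndL (mkL p) = p.2 := rfl
theorem mk_eta (v : YY) : mkL (fstL v, sndL v) = v := rfl
theorem YY_ext {v w : YY} (h1 : fstL v = fstL w) (h2 : sndL v = sndL w) : v = w := by
  rw [← mk_eta v, ← mk_eta w, h1, h2]
theorem YY_inner (v w : YY) : ⟪v, w⟫ = ⟪fstL v, fstL w⟫ + ⟪sndL v, sndL w⟫ := rfl

noncomputable def dia (T : LL →L[ℂ] LL) : YY →L[ℂ] YY := mkL ∘L ((T ∘L fstL).prod (T ∘L sndL))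
theorem fst_dia (T) (v : YY) : fstL (dia T v) = T (fstL v) := rfl
theorem snd_dia (T) (v : YY) : sndL (dia T v) = T (sndL v) := rfl

theorem dia_sa (T : LL →L[ℂ] LL) (hT : IsSelfAdjoint T) : IsSelfAdjoint (dia T) := by
  have hT : ∀ a b, ⟪T a, b⟫ = ⟪a, T b⟫ := ContinuousLinearMap.isSelfAdjoint_iff_isSymmetric.1 hT
  rw [ContinuousLinearMap.isSelfAdjoint_iff_isSymmetric]
  intro v w
  change ⟪dia T v, w⟫ = ⟪v, dia T w⟫
  rw [YY_inner, YY_inner, fst_dia, snd_dia, fst_dia, snd_dia, hT, hT]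

noncomputable def GLm (α : ℝ) : YY →L[ℂ] LL × ℂ :=
  (sndL - (α : ℂ) • (VV ∘L fstL)).prod ((innerSL ℂ one) ∘L fstL)

noncomputable def GG (α : ℝ) : Submodule ℂ YY := (GLm α).ker

theorem mem_GG (α : ℝ) (v : YY) : v ∈ GG α ↔ sndL v = (α : ℂ) • VV (fstL v) ∧ ⟪one, fstL v⟫ = 0 := by
  rw [GG, LinearMap.mem_ker]
  change ((sndL v - (α:ℂ) • VV (fstL v), ⟪one, fstL v⟫) : LL × ℂ) = 0 ↔ _
  rw [Prod.mk_eq_zero, sub_eq_zero]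

theorem GG_closed (α : ℝ) : IsClosed (GG α : Set YY) := (GLm α).isClosed_ker

instance (α : ℝ) : CompleteSpace (GG α) := (GG_closed α).completeSpace_coe

noncomputable def PP (α : ℝ) : YY →L[ℂ] YY := (GG α).starProjection

theorem PP_sa (α : ℝ) : IsSelfAdjoint (PP α) := isSelfAdjoint_starProjection _

theorem PP_self (α : ℝ) (v : YY) : PP α v = v ↔ v ∈ GG α := Submodule.starProjection_eq_self_iff

theorem PP_idem (α : ℝ) (v : YY) : PP α (PP α v) = PP α v :=
  (PP_self α _).2 (Submodule.starProjection_apply_mem _ _)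

theorem PP_zero (α : ℝ) (v : YY) : PP α v = 0 ↔ v ∈ (GG α)ᗮ := Submodule.starProjection_apply_eq_zero_iff _

theorem inner_one_one : ⟪one, one⟫ = (2:ℂ) := by
  rw [inner_one, integral_congr_ae one_coe]
  simp [measureReal_def]
  norm_num

theorem PP_zero_iff (α : ℝ) (v : YY) : PP α v = 0 ↔
    ∃ κ : ℂ, fstL v + (α : ℂ) • (⟪one, sndL v⟫ • one - VV (sndL v)) = κ • one := by
  have key : ∀ D : LL, ⟪mkL (D, (α:ℂ) • VV D), v⟫ = ⟪D, fstL v + (α : ℂ) • (⟪one, sndL v⟫ • one - VV (sndL v))⟫ := by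
    intro D
    rw [YY_inner, fst_mk, snd_mk, inner_add_right, inner_smul_left, VV_adj, inner_smul_right, Complex.conj_ofReal]
  rw [PP_zero, Submodule.mem_orthogonal]
  set e := fstL v + (α : ℂ) • (⟪one, sndL v⟫ • one - VV (sndL v)) with he
  constructor
  · intro h
    refine ⟨⟪one, e⟫ / 2, ?_⟩
    set κ := ⟪one, e⟫ / 2 with hκ
    have h1 : ⟪one, e - κ • one⟫ = 0 := by
      rw [inner_sub_right, inner_smul_right, inner_one_one, hκ]; ring
    have h2 := h (mkL (e - κ • one, (α:ℂ) • VV (e - κ • one))) ((mem_GG _ _).2 ⟨rfl, h1⟩)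
    rw [key] at h2
    have h3 : ⟪e - κ • one, one⟫ = 0 := by rw [← inner_conj_symm, h1, map_zero]
    have h4 : ⟪e - κ • one, e - κ • one⟫ = 0 := by
      rw [inner_sub_right, h2, inner_smul_right, h3]; ring
    exact sub_eq_zero.1 (inner_self_eq_zero.1 h4)
  · rintro ⟨κ, hκ⟩ w hw
    obtain ⟨h1, h2⟩ := (mem_GG _ _).1 hw
    have h3 : w = mkL (fstL w, (α:ℂ) • VV (fstL w)) := by rw [← h1, mk_eta]
    rw [h3, key, hκ, inner_smul_right, ← inner_conj_symm, h2]; simp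
end
end MHD

namespace MHD
section
open MeasureTheory
open scoped ComplexInnerProductSpace

structure Prof (u b u1 b1 u2 b2 : ℝ → ℝ) (c C : ℝ) : Prop where
  hc : 0 < c
  u0 : u 0 = 0
  b0 : b 0 = 0
  uc : ContinuousOn u (Icc (-1) 1)
  bc : ContinuousOn b (Icc (-1) 1)
  uc1 : ContinuousOn u1 (Icc (-1) 1)
  bc1 : ContinuousOn b1 (Icc (-1) 1)
  ud : ∀ y ∈ Ioo (-1:ℝ) 1, HasDerivAt u (u1 y) y
  bd : ∀ y ∈ Ioo (-1:ℝ) 1, HasDerivAt b (b1 y) y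
  udd : ∀ y ∈ Ioo (-1:ℝ) 1, HasDerivAt u1 (u2 y) y
  bdd : ∀ y ∈ Ioo (-1:ℝ) 1, HasDerivAt b1 (b2 y) y
  low : ∀ y ∈ Icc (-1:ℝ) 1, c ≤ b1 y - |u1 y|
  up : ∀ y ∈ Icc (-1:ℝ) 1, b1 y + |u1 y| ≤ C
  up2 : ∀ y ∈ Ioo (-1:ℝ) 1, |b2 y| + |u2 y| ≤ C

variable {u b u1 b1 u2 b2 : ℝ → ℝ} {c C : ℝ}

theorem Prof.right (h : Prof u b u1 b1 u2 b2 c C) :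
    HD (fun y => u y + b y) (fun y => b y - u y) (fun y => u1 y + b1 y) (fun y => b1 y - u1 y)
      (fun y => u2 y + b2 y) (fun y => b2 y - u2 y) c C := by
  have s1 : Icc (0:ℝ) 1 ⊆ Icc (-1) 1 := Icc_subset_Icc (by norm_num) le_rfl
  have s2 : Ioo (0:ℝ) 1 ⊆ Ioo (-1) 1 := Ioo_subset_Ioo (by norm_num) le_rfl
  exact {
    hc := h.hc
    g0 := by simp [h.u0, h.b0]
    k0 := by simp [h.u0, h.b0]
    gc := (h.uc.add h.bc).mono s1
    kc := (h.bc.sub h.uc).mono s1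
    gc' := (h.uc1.add h.bc1).mono s1
    kc' := (h.bc1.sub h.uc1).mono s1
    gd := fun y hy => (h.ud y (s2 hy)).add (h.bd y (s2 hy))
    kd := fun y hy => (h.bd y (s2 hy)).sub (h.ud y (s2 hy))
    gdd := fun y hy => (h.udd y (s2 hy)).add (h.bdd y (s2 hy))
    kdd := fun y hy => (h.bdd y (s2 hy)).sub (h.udd y (s2 hy))
    gl := fun y hy => by linarith [h.low y (s1 hy), neg_abs_le (u1 y)]
    gu := fun y hy => by linarith [h.up y (s1 hy), le_abs_self (u1 y)]
    kl := fun y hy => by linarith [h.low y (s1 hy), le_abs_self (u1 y)]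
    ku := fun y hy => by linarith [h.up y (s1 hy), neg_abs_le (u1 y)]
    g2 := fun y hy => by linarith [h.up2 y (s2 hy), abs_add_le (u2 y) (b2 y)]
    k2 := fun y hy => by linarith [h.up2 y (s2 hy), abs_sub (b2 y) (u2 y)] }

theorem Prof.left (h : Prof u b u1 b1 u2 b2 c C) :
    HD (fun y => - (b (-y) - u (-y))) (fun y => - (u (-y) + b (-y)))
      (fun y => b1 (-y) - u1 (-y)) (fun y => u1 (-y) + b1 (-y))
      (fun y => - (b2 (-y) - u2 (-y))) (fun y => - (u2 (-y) + b2 (-y))) c C := by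
  have s1 : ∀ y ∈ Icc (0:ℝ) 1, -y ∈ Icc (-1:ℝ) 1 := fun y hy => ⟨by linarith [hy.2], by linarith [hy.1]⟩
  have s2 : ∀ y ∈ Ioo (0:ℝ) 1, -y ∈ Ioo (-1:ℝ) 1 := fun y hy => ⟨by linarith [hy.2], by linarith [hy.1]⟩
  have cc : ∀ {f : ℝ → ℝ}, ContinuousOn f (Icc (-1) 1) → ContinuousOn (fun y => f (-y)) (Icc 0 1) :=
    fun hf => hf.comp continuousOn_neg s1
  have dd : ∀ {f : ℝ → ℝ} {d y : ℝ}, HasDerivAt f d (-y) → HasDerivAt (fun y => f (-y)) (-d) y :=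
    fun {f d y} hf => by
      have := hf.comp y (hasDerivAt_neg y)
      rw [mul_neg_one] at this
      exact this
  exact {
    hc := h.hc
    g0 := by simp [h.u0, h.b0]
    k0 := by simp [h.u0, h.b0]
    gc := (cc (h.bc.sub h.uc)).neg
    kc := (cc (h.uc.add h.bc)).neg
    gc' := cc (h.bc1.sub h.uc1)
    kc' := cc (h.uc1.add h.bc1)
    gd := fun y hy => (dd ((h.bd _ (s2 y hy)).sub (h.ud _ (s2 y hy)))).neg.congr_deriv (neg_neg _)
    kd := fun y hy => (dd ((h.ud _ (s2 y hy)).add (h.bd _ (s2 y hy)))).neg.congr_deriv (neg_neg _)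
    gdd := fun y hy => dd ((h.bdd _ (s2 y hy)).sub (h.udd _ (s2 y hy)))
    kdd := fun y hy => dd ((h.udd _ (s2 y hy)).add (h.bdd _ (s2 y hy)))
    gl := fun y hy => by linarith [h.low _ (s1 y hy), le_abs_self (u1 (-y))]
    gu := fun y hy => by linarith [h.up _ (s1 y hy), neg_abs_le (u1 (-y))]
    kl := fun y hy => by linarith [h.low _ (s1 y hy), neg_abs_le (u1 (-y))]
    ku := fun y hy => by linarith [h.up _ (s1 y hy), le_abs_self (u1 (-y))]
    g2 := fun y hy => by rw [abs_neg]; linarith [h.up2 _ (s2 y hy), abs_sub (b2 (-y)) (u2 (-y))]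
    k2 := fun y hy => by rw [abs_neg]; linarith [h.up2 _ (s2 y hy), abs_add_le (u2 (-y)) (b2 (-y))] }

theorem Prof.H_ge (h : Prof u b u1 b1 u2 b2 c C) {y : ℝ} (hy : y ∈ Icc (-1:ℝ) 1) :
    c ^ 2 * y ^ 2 ≤ b y ^ 2 - u y ^ 2 := by
  have hc := h.hc
  rcases le_total 0 y with h0 | h0
  · have h1 := (h.right.gb ⟨h0, hy.2⟩).1
    have h2 := (h.right.kb ⟨h0, hy.2⟩).1
    nlinarith [mul_le_mul h1 h2 (by positivity) (by linarith [mul_nonneg hc.le h0])]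
  · have h1 := (h.left.gb (y := -y) ⟨by linarith, by linarith [hy.1]⟩).1
    have h2 := (h.left.kb (y := -y) ⟨by linarith, by linarith [hy.1]⟩).1
    simp only [neg_neg] at h1 h2
    have h3 : 0 ≤ c * -y := mul_nonneg hc.le (by linarith)
    nlinarith [mul_le_mul h1 h2 h3 (by linarith)]

theorem Prof.ZZ_ne' (h : Prof u b u1 b1 u2 b2 c C) (x ε : ℝ) (hε : 0 < ε) {y : ℝ} (hy : y ∈ Icc (-1:ℝ) 1) :
    ZZ (fun y => u y + b y) (fun y => b y - u y) (x + ε * Complex.I) y ≠ 0 := by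
  intro h0
  have h1 := ZZ_im (g := fun y => u y + b y) (k := fun y => b y - u y) x ε hε y
  rw [h0] at h1
  have h2 := h.H_ge hy
  have h3 : 0 ≤ (u y + b y) * (b y - u y) := by nlinarith [mul_nonneg (sq_nonneg c) (sq_nonneg y)]
  have h4 : 0 ≤ (u y + b y) * (b y - u y) / (x ^ 2 + ε ^ 2) := by positivity
  simp only [Complex.zero_im] at h1
  nlinarith

theorem ZZ_flip (z : ℂ) (y : ℝ) : ZZ (fun y => - (b (-y) - u (-y))) (fun y => - (u (-y) + b (-y))) z y =
    ZZ (fun y => u y + b y) (fun y => b y - u y) z (-y) := by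
  simp only [ZZ]; push_cast; ring

theorem prim_hasDeriv {f F : ℝ → ℂ} (hf : Integrable f mu) (h : f =ᵐ[mu] F) {y : ℝ} (hy : y ∈ Ioo (-1:ℝ) 1)
    (hF : ContinuousAt F y) : HasDerivAt (prim f) (F y) y := by
  have hFi : Integrable F mu := hf.congr h
  have h1 : HasDerivAt (fun x => ∫ s in (-1)..x, F s) (F y) y := by
    apply intervalIntegral.integral_hasDerivAt_right
    · rw [intervalIntegrable_iff_integrableOn_Ioc_of_le hy.1.le]
      exact IntegrableOn.mono_set hFi (Ioc_subset_Ioc_right hy.2.le)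
    · refine ⟨Ioo (-1) 1, Ioo_mem_nhds hy.1 hy.2, ?_⟩
      exact (IntegrableOn.mono_set hFi Ioo_subset_Ioc_self).aestronglyMeasurable
    · exact hF
  refine h1.congr_of_eventuallyEq ?_
  filter_upwards [Ioo_mem_nhds hy.1 hy.2] with x hx
  exact prim_eq h (Ioo_subset_Icc_self hx)

theorem contOn_int {F : ℝ → ℂ} (hF : ContinuousOn F (Icc (-1) 1)) : Integrable F mu :=
  (hF.integrableOn_Icc).mono_set Ioc_subset_Icc_self

noncomputable def hh (u b : ℝ → ℝ) (y : ℝ) : ℝ := √(b y ^ 2 - u y ^ 2)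

theorem Prof.hh_sq (h : Prof u b u1 b1 u2 b2 c C) {y : ℝ} (hy : y ∈ Icc (-1:ℝ) 1) :
    hh u b y * hh u b y = b y ^ 2 - u y ^ 2 :=
  Real.mul_self_sqrt ((by positivity : (0:ℝ) ≤ c ^ 2 * y ^ 2).trans (h.H_ge hy))

set_option maxHeartbeats 1000000 in
theorem hres_prof (h : Prof u b u1 b1 u2 b2 c C) (hu : MemLp u ⊤ mu) (hm : MemLp (hh u b) ⊤ mu) (α : ℝ) :
    ∃ B : ℝ → ℝ, MemLp B 2 volume ∧ ∃ S : Set ℝ, S.Finite ∧ ∀ ε : ℝ, 0 < ε → ε ≤ 1 → ∀ x : ℝ, x ∉ S → ∀ w : YY,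
      PP α w = w → PP α (((x : ℂ) + ε * Complex.I) • w - (2:ℂ) • dia (MM u hu) w -
        ((x : ℂ) + ε * Complex.I)⁻¹ • dia (MM _ hm) (dia (MM _ hm) w) + mkL (chi 0, 0)) = 0 →
      ‖⟪mkL (chi 0, 0), w⟫‖ ≤ B x := by
  obtain ⟨B, hB, S, hS, hfull⟩ := full_bound h.right h.left α
  refine ⟨B, hB, S, hS, fun ε hε hε1 x hx w hw hv => ?_⟩
  set z : ℂ := (x : ℂ) + ε * Complex.I with hz
  have hz0 : z ≠ 0 := by
    intro h0
    have : z.im = ε := by simp [hz]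
    rw [h0] at this; simp at this; linarith
  obtain ⟨hw2, hw1⟩ := (mem_GG _ _).1 ((PP_self _ _).1 hw)
  set D := fstL w with hD
  obtain ⟨κ, hκ⟩ := (PP_zero_iff _ _).1 hv
  set v := z • w - (2:ℂ) • dia (MM u hu) w - z⁻¹ • dia (MM _ hm) (dia (MM _ hm) w) + mkL (chi 0, 0) with hvd
  set Zf : ℝ → ℂ := ZZ (fun y => u y + b y) (fun y => b y - u y) z with hZf
  have hZc : ContinuousOn Zf (Icc (-1) 1) := by
    have h1 : ContinuousOn (fun y => (u y : ℂ)) (Icc (-1) 1) := Complex.continuous_ofReal.comp_continuousOn h.uc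
    have h2 : ContinuousOn (fun y => (b y : ℂ)) (Icc (-1) 1) := Complex.continuous_ofReal.comp_continuousOn h.bc
    have : Zf = fun y => (z + ((b y : ℂ) - u y)) * (z - (u y + b y)) / z := by
      funext y; simp only [hZf, ZZ]; push_cast; ring
    rw [this]
    fun_prop
  have hZe : ∀ y ∈ Icc (-1:ℝ) 1, Zf y = z - 2 * u y - z⁻¹ * (hh u b y * hh u b y) := by
    intro y hy
    have := h.hh_sq hy
    rw [← Complex.ofReal_mul, this]
    simp only [hZf, ZZ]
    push_cast
    field_simp
    ring
  have hrm : ∀ᵐ y ∂mu, y ∈ Ioc (-1:ℝ) 1 := ae_restrict_mem measurableSet_Ioc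
  have hmul : ∀ g : LL, ∀ᵐ y ∂mu, (z • g - (2:ℂ) • MM u hu g - z⁻¹ • MM _ hm (MM _ hm g)) y = Zf y * g y := by
    intro g
    filter_upwards [hrm, MM_coe u hu g, MM_coe _ hm g, MM_coe _ hm (MM _ hm g),
      Lp.coeFn_sub (z • g - (2:ℂ) • MM u hu g) (z⁻¹ • MM _ hm (MM _ hm g)), Lp.coeFn_sub (z • g) ((2:ℂ) • MM u hu g),
      Lp.coeFn_smul z g, Lp.coeFn_smul (2:ℂ) (MM u hu g), Lp.coeFn_smul z⁻¹ (MM _ hm (MM _ hm g))] with y hy a1 a2 a3 a4 a5 a6 a7 a8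
    rw [a4, Pi.sub_apply, a5, Pi.sub_apply, a6, a7, a8, Pi.smul_apply, Pi.smul_apply, Pi.smul_apply, a1, a3, a2, hZe y (Ioc_subset_Icc_self hy)]
    simp only [smul_eq_mul]
    ring
  have hDi := LL_int D
  set X : ℝ → ℂ := prim D with hX
  have hXc : Continuous X := prim_cont hDi
  have hv1 : fstL v = (z • D - (2:ℂ) • MM u hu D - z⁻¹ • MM _ hm (MM _ hm D)) + chi 0 := by
    simp only [hvd, map_add, map_sub, map_smul, fst_dia, fst_mk, hD]
  have hv2 : sndL v = (α : ℂ) • (z • VV D - (2:ℂ) • MM u hu (VV D) - z⁻¹ • MM _ hm (MM _ hm (VV D))) := by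
    simp only [hvd, map_add, map_sub, map_smul, snd_dia, snd_mk, hw2, add_zero, smul_sub]
    simp only [smul_comm (α:ℂ)]
  set F : ℝ → ℂ := fun y => (α : ℂ) * (Zf y * X y) with hF
  have hFc : ContinuousOn F (Icc (-1) 1) := continuousOn_const.mul (hZc.mul hXc.continuousOn)
  have hsF : sndL v =ᵐ[mu] F := by
    rw [hv2]
    filter_upwards [hmul (VV D), VV_coe D, Lp.coeFn_smul (α:ℂ) (z • VV D - (2:ℂ) • MM u hu (VV D) - z⁻¹ • MM _ hm (MM _ hm (VV D)))] with y a1 a2 a3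
    rw [a3, Pi.smul_apply, a1, a2, smul_eq_mul]
  set c1 := ⟪one, sndL v⟫ with hc1
  set Pf : ℝ → ℂ := fun y => κ - α * c1 + α * prim (sndL v) y with hPf
  have hPc : Continuous Pf := continuous_const.add (continuous_const.mul (prim_cont (LL_int _)))
  set Q : ℝ → ℂ := fun y => (Pf y - if y ≤ 0 then 1 else 0) / Zf y with hQ
  have hZne : ∀ y ∈ Icc (-1:ℝ) 1, Zf y ≠ 0 := fun y hy => h.ZZ_ne' x ε hε hy
  have hDQ : D =ᵐ[mu] Q := by
    have hκ' : ∀ᵐ y ∂mu, (fstL v + (α : ℂ) • (c1 • one - VV (sndL v))) y = (κ • one) y := by rw [hκ]; exact Eventually.of_forall fun _ => rfl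
    rw [hv1] at hκ'
    filter_upwards [hrm, hκ', hmul D, VV_coe (sndL v), one_coe, 
      Lp.coeFn_add ((z • D - (2:ℂ) • MM u hu D - z⁻¹ • MM _ hm (MM _ hm D)) + chi 0) ((α : ℂ) • (c1 • one - VV (sndL v))),
      Lp.coeFn_add (z • D - (2:ℂ) • MM u hu D - z⁻¹ • MM _ hm (MM _ hm D)) (chi 0),
      Lp.coeFn_smul (α:ℂ) (c1 • one - VV (sndL v)), Lp.coeFn_sub (c1 • one) (VV (sndL v)), Lp.coeFn_smul c1 one, Lp.coeFn_smul κ one,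
      indicatorConstLp_coeFn (p := 2) (s := Ioc (-1) 0) (hs := measurableSet_Ioc) (hμs := measure_ne_top mu _) (c := (1:ℂ))]
      with y hy a1 a2 a3 a4 a5 a6 a7 a8 a9 a10 a11
    rw [a5, Pi.add_apply, a6, Pi.add_apply, a2, a7, Pi.smul_apply, a8, Pi.sub_apply, a9, a10, Pi.smul_apply, Pi.smul_apply, a4, a3, chi, a11] at a1
    simp only [smul_eq_mul, indicator, mem_Ioc, hy.1, true_and, mul_one] at a1
    rw [hQ]
    simp only [hPf]
    rw [eq_div_iff (hZne y (Ioc_subset_Icc_self hy))]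
    linear_combination a1
  have hX1 : X 1 = 0 := by rw [hX, prim_one, ← inner_one, hw1]
  have hXm : X (-1) = 0 := by simp [hX, prim]
  have hnb : ∀ y ∈ Ioo (-1:ℝ) 1, Icc (-1:ℝ) 1 ∈ 𝓝 y := fun y hy => Icc_mem_nhds hy.1 hy.2
  have hPd : ∀ y ∈ Ioo (-1:ℝ) 1, HasDerivAt Pf (α ^ 2 * Zf y * X y) y := by
    intro y hy
    have h1 := prim_hasDeriv (LL_int (sndL v)) hsF hy (hFc.continuousAt (hnb y hy))
    refine ((h1.const_mul (α:ℂ)).const_add (κ - α * c1)).congr_deriv ?_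
    simp only [hF]; ring
  have hQc : ∀ y ∈ Ioo (-1:ℝ) 1, ∀ d : ℂ, ContinuousAt (fun y => (Pf y - d) / Zf y) y := by
    intro y hy d
    exact (hPc.continuousAt.sub continuousAt_const).div (hZc.continuousAt (hnb y hy)) (hZne y (Ioo_subset_Icc_self hy))
  have hXr : ∀ y ∈ Ioo (0:ℝ) 1, HasDerivAt X (Pf y / Zf y) y := by
    intro y hy
    have hy' : y ∈ Ioo (-1:ℝ) 1 := ⟨by linarith [hy.1], hy.2⟩
    have h1 : ContinuousAt Q y := (hQc y hy' 0).congr (by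
      filter_upwards [lt_mem_nhds hy.1] with s hs
      simp [hQ, not_le.2 hs])
    refine (prim_hasDeriv hDi hDQ hy' h1).congr_deriv ?_
    simp [hQ, not_le.2 hy.1]
  have hXl : ∀ y ∈ Ioo (-1:ℝ) 0, HasDerivAt X ((Pf y - 1) / Zf y) y := by
    intro y hy
    have hy' : y ∈ Ioo (-1:ℝ) 1 := ⟨hy.1, by linarith [hy.2]⟩
    have h1 : ContinuousAt Q y := (hQc y hy' 1).congr (by
      filter_upwards [gt_mem_nhds hy.2] with s hs
      simp [hQ, hs.le])
    refine (prim_hasDeriv hDi hDQ hy' h1).congr_deriv ?_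
    simp [hQ, hy.2.le]
  have hS1 : HS (fun y => u y + b y) (fun y => b y - u y) α z X Pf :=
    ⟨hXc.continuousOn, hPc.continuousOn, hXr, fun y hy => hPd y ⟨by linarith [hy.1], hy.2⟩, hX1⟩
  have hS2 : HS (fun y => - (b (-y) - u (-y))) (fun y => - (u (-y) + b (-y))) α z (fun y => X (-y)) (fun y => - (Pf (-y) - 1)) := by
    refine ⟨by fun_prop, by fun_prop, fun y hy => ?_, fun y hy => ?_, hXm⟩
    · rw [ZZ_flip]
      refine ((hXl (-y) ⟨by linarith [hy.2], by linarith [hy.1]⟩).scomp y (hasDerivAt_neg y)).congr_deriv ?_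
      simp only [neg_smul, one_smul]; ring
    · rw [ZZ_flip]
      refine (((hPd (-y) ⟨by linarith [hy.2], by linarith [hy.1]⟩).scomp y (hasDerivAt_neg y)).sub_const 1).neg.congr_deriv ?_
      simp only [neg_smul, one_smul, neg_neg]; rfl
  have := hfull ε hε hε1 x hx X Pf _ _ hS1 hS2 (by simp) (by
    simp only [JJ, neg_zero]
    rw [show -(Pf 0 * (starRingEnd ℂ) (X 0)) + -(-(Pf 0 - 1) * (starRingEnd ℂ) (X 0)) = - (starRingEnd ℂ) (X 0) by ring]
    simp)
  rw [YY_inner, fst_mk, snd_mk, inner_zero_left, add_zero, inner_chi _ (by norm_num)]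
  exact this
end
end MHD

namespace MHD
section
open MeasureTheory
open scoped ComplexInnerProductSpace

def Rep (v : LL) (f : ℝ → ℂ) : Prop := v =ᵐ[mu] f

theorem Rep.add {v w : LL} {f g : ℝ → ℂ} (h1 : Rep v f) (h2 : Rep w g) : Rep (v + w) (fun y => f y + g y) := by
  filter_upwards [h1, h2, Lp.coeFn_add v w] with y a1 a2 a3
  rw [a3, Pi.add_apply, a1, a2]

theorem Rep.sub {v w : LL} {f g : ℝ → ℂ} (h1 : Rep v f) (h2 : Rep w g) : Rep (v - w) (fun y => f y - g y) := by
  filter_upwards [h1, h2, Lp.coeFn_sub v w] with y a1 a2 a3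
  rw [a3, Pi.sub_apply, a1, a2]

theorem Rep.smul {v : LL} {f : ℝ → ℂ} (h1 : Rep v f) (c : ℂ) : Rep (c • v) (fun y => c * f y) := by
  filter_upwards [h1, Lp.coeFn_smul c v] with y a1 a3
  rw [a3, Pi.smul_apply, a1, smul_eq_mul]

theorem Rep.MM {v : LL} {f : ℝ → ℂ} (h1 : Rep v f) (g : ℝ → ℝ) (hg : MemLp g ⊤ mu) : Rep (MM g hg v) (fun y => g y * f y) := by
  filter_upwards [h1, MM_coe g hg v] with y a1 a3
  rw [a3, a1]

theorem rep_one : Rep one (fun _ => 1) := one_coe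

theorem mu_nice : ∀ᵐ y ∂mu, y ∈ Ioo (-1:ℝ) 1 ∧ y ≠ 0 := by
  have h0 : ∀ᵐ y ∂mu, y ≠ (0:ℝ) := by
    have : mu {(0:ℝ)} = 0 := measure_singleton _
    exact compl_mem_ae_iff.2 this
  have h1 : ∀ᵐ y ∂mu, y ≠ (1:ℝ) := by
    have : mu {(1:ℝ)} = 0 := measure_singleton _
    exact compl_mem_ae_iff.2 this
  filter_upwards [h0, h1, ae_restrict_mem measurableSet_Ioc] with y a1 a2 a3
  exact ⟨⟨a3.1, lt_of_le_of_ne a3.2 a2⟩, a1⟩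

theorem Rep.congr {v : LL} {f g : ℝ → ℂ} (h1 : Rep v f) (h : ∀ y ∈ Ioo (-1:ℝ) 1, y ≠ 0 → f y = g y) : Rep v g := by
  filter_upwards [h1, mu_nice] with y a1 a2
  rw [a1, h y a2.1 a2.2]

theorem Rep.eq {v w : LL} {f g : ℝ → ℂ} (h1 : Rep v f) (h2 : Rep w g) (h : ∀ y ∈ Ioo (-1:ℝ) 1, y ≠ 0 → f y = g y) : v = w := by
  apply Lp.ext
  filter_upwards [h1.congr h, h2] with y a1 a2
  rw [a1, a2]

theorem Rep.VV {v : LL} {f : ℝ → ℂ} (h1 : Rep v f) : Rep (VV v) (fun y => ∫ s in (-1)..y, f s) := by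
  filter_upwards [VV_coe v, mu_nice] with y a1 a2
  rw [a1, prim_eq h1 (Ioo_subset_Icc_self a2.1)]

theorem Rep.inner_one {v : LL} {f : ℝ → ℂ} (h1 : Rep v f) : ⟪one, v⟫ = ∫ s in (-1)..1, f s := by
  rw [MHD.inner_one, ← prim_one, prim_eq h1 (by simp)]

theorem Rep.ii {v : LL} {f : ℝ → ℂ} (h1 : Rep v f) {y : ℝ} (hy : y ∈ Icc (-1:ℝ) 1) : IntervalIntegrable f volume (-1) y := by
  rw [intervalIntegrable_iff_integrableOn_Ioc_of_le hy.1]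
  exact IntegrableOn.mono_set ((LL_int v).congr h1) (Ioc_subset_Ioc_right hy.2)

/-- primitive of a represented function -/
theorem Rep.ftc {v : LL} {f F : ℝ → ℂ} (h1 : Rep v f) (hc : ContinuousOn F (Icc (-1) 1))
    (hd : ∀ y ∈ Ioo (-1:ℝ) 1, y ≠ 0 → HasDerivAt F (f y) y) {y : ℝ} (hy : y ∈ Icc (-1:ℝ) 1) :
    ∫ s in (-1)..y, f s = F y - F (-1) := by
  refine integral_eq_of_hasDerivAt_off_countable_of_le F f hy.1 (countable_singleton (0:ℝ))
    (hc.mono (Icc_subset_Icc_right hy.2)) (fun x hx => hd x ⟨hx.1.1, hx.1.2.trans_le hy.2⟩ hx.2) (h1.ii hy)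

open Classical in
noncomputable def TL (f : ℝ → ℂ) : LL := if h : MemLp f 2 mu then h.toLp else 0

theorem contOn_memLp {F : ℝ → ℂ} (hF : ContinuousOn F (Icc (-1) 1)) (p) : MemLp F p mu := by
  obtain ⟨C, hC⟩ := (isCompact_Icc (a := (-1:ℝ)) (b := 1)).exists_bound_of_continuousOn hF
  refine MemLp.of_bound (contOn_int hF).aestronglyMeasurable C ?_
  filter_upwards [ae_restrict_mem measurableSet_Ioc] with y hy
  exact hC y (Ioc_subset_Icc_self hy)

theorem TL_rep {f : ℝ → ℂ} (hf : ContinuousOn f (Icc (-1) 1)) : Rep (TL f) f := by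
  rw [TL, dif_pos (contOn_memLp hf 2)]
  exact MemLp.coeFn_toLp _

theorem Rep.norm_le {v : LL} {f : ℝ → ℂ} (h1 : Rep v f) {c : ℝ} (h : ∀ y ∈ Icc (-1:ℝ) 1, ‖f y‖ ≤ c) : ‖v‖ ≤ c * ‖one‖ := by
  apply Lp.norm_le_mul_norm_of_ae_le_mul
  filter_upwards [h1, mu_nice, one_coe] with y a1 a2 a3
  rw [a1, a3, norm_one, mul_one]
  exact h y (Ioo_subset_Icc_self a2.1)

theorem slice {F : ℝ → ℝ → ℂ} (hF : ContinuousOn (fun p : ℝ × ℝ => F p.1 p.2) (Ici (0:ℝ) ×ˢ Icc (-1:ℝ) 1)) {t : ℝ} (ht : 0 ≤ t) :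
    ContinuousOn (F t) (Icc (-1) 1) :=
  hF.comp (f := fun y => (t, y)) (by fun_prop) (fun y hy => ⟨ht, hy⟩)

theorem curve {F F' : ℝ → ℝ → ℂ} (hF : ContinuousOn (fun p : ℝ × ℝ => F p.1 p.2) (Ici (0:ℝ) ×ˢ Icc (-1:ℝ) 1))
    (hF' : ContinuousOn (fun p : ℝ × ℝ => F' p.1 p.2) (Ici (0:ℝ) ×ˢ Icc (-1:ℝ) 1))
    (hd : ∀ t ≥ 0, ∀ y ∈ Icc (-1:ℝ) 1, HasDerivAt (fun s => F s y) (F' t y) t) (t : ℝ) (ht : 0 ≤ t) :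
    HasDerivWithinAt (fun t => TL (F t)) (TL (F' t)) (Ici 0) t := by
  rw [hasDerivWithinAt_iff_isLittleO, Asymptotics.isLittleO_iff]
  intro e he
  set e' := e / (‖one‖ + 1) with he'
  have he0 : 0 < e' := by positivity
  have hK : IsCompact (Icc (0:ℝ) (t + 1) ×ˢ Icc (-1:ℝ) 1) := isCompact_Icc.prod isCompact_Icc
  have huc := hK.uniformContinuousOn_of_continuous (hF'.mono (prod_mono Icc_subset_Ici_self le_rfl))
  rw [Metric.uniformContinuousOn_iff] at huc
  obtain ⟨δ, hδ, huc⟩ := huc e' he0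
  have hnear : ∀ᶠ s in 𝓝[Ici 0] t, s ∈ Ici (0:ℝ) ∧ dist s t < min δ 1 :=
    (eventually_mem_nhdsWithin).and (mem_nhdsWithin_of_mem_nhds (Metric.ball_mem_nhds t (by positivity)))
  filter_upwards [hnear] with s hs
  have hrep : Rep (TL (F s) - TL (F t) - (s - t) • TL (F' t)) (fun y => F s y - F t y - ((s - t : ℝ) : ℂ) * F' t y) := by
    have : (s - t) • TL (F' t) = ((s - t : ℝ) : ℂ) • TL (F' t) := (Complex.coe_smul _ _).symm
    rw [this]
    exact ((TL_rep (slice hF hs.1)).sub (TL_rep (slice hF ht))).sub ((TL_rep (slice hF' ht)).smul _)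
  have hb : ∀ y ∈ Icc (-1:ℝ) 1, ‖F s y - F t y - ((s - t : ℝ) : ℂ) * F' t y‖ ≤ e' * ‖s - t‖ := by
    intro y hy
    have := (convex_Ici (0:ℝ)).inter (convex_ball t (min δ 1)) |>.norm_image_sub_le_of_norm_hasDerivWithin_le
      (f := fun s => F s y - (s : ℂ) * F' t y) (f' := fun r => F' r y - F' t y) (C := e')
      (fun r hr => by
        refine HasDerivAt.hasDerivWithinAt ?_
        have h2 : HasDerivAt (fun s : ℝ => (s : ℂ) * F' t y) (F' t y) r := by
          simpa using (Complex.ofRealCLM.hasDerivAt (x := r)).mul_const (F' t y)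
        exact (hd r hr.1 y hy).sub h2)
      (fun r hr => by
        have hr2 : dist r t < min δ 1 := hr.2
        have hr3 : |r - t| < 1 := hr2.trans_le (min_le_right _ _)
        have := huc (r, y) ⟨⟨hr.1, by linarith [le_abs_self (r - t)]⟩, hy⟩ (t, y) ⟨⟨ht, by linarith⟩, hy⟩
          (by rw [Prod.dist_eq, dist_self]; exact max_lt (hr2.trans_le (min_le_left _ _)) hδ)
        rw [dist_eq_norm] at this
        exact this.le)
      (x := t) (y := s) ⟨ht, Metric.mem_ball_self (by positivity)⟩ ⟨hs.1, hs.2⟩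
    refine le_trans (le_of_eq ?_) this
    congr 1
    push_cast
    ring
  refine (hrep.norm_le hb).trans ?_
  have h3 : e' * ‖one‖ ≤ e := by
    rw [he', div_mul_eq_mul_div, div_le_iff₀ (by positivity)]
    nlinarith [norm_nonneg one]
  nlinarith [norm_nonneg (s - t)]
end
end MHD

namespace MHD
section
open MeasureTheory
open scoped ComplexInnerProductSpace

noncomputable def BB : LL →L[ℂ] LL := VV - (1/2:ℂ) • ((innerSL ℂ one ∘L VV).smulRight one)

theorem BB_apply (p : LL) : BB p = VV p - ((1/2:ℂ) * ⟪one, VV p⟫) • one := by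
  simp [BB, mul_smul]

theorem deriv_clm (T : LL →L[ℂ] LL) {c : ℝ → LL} {c' : LL} {s : Set ℝ} {t : ℝ} (h : HasDerivWithinAt c c' s t) :
    HasDerivWithinAt (fun t => T (c t)) (T c') s t :=
  ((T.restrictScalars ℝ).hasFDerivAt (x := c t)).comp_hasDerivWithinAt t h

theorem eqOn_of_rep {v : LL} {f g : ℝ → ℂ} (h1 : Rep v f) (h2 : Rep v g) (hf : ContinuousOn f (Icc (-1) 1))
    (hg : ContinuousOn g (Icc (-1) 1)) : EqOn f g (Icc (-1) 1) := by
  refine Measure.eqOn_Icc_of_ae_eq volume (by norm_num) ?_ hf hg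
  rw [← Measure.restrict_congr_set (Ioc_ae_eq_Icc (μ := volume))]
  exact h1.symm.trans h2

theorem field {ψ ψy ψyy ψt ψyyt : ℝ → ℝ → ℂ}
    (c0 : ContinuousOn (fun p : ℝ × ℝ => ψ p.1 p.2) (Ici (0:ℝ) ×ˢ Icc (-1:ℝ) 1))
    (c1 : ContinuousOn (fun p : ℝ × ℝ => ψy p.1 p.2) (Ici (0:ℝ) ×ˢ Icc (-1:ℝ) 1))
    (c2 : ContinuousOn (fun p : ℝ × ℝ => ψyy p.1 p.2) (Ici (0:ℝ) ×ˢ Icc (-1:ℝ) 1))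
    (c3 : ContinuousOn (fun p : ℝ × ℝ => ψt p.1 p.2) (Ici (0:ℝ) ×ˢ Icc (-1:ℝ) 1))
    (c4 : ContinuousOn (fun p : ℝ × ℝ => ψyyt p.1 p.2) (Ici (0:ℝ) ×ˢ Icc (-1:ℝ) 1))
    (d1 : ∀ t ≥ 0, ∀ y ∈ Icc (-1:ℝ) 1, HasDerivAt (ψ t) (ψy t y) y)
    (d2 : ∀ t ≥ 0, ∀ y ∈ Icc (-1:ℝ) 1, HasDerivAt (ψy t) (ψyy t y) y)
    (d3 : ∀ t ≥ 0, ∀ y ∈ Icc (-1:ℝ) 1, HasDerivAt (fun s => ψ s y) (ψt t y) t)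
    (d4 : ∀ t ≥ 0, ∀ y ∈ Icc (-1:ℝ) 1, HasDerivAt (fun s => ψyy s y) (ψyyt t y) t)
    (bc : ∀ t ≥ 0, ψ t (-1) = 0 ∧ ψ t 1 = 0) :
    ∃ q : ℝ → ℝ → ℂ, ∀ t ≥ 0, ContinuousOn (q t) (Icc (-1) 1) ∧
      (∀ y ∈ Ioo (-1:ℝ) 1, HasDerivAt (ψt t) (q t y) y) ∧
      (∀ y ∈ Ioo (-1:ℝ) 1, HasDerivAt (q t) (ψyyt t y) y) ∧ ψt t (-1) = 0 ∧ ψt t 1 = 0 ∧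
      HasDerivWithinAt (fun t => TL (ψ t)) (TL (ψt t)) (Ici 0) t ∧
      HasDerivWithinAt (fun t => TL (ψy t)) (TL (q t)) (Ici 0) t := by
  have h2 : ∀ t ≥ 0, TL (ψ t) = VV (TL (ψy t)) := fun t ht => by
    refine (TL_rep (slice c0 ht)).eq (TL_rep (slice c1 ht)).VV fun y hy _ => ?_
    rw [(TL_rep (slice c1 ht)).ftc (slice c0 ht) (fun x hx _ => d1 t ht x (Ioo_subset_Icc_self hx)) (Ioo_subset_Icc_self hy), (bc t ht).1, sub_zero]
  have h1 : ∀ t ≥ 0, TL (ψy t) = BB (TL (ψyy t)) := fun t ht => by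
    have e1 : VV (TL (ψyy t)) = TL (ψy t) - (ψy t (-1)) • one := by
      refine (TL_rep (slice c2 ht)).VV.eq ((TL_rep (slice c1 ht)).sub (rep_one.smul _)) fun y hy _ => ?_
      rw [(TL_rep (slice c2 ht)).ftc (slice c1 ht) (fun x hx _ => d2 t ht x (Ioo_subset_Icc_self hx)) (Ioo_subset_Icc_self hy), mul_one]
    have e2 : ⟪one, TL (ψy t)⟫ = 0 := by
      rw [(TL_rep (slice c1 ht)).inner_one, (TL_rep (slice c1 ht)).ftc (slice c0 ht) (fun x hx _ => d1 t ht x (Ioo_subset_Icc_self hx)) (by simp),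
        (bc t ht).1, (bc t ht).2, sub_zero]
    rw [BB_apply, e1, inner_sub_right, e2, inner_smul_right, inner_one_one]
    rw [show (1/2:ℂ) * (0 - ψy t (-1) * 2) = - ψy t (-1) by ring, neg_smul]
    abel
  set W : ℝ → LL := fun t => TL (ψyyt t) with hW
  have k1 : ∀ t ≥ 0, HasDerivWithinAt (fun t => TL (ψy t)) (BB (W t)) (Ici 0) t := fun t ht =>
    (deriv_clm BB (curve c2 c4 d4 t ht)).congr (fun s hs => h1 s hs) (h1 t ht)
  have k2 : ∀ t ≥ 0, HasDerivWithinAt (fun t => TL (ψ t)) (VV (BB (W t))) (Ici 0) t := fun t ht =>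
    (deriv_clm VV (k1 t ht)).congr (fun s hs => h2 s hs) (h2 t ht)
  have k3 : ∀ t ≥ 0, TL (ψt t) = VV (BB (W t)) := fun t ht =>
    (uniqueDiffOn_Ici (0:ℝ) t ht).eq_deriv _ (curve c0 c3 d3 t ht) (k2 t ht)
  refine ⟨fun t y => prim (W t) y - (1/2:ℂ) * ⟪one, VV (W t)⟫, fun t ht => ?_⟩
  set q : ℝ → ℂ := fun y => prim (W t) y - (1/2:ℂ) * ⟪one, VV (W t)⟫ with hq
  have hqc : Continuous q := (prim_cont (LL_int _)).sub continuous_const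
  have hBq : Rep (BB (W t)) q := by
    rw [BB_apply]
    exact (Rep.sub (VV_coe (W t)) (rep_one.smul _)).congr fun y _ _ => by rw [mul_one]
  have hT : TL q = BB (W t) := (TL_rep hqc.continuousOn).eq hBq fun _ _ _ => rfl
  have hbq : EqOn (ψt t) (prim (BB (W t))) (Icc (-1) 1) := by
    refine eqOn_of_rep (TL_rep (slice c3 ht)) ?_ (slice c3 ht) (prim_cont (LL_int _)).continuousOn
    rw [k3 t ht]
    exact VV_coe _
  refine ⟨hqc.continuousOn, fun y hy => ?_, fun y hy => ?_, ?_, ?_, ?_, ?_⟩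
  · have := prim_hasDeriv (LL_int (BB (W t))) hBq hy hqc.continuousAt
    refine this.congr_of_eventuallyEq ?_
    filter_upwards [Icc_mem_nhds hy.1 hy.2] with s hs using hbq hs
  · exact (prim_hasDeriv (LL_int (W t)) (TL_rep (slice c4 ht)) hy ((slice c4 ht).continuousAt (Icc_mem_nhds hy.1 hy.2))).sub_const _
  · rw [hbq (by simp)]; simp [prim]
  · rw [hbq (by simp), prim_one, ← inner_one, BB_apply, inner_sub_right, inner_smul_right, inner_one_one]
    ring
  · exact curve c0 c3 d3 t ht
  · rw [hT]; exact k1 t ht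
end
end MHD

namespace MHD
section
open MeasureTheory

variable {u b u1 b1 u2 b2 : ℝ → ℝ} {c C : ℝ}

theorem lz {f f' : ℝ → ℂ} {K y : ℝ} (hf : ContinuousOn f (Icc (-1) 1)) (hd : ∀ x ∈ Ioo (-1:ℝ) 1, x ≠ 0 → HasDerivAt f (f' x) x)
    (hy : y ∈ Icc (-1:ℝ) 1) (hb : ∀ x ∈ Ioo (-1:ℝ) 1, x ≠ 0 → |x| ≤ |y| → ‖f' x‖ ≤ K) : ‖f y - f 0‖ ≤ K * |y| := by
  have hG : ∀ x, HasDerivAt (fun x : ℝ => K * x) K x := fun x => by simpa using (hasDerivAt_id x).const_mul K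
  have hGc : Continuous (fun x : ℝ => K * x) := by fun_prop
  rcases le_total 0 y with h0 | h0
  · have := norm_sub_le_of_deriv_le h0 (hf.mono (Icc_subset_Icc (by norm_num) hy.2)) hGc.continuousOn
      (fun x hx => hd x ⟨by linarith [hx.1], by linarith [hx.2, hy.2]⟩ hx.1.ne') (fun x _ => hG x)
      (fun x hx => hb x ⟨by linarith [hx.1], by linarith [hx.2, hy.2]⟩ hx.1.ne' (by
        rw [abs_of_nonneg h0, abs_of_nonneg hx.1.le]; exact hx.2.le))
    rw [abs_of_nonneg h0]; linarith
  · have := norm_sub_le_of_deriv_le h0 (hf.mono (Icc_subset_Icc hy.1 (by norm_num))) hGc.continuousOn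
      (fun x hx => hd x ⟨by linarith [hx.1, hy.1], by linarith [hx.2]⟩ hx.2.ne) (fun x _ => hG x)
      (fun x hx => hb x ⟨by linarith [hx.1, hy.1], by linarith [hx.2]⟩ hx.2.ne (by
        rw [abs_of_nonpos h0, abs_of_nonpos hx.2.le]; linarith [hx.1]))
    rw [abs_of_nonpos h0, norm_sub_rev]; linarith

theorem lzr {f f' : ℝ → ℝ} {K y : ℝ} (hf : ContinuousOn f (Icc (-1) 1)) (hd : ∀ x ∈ Ioo (-1:ℝ) 1, HasDerivAt f (f' x) x)
    (hy : y ∈ Icc (-1:ℝ) 1) (hb : ∀ x ∈ Ioo (-1:ℝ) 1, |x| ≤ |y| → |f' x| ≤ K) : |f y - f 0| ≤ K * |y| := by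
  have := lz (f := fun x => (f x : ℂ)) (f' := fun x => (f' x : ℂ)) (Complex.continuous_ofReal.comp_continuousOn hf)
    (fun x hx _ => (hd x hx).ofReal_comp) hy (fun x hx _ h => by simpa using hb x hx h)
  rw [← Complex.ofReal_sub, Complex.norm_real] at this
  exact this

noncomputable def mm (u b u1 b1 : ℝ → ℝ) (y : ℝ) : ℝ := if y = 0 then u1 0 / b1 0 else u y / b y
noncomputable def m1 (u b u1 b1 : ℝ → ℝ) (y : ℝ) : ℝ := (u1 y * b y - u y * b1 y) / b y ^ 2

theorem Prof.b_ge (h : Prof u b u1 b1 u2 b2 c C) {y : ℝ} (hy : y ∈ Icc (-1:ℝ) 1) : c * |y| ≤ |b y| := by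
  have h1 := h.H_ge hy
  apply le_of_sq_le_sq _ (abs_nonneg _)
  rw [mul_pow, sq_abs, sq_abs]
  nlinarith [sq_nonneg (u y)]

theorem Prof.b_ne (h : Prof u b u1 b1 u2 b2 c C) {y : ℝ} (hy : y ∈ Icc (-1:ℝ) 1) (h0 : y ≠ 0) : b y ≠ 0 := by
  intro hb
  have := h.b_ge hy
  rw [hb, abs_zero] at this
  have : 0 < c * |y| := mul_pos h.hc (abs_pos.2 h0)
  linarith

theorem Prof.mm_mul (h : Prof u b u1 b1 u2 b2 c C) {y : ℝ} (hy : y ∈ Icc (-1:ℝ) 1) : mm u b u1 b1 y * b y = u y := by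
  unfold mm
  split_ifs with h0
  · subst h0; simp [h.u0, h.b0]
  · exact div_mul_cancel₀ _ (h.b_ne hy h0)

theorem Prof.m1_mul (h : Prof u b u1 b1 u2 b2 c C) {y : ℝ} (hy : y ∈ Icc (-1:ℝ) 1) (h0 : y ≠ 0) :
    b y * m1 u b u1 b1 y = u1 y - mm u b u1 b1 y * b1 y := by
  have := h.b_ne hy h0
  simp only [mm, m1, if_neg h0]
  field_simp

theorem Prof.mm_d (h : Prof u b u1 b1 u2 b2 c C) {y : ℝ} (hy : y ∈ Ioo (-1:ℝ) 1) (h0 : y ≠ 0) :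
    HasDerivAt (mm u b u1 b1) (m1 u b u1 b1 y) y := by
  have := (h.ud y hy).div (h.bd y hy) (h.b_ne (Ioo_subset_Icc_self hy) h0)
  refine this.congr_of_eventuallyEq ?_
  filter_upwards [isOpen_ne.mem_nhds h0] with s hs
  simp only [mm, if_neg hs]; rfl

theorem Prof.C0 (h : Prof u b u1 b1 u2 b2 c C) : c ≤ C := by
  have h1 := h.low 0 (by simp)
  have h2 := h.up 0 (by simp)
  linarith [abs_nonneg (u1 0)]

theorem Prof.u1_le (h : Prof u b u1 b1 u2 b2 c C) {y : ℝ} (hy : y ∈ Icc (-1:ℝ) 1) : |u1 y| ≤ C := by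
  linarith [h.up y hy, h.low y hy, h.hc, abs_nonneg (u1 y)]

theorem Prof.b1_le (h : Prof u b u1 b1 u2 b2 c C) {y : ℝ} (hy : y ∈ Icc (-1:ℝ) 1) : |b1 y| ≤ C := by
  have : 0 ≤ b1 y := by linarith [h.low y hy, h.hc, abs_nonneg (u1 y)]
  rw [abs_of_nonneg this]
  linarith [h.up y hy, abs_nonneg (u1 y)]

theorem Prof.u_le (h : Prof u b u1 b1 u2 b2 c C) {y : ℝ} (hy : y ∈ Icc (-1:ℝ) 1) : |u y| ≤ C * |y| := by
  have := lzr h.uc h.ud hy (fun x hx _ => h.u1_le (Ioo_subset_Icc_self hx))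
  rwa [h.u0, sub_zero] at this

theorem Prof.b_le (h : Prof u b u1 b1 u2 b2 c C) {y : ℝ} (hy : y ∈ Icc (-1:ℝ) 1) : |b y| ≤ C * |y| := by
  have := lzr h.bc h.bd hy (fun x hx _ => h.b1_le (Ioo_subset_Icc_self hx))
  rwa [h.b0, sub_zero] at this

theorem Prof.u1_lz (h : Prof u b u1 b1 u2 b2 c C) {y : ℝ} (hy : y ∈ Icc (-1:ℝ) 1) : |u1 y - u1 0| ≤ C * |y| :=
  lzr h.uc1 h.udd hy (fun x hx _ => by linarith [h.up2 x hx, abs_nonneg (b2 x)])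

theorem Prof.b1_lz (h : Prof u b u1 b1 u2 b2 c C) {y : ℝ} (hy : y ∈ Icc (-1:ℝ) 1) : |b1 y - b1 0| ≤ C * |y| :=
  lzr h.bc1 h.bdd hy (fun x hx _ => by linarith [h.up2 x hx, abs_nonneg (u2 x)])

theorem Prof.m1_le (h : Prof u b u1 b1 u2 b2 c C) {y : ℝ} (hy : y ∈ Icc (-1:ℝ) 1) (h0 : y ≠ 0) :
    |m1 u b u1 b1 y| ≤ 2 * C ^ 2 / c ^ 2 := by
  have hc := h.hc
  have hC : 0 < C := hc.trans_le h.C0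
  have h1 : |(u1 y * b y - u y * b1 y) - (u1 0 * b 0 - u 0 * b1 0)| ≤ (2 * C ^ 2 * |y|) * |y| := by
    refine lzr (f := fun y => u1 y * b y - u y * b1 y) (f' := fun y => (u2 y * b y + u1 y * b1 y) - (u1 y * b1 y + u y * b2 y))
      ((h.uc1.mul h.bc).sub (h.uc.mul h.bc1)) (fun x hx => ((h.udd x hx).mul (h.bd x hx)).sub ((h.ud x hx).mul (h.bdd x hx))) hy
      (fun x hx hxy => ?_)
    have e : (u2 x * b x + u1 x * b1 x) - (u1 x * b1 x + u x * b2 x) = u2 x * b x - u x * b2 x := by ring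
    rw [e]
    refine (abs_sub _ _).trans ?_
    rw [abs_mul, abs_mul]
    have a1 := h.up2 x hx
    have a2 := h.u_le (Ioo_subset_Icc_self hx)
    have a3 := h.b_le (Ioo_subset_Icc_self hx)
    have a4 : |u2 x| * |b x| ≤ C * (C * |y|) := mul_le_mul (by linarith [abs_nonneg (b2 x)]) (a3.trans (by gcongr)) (abs_nonneg _) hC.le
    have a5 : |u x| * |b2 x| ≤ (C * |y|) * C := mul_le_mul (a2.trans (by gcongr)) (by linarith [abs_nonneg (u2 x)]) (abs_nonneg _) (by positivity)
    nlinarith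
  rw [h.u0, h.b0] at h1
  simp only [mul_zero, zero_mul, sub_zero] at h1
  have h2 := h.b_ge hy
  have h3 : 0 < c * |y| := mul_pos hc (abs_pos.2 h0)
  have h4 : (c * |y|) ^ 2 ≤ |b y| ^ 2 := by gcongr
  rw [m1, abs_div, abs_pow, div_le_div_iff₀ (by nlinarith) (by positivity)]
  have h5 : 0 ≤ 2 * C ^ 2 := by positivity
  nlinarith [mul_le_mul_of_nonneg_left h4 h5, mul_le_mul_of_nonneg_right h1 (sq_nonneg c)]

theorem Prof.mm_lz (h : Prof u b u1 b1 u2 b2 c C) {y : ℝ} (hy : y ∈ Icc (-1:ℝ) 1) :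
    |mm u b u1 b1 y - mm u b u1 b1 0| ≤ 2 * C ^ 2 / c ^ 2 * |y| := by
  have hc := h.hc
  have hC : 0 < C := hc.trans_le h.C0
  by_cases h0 : y = 0
  · subst h0; simp
  have hb0 : c ≤ b1 0 := by linarith [h.low 0 (by simp), abs_nonneg (u1 0)]
  have h1 : |(u y * b1 0 - u1 0 * b y) - (u 0 * b1 0 - u1 0 * b 0)| ≤ (2 * C ^ 2 * |y|) * |y| := by
    refine lzr (f := fun y => u y * b1 0 - u1 0 * b y) (f' := fun y => u1 y * b1 0 - u1 0 * b1 y)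
      ((h.uc.mul continuousOn_const).sub (continuousOn_const.mul h.bc)) (fun x hx => ((h.ud x hx).mul_const _).sub ((h.bd x hx).const_mul _)) hy
      (fun x hx hxy => ?_)
    have e : u1 x * b1 0 - u1 0 * b1 x = (u1 x - u1 0) * b1 0 - u1 0 * (b1 x - b1 0) := by ring
    rw [e]
    refine (abs_sub _ _).trans ?_
    rw [abs_mul, abs_mul]
    have a2 := h.u1_lz (Ioo_subset_Icc_self hx)
    have a3 := h.b1_lz (Ioo_subset_Icc_self hx)
    have a4 : |u1 x - u1 0| * |b1 0| ≤ (C * |y|) * C := mul_le_mul (a2.trans (by gcongr)) (h.b1_le (by simp)) (abs_nonneg _) (by positivity)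
    have a5 : |u1 0| * |b1 x - b1 0| ≤ C * (C * |y|) := mul_le_mul (h.u1_le (by simp)) (a3.trans (by gcongr)) (abs_nonneg _) (by positivity)
    nlinarith
  rw [h.u0, h.b0] at h1
  simp only [mul_zero, zero_mul, sub_zero] at h1
  have h2 := h.b_ge hy
  have h3 : 0 < c * |y| := mul_pos hc (abs_pos.2 h0)
  have hbn := h.b_ne hy h0
  have e : mm u b u1 b1 y - mm u b u1 b1 0 = (u y * b1 0 - u1 0 * b y) / (b y * b1 0) := by
    have : b1 0 ≠ 0 := by linarith
    simp only [mm, if_neg h0, if_true]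
    field_simp
  rw [e, abs_div, abs_mul, abs_of_pos (hc.trans_le hb0)]
  have h4 : c * |y| * c ≤ |b y| * b1 0 := mul_le_mul h2 hb0 hc.le (abs_nonneg _)
  rw [div_le_iff₀ (by nlinarith)]
  have h6 : 2 * C ^ 2 / c ^ 2 * |y| * (c * |y| * c) = 2 * C ^ 2 * |y| * |y| := by field_simp
  have h5 : 0 ≤ 2 * C ^ 2 / c ^ 2 * |y| := by positivity
  nlinarith [mul_le_mul_of_nonneg_left h4 h5]

theorem Prof.mm_c (h : Prof u b u1 b1 u2 b2 c C) : ContinuousOn (mm u b u1 b1) (Icc (-1) 1) := by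
  intro y hy
  by_cases h0 : y = 0
  · subst h0
    rw [ContinuousWithinAt, tendsto_iff_dist_tendsto_zero]
    have h1 : Tendsto (fun y : ℝ => 2 * C ^ 2 / c ^ 2 * |y|) (𝓝[Icc (-1) 1] 0) (𝓝 0) := by
      have : Continuous (fun y : ℝ => 2 * C ^ 2 / c ^ 2 * |y|) := by fun_prop
      have := this.tendsto 0
      simp only [abs_zero, mul_zero] at this
      exact this.mono_left nhdsWithin_le_nhds
    refine squeeze_zero' (Eventually.of_forall fun _ => dist_nonneg) ?_ h1
    filter_upwards [self_mem_nhdsWithin] with s hs using h.mm_lz hs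
  · have := (h.uc y hy).div (h.bc y hy) (h.b_ne hy h0)
    refine this.congr_of_eventuallyEq ?_ ?_
    · filter_upwards [mem_nhdsWithin_of_mem_nhds (isOpen_ne.mem_nhds h0)] with s hs
      simp only [mm, if_neg hs]; rfl
    · simp only [mm, if_neg h0]; rfl

theorem contOn_top {f : ℝ → ℝ} (hf : ContinuousOn f (Icc (-1) 1)) : MemLp f ⊤ mu := by
  obtain ⟨C, hC⟩ := (isCompact_Icc (a := (-1:ℝ)) (b := 1)).exists_bound_of_continuousOn hf
  refine MemLp.of_bound (hf.integrableOn_Icc.mono_set Ioc_subset_Icc_self).aestronglyMeasurable C ?_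
  filter_upwards [ae_restrict_mem measurableSet_Ioc] with y hy
  exact hC y (Ioc_subset_Icc_self hy)

theorem Prof.m1_top (h : Prof u b u1 b1 u2 b2 c C) : MemLp (m1 u b u1 b1) ⊤ mu := by
  have a : ∀ {f : ℝ → ℝ}, ContinuousOn f (Icc (-1) 1) → AEMeasurable f mu := fun hf =>
    (contOn_top hf).aestronglyMeasurable.aemeasurable
  refine MemLp.of_bound (C := 2 * C ^ 2 / c ^ 2) ?_ ?_
  · exact ((((a h.uc1).mul (a h.bc)).sub ((a h.uc).mul (a h.bc1))).div ((a h.bc).pow_const 2)).aestronglyMeasurable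
  · filter_upwards [mu_nice] with y hy using h.m1_le (Ioo_subset_Icc_self hy.1) hy.2

theorem Prof.hh_c (h : Prof u b u1 b1 u2 b2 c C) : ContinuousOn (hh u b) (Icc (-1) 1) :=
  Real.continuous_sqrt.comp_continuousOn ((h.bc.pow 2).sub (h.uc.pow 2))

theorem Prof.hh_ge (h : Prof u b u1 b1 u2 b2 c C) {y : ℝ} (hy : y ∈ Icc (-1:ℝ) 1) : c * |y| ≤ hh u b y := by
  apply Real.le_sqrt_of_sq_le
  rw [mul_pow, sq_abs]
  exact h.H_ge hy
end
end MHD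

namespace MHD
section
open MeasureTheory
open scoped ComplexInnerProductSpace

theorem ode_zero_r {α : ℝ} (hα : α ≠ 0) {d d1 : ℝ → ℝ} (hc : ContinuousOn d (Icc (-1) 1)) (hc1 : ContinuousOn d1 (Icc (-1) 1))
    (hd : ∀ y ∈ Ioo (-1:ℝ) 1, HasDerivAt d (d1 y) y) (hd1 : ∀ y ∈ Ioo (-1:ℝ) 1, HasDerivAt d1 (α ^ 2 * d y) y)
    (h0 : d (-1) = 0) (h1 : d 1 = 0) : ∀ y ∈ Icc (-1:ℝ) 1, d y = 0 := by
  have hg : ∀ y ∈ Ioo (-1:ℝ) 1, HasDerivAt (fun y => d y * d1 y) (d1 y * d1 y + d y * (α ^ 2 * d y)) y := fun y hy =>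
    (hd y hy).mul (hd1 y hy)
  have hmon : MonotoneOn (fun y => d y * d1 y) (Icc (-1) 1) := by
    refine monotoneOn_of_deriv_nonneg (convex_Icc _ _) (hc.mul hc1) ?_ ?_
    · rw [interior_Icc]; exact fun y hy => (hg y hy).differentiableAt.differentiableWithinAt
    · rw [interior_Icc]; intro y hy; rw [(hg y hy).deriv]
      nlinarith [mul_self_nonneg (d1 y), mul_self_nonneg (α * d y)]
  have hz : ∀ y ∈ Icc (-1:ℝ) 1, d y * d1 y = 0 := by
    intro y hy
    have a1 := hmon (left_mem_Icc.2 (by norm_num)) hy hy.1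
    have a2 := hmon hy (right_mem_Icc.2 (by norm_num)) hy.2
    simp only [h0, h1, zero_mul] at a1 a2
    linarith
  intro y hy
  rcases eq_or_lt_of_le hy.1 with e | e
  · rw [← e, h0]
  rcases eq_or_lt_of_le hy.2 with e' | e'
  · rw [e', h1]
  have hy' : y ∈ Ioo (-1:ℝ) 1 := ⟨e, e'⟩
  have k := (hg y hy').unique ((hasDerivAt_const y (0:ℝ)).congr_of_eventuallyEq (by
    filter_upwards [Icc_mem_nhds e e'] with s hs using hz s hs))
  have : (α * d y) ^ 2 = 0 := by nlinarith [mul_self_nonneg (d1 y), sq_nonneg (α * d y)]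
  simpa [hα] using this

theorem ode_zero {α : ℝ} (hα : α ≠ 0) {d d1 : ℝ → ℂ} (hc : ContinuousOn d (Icc (-1) 1)) (hc1 : ContinuousOn d1 (Icc (-1) 1))
    (hd : ∀ y ∈ Ioo (-1:ℝ) 1, HasDerivAt d (d1 y) y) (hd1 : ∀ y ∈ Ioo (-1:ℝ) 1, HasDerivAt d1 ((α:ℂ) ^ 2 * d y) y)
    (h0 : d (-1) = 0) (h1 : d 1 = 0) : ∀ y ∈ Icc (-1:ℝ) 1, d y = 0 := by
  have re : ∀ {f : ℝ → ℂ} {f' : ℂ} {y : ℝ}, HasDerivAt f f' y → HasDerivAt (fun y => (f y).re) f'.re y := fun h =>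
    Complex.reCLM.hasFDerivAt.comp_hasDerivAt _ h
  have im : ∀ {f : ℝ → ℂ} {f' : ℂ} {y : ℝ}, HasDerivAt f f' y → HasDerivAt (fun y => (f y).im) f'.im y := fun h =>
    Complex.imCLM.hasFDerivAt.comp_hasDerivAt _ h
  intro y hy
  apply Complex.ext
  · refine ode_zero_r hα (d := fun y => (d y).re) (d1 := fun y => (d1 y).re) (Complex.continuous_re.comp_continuousOn hc) (Complex.continuous_re.comp_continuousOn hc1)
      (fun y hy => re (hd y hy)) (fun y hy => ?_) (by simp [h0]) (by simp [h1]) y hy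
    have := re (hd1 y hy)
    rwa [← Complex.ofReal_pow, Complex.re_ofReal_mul] at this
  · refine ode_zero_r hα (d := fun y => (d y).im) (d1 := fun y => (d1 y).im) (Complex.continuous_im.comp_continuousOn hc) (Complex.continuous_im.comp_continuousOn hc1)
      (fun y hy => im (hd y hy)) (fun y hy => ?_) (by simp [h0]) (by simp [h1]) y hy
    have := im (hd1 y hy)
    rwa [← Complex.ofReal_pow, Complex.im_ofReal_mul] at this

/-- snapshot of the fields at a fixed time -/
structure Snap (u b u1 b1 u2 b2 : ℝ → ℝ) (α : ℝ) (f g fy gy fyy gyy ft gt p q : ℝ → ℂ) : Prop where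
  cf : ContinuousOn f (Icc (-1) 1)
  cg : ContinuousOn g (Icc (-1) 1)
  cfy : ContinuousOn fy (Icc (-1) 1)
  cgy : ContinuousOn gy (Icc (-1) 1)
  cft : ContinuousOn ft (Icc (-1) 1)
  cgt : ContinuousOn gt (Icc (-1) 1)
  cp : ContinuousOn p (Icc (-1) 1)
  cq : ContinuousOn q (Icc (-1) 1)
  df : ∀ y ∈ Ioo (-1:ℝ) 1, HasDerivAt f (fy y) y
  dg : ∀ y ∈ Ioo (-1:ℝ) 1, HasDerivAt g (gy y) y
  dfy : ∀ y ∈ Ioo (-1:ℝ) 1, HasDerivAt fy (fyy y) y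
  dgy : ∀ y ∈ Ioo (-1:ℝ) 1, HasDerivAt gy (gyy y) y
  dft : ∀ y ∈ Ioo (-1:ℝ) 1, HasDerivAt ft (p y) y
  dgt : ∀ y ∈ Ioo (-1:ℝ) 1, HasDerivAt gt (q y) y
  dp : ∀ y ∈ Ioo (-1:ℝ) 1, HasDerivAt p ((α:ℂ) ^ 2 * ft y - Complex.I * α * u y * (fyy y - (α:ℂ) ^ 2 * f y)
    + Complex.I * α * b y * (gyy y - (α:ℂ) ^ 2 * g y) + Complex.I * α * (u2 y * f y - b2 y * g y)) y
  dq : ∀ y ∈ Ioo (-1:ℝ) 1, HasDerivAt q ((α:ℂ) ^ 2 * gt y - Complex.I * α * u y * (gyy y - (α:ℂ) ^ 2 * g y)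
    + Complex.I * α * b y * (fyy y - (α:ℂ) ^ 2 * f y)
    + Complex.I * α * (b2 y * f y - u2 y * g y - 2 * u1 y * gy y + 2 * b1 y * fy y)) y
  bf : f (-1) = 0 ∧ f 1 = 0
  bg : g (-1) = 0 ∧ g 1 = 0
  bft : ft (-1) = 0 ∧ ft 1 = 0
  bgt : gt (-1) = 0 ∧ gt 1 = 0

variable {u b u1 b1 u2 b2 : ℝ → ℝ} {c C α : ℝ} {f g fy gy fyy gyy ft gt p q : ℝ → ℂ}

theorem cR {f : ℝ → ℝ} {s : Set ℝ} (h : ContinuousOn f s) : ContinuousOn (fun y => (f y : ℂ)) s :=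
  Complex.continuous_ofReal.comp_continuousOn h

theorem Snap.gt_eq (h : Prof u b u1 b1 u2 b2 c C) (hα : α ≠ 0) (s : Snap u b u1 b1 u2 b2 α f g fy gy fyy gyy ft gt p q) :
    (∀ y ∈ Icc (-1:ℝ) 1, gt y = Complex.I * α * (b y * f y - u y * g y)) ∧
    (∀ y ∈ Ioo (-1:ℝ) 1, q y = Complex.I * α * (b1 y * f y + b y * fy y - (u1 y * g y + u y * gy y))) := by
  have hd : ∀ y ∈ Ioo (-1:ℝ) 1, HasDerivAt (fun y => Complex.I * α * (b y * f y - u y * g y))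
      (Complex.I * α * (b1 y * f y + b y * fy y - (u1 y * g y + u y * gy y))) y := fun y hy =>
    (((h.bd y hy).ofReal_comp.mul (s.df y hy)).sub ((h.ud y hy).ofReal_comp.mul (s.dg y hy))).const_mul _
  have key := ode_zero hα (d := fun y => gt y - Complex.I * α * (b y * f y - u y * g y))
    (d1 := fun y => q y - Complex.I * α * (b1 y * f y + b y * fy y - (u1 y * g y + u y * gy y)))
    (s.cgt.sub (continuousOn_const.mul (((cR h.bc).mul s.cf).sub ((cR h.uc).mul s.cg))))
    (s.cq.sub (continuousOn_const.mul ((((cR h.bc1).mul s.cf).add ((cR h.bc).mul s.cfy)).sub (((cR h.uc1).mul s.cg).add ((cR h.uc).mul s.cgy)))))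
    (fun y hy => (s.dgt y hy).sub (hd y hy))
    (fun y hy => by
      have := (s.dq y hy).sub ((((((h.bdd y hy).ofReal_comp.mul (s.df y hy)).add ((h.bd y hy).ofReal_comp.mul (s.dfy y hy))).sub
        (((h.udd y hy).ofReal_comp.mul (s.dg y hy)).add ((h.ud y hy).ofReal_comp.mul (s.dgy y hy))))).const_mul (Complex.I * α))
      refine this.congr_deriv ?_
      ring)
    (by simp [s.bgt.1, s.bf.1, s.bg.1]) (by simp [s.bgt.2, s.bf.2, s.bg.2])
  have k1 : ∀ y ∈ Icc (-1:ℝ) 1, gt y = Complex.I * α * (b y * f y - u y * g y) := fun y hy => sub_eq_zero.1 (key y hy)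
  refine ⟨k1, fun y hy => ?_⟩
  refine (s.dgt y hy).unique ((hd y hy).congr_of_eventuallyEq ?_)
  filter_upwards [Icc_mem_nhds hy.1 hy.2] with x hx using k1 x hx
end
end MHD

namespace MHD
section
open MeasureTheory
open scoped ComplexInnerProductSpace

variable {u b u1 b1 u2 b2 : ℝ → ℝ} {c C α : ℝ} {f g fy gy fyy gyy ft gt p q : ℝ → ℂ}

noncomputable def kk (u b u1 b1 a : ℝ → ℝ) (y : ℝ) : ℝ := (1 - mm u b u1 b1 y ^ 2) * a y

theorem Prof.kk_c (h : Prof u b u1 b1 u2 b2 c C) {a : ℝ → ℝ} (ha : ContinuousOn a (Icc (-1) 1)) : ContinuousOn (kk u b u1 b1 a) (Icc (-1) 1) :=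
  (continuousOn_const.sub (h.mm_c.pow 2)).mul ha

noncomputable def WW (h : Prof u b u1 b1 u2 b2 c C) (α : ℝ) (x1 x2 x3 x4 : LL) : YY :=
  mkL ((Complex.I * α) • (x2 - MM _ h.m1_top x3 - MM _ (contOn_top h.mm_c) x4), (Complex.I * α ^ 2) • (x1 - MM _ (contOn_top h.mm_c) x3))

noncomputable def NN (h : Prof u b u1 b1 u2 b2 c C) (α : ℝ) (x3 x4 : LL) : YY :=
  mkL (MM _ (contOn_top (h.kk_c h.bc)) x4 - MM _ (contOn_top (h.kk_c h.bc1)) x3, (α:ℂ) • MM _ (contOn_top (h.kk_c h.bc)) x3)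

noncomputable def et (u b u1 b1 : ℝ → ℝ) (α : ℝ) (f g : ℝ → ℂ) (y : ℝ) : ℂ := Complex.I * α * (f y - mm u b u1 b1 y * g y)

theorem Snap.et_c (h : Prof u b u1 b1 u2 b2 c C) (s : Snap u b u1 b1 u2 b2 α f g fy gy fyy gyy ft gt p q) :
    ContinuousOn (et u b u1 b1 α f g) (Icc (-1) 1) := continuousOn_const.mul (s.cf.sub ((cR h.mm_c).mul s.cg))

theorem Snap.et_d (h : Prof u b u1 b1 u2 b2 c C) (s : Snap u b u1 b1 u2 b2 α f g fy gy fyy gyy ft gt p q) {y : ℝ} (hy : y ∈ Ioo (-1:ℝ) 1) (h0 : y ≠ 0) :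
    HasDerivAt (et u b u1 b1 α f g) (Complex.I * α * (fy y - m1 u b u1 b1 y * g y - mm u b u1 b1 y * gy y)) y := by
  refine (((s.df y hy).sub ((h.mm_d hy h0).ofReal_comp.mul (s.dg y hy))).const_mul (Complex.I * α)).congr_deriv ?_
  ring

theorem Snap.w1 (h : Prof u b u1 b1 u2 b2 c C) (s : Snap u b u1 b1 u2 b2 α f g fy gy fyy gyy ft gt p q) :
    Rep (fstL (WW h α (TL f) (TL fy) (TL g) (TL gy))) (fun y => Complex.I * α * (fy y - m1 u b u1 b1 y * g y - mm u b u1 b1 y * gy y)) :=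
  (((TL_rep s.cfy).sub ((TL_rep s.cg).MM _ h.m1_top)).sub ((TL_rep s.cgy).MM _ (contOn_top h.mm_c))).smul _

theorem Snap.w2 (h : Prof u b u1 b1 u2 b2 c C) (s : Snap u b u1 b1 u2 b2 α f g fy gy fyy gyy ft gt p q) :
    Rep (sndL (WW h α (TL f) (TL fy) (TL g) (TL gy))) (fun y => Complex.I * α ^ 2 * (f y - mm u b u1 b1 y * g y)) :=
  ((TL_rep s.cf).sub ((TL_rep s.cg).MM _ (contOn_top h.mm_c))).smul _

theorem Snap.w1t (h : Prof u b u1 b1 u2 b2 c C) (s : Snap u b u1 b1 u2 b2 α f g fy gy fyy gyy ft gt p q) :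
    Rep (fstL (WW h α (TL ft) (TL p) (TL gt) (TL q))) (fun y => Complex.I * α * (p y - m1 u b u1 b1 y * gt y - mm u b u1 b1 y * q y)) :=
  (((TL_rep s.cp).sub ((TL_rep s.cgt).MM _ h.m1_top)).sub ((TL_rep s.cq).MM _ (contOn_top h.mm_c))).smul _

theorem Snap.w2t (h : Prof u b u1 b1 u2 b2 c C) (s : Snap u b u1 b1 u2 b2 α f g fy gy fyy gyy ft gt p q) :
    Rep (sndL (WW h α (TL ft) (TL p) (TL gt) (TL q))) (fun y => Complex.I * α ^ 2 * (ft y - mm u b u1 b1 y * gt y)) :=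
  ((TL_rep s.cft).sub ((TL_rep s.cgt).MM _ (contOn_top h.mm_c))).smul _

theorem Snap.n1 (h : Prof u b u1 b1 u2 b2 c C) (s : Snap u b u1 b1 u2 b2 α f g fy gy fyy gyy ft gt p q) :
    Rep (fstL (NN h α (TL g) (TL gy))) (fun y => kk u b u1 b1 b y * gy y - kk u b u1 b1 b1 y * g y) :=
  ((TL_rep s.cgy).MM _ (contOn_top (h.kk_c h.bc))).sub ((TL_rep s.cg).MM _ (contOn_top (h.kk_c h.bc1)))

theorem Snap.n2 (h : Prof u b u1 b1 u2 b2 c C) (s : Snap u b u1 b1 u2 b2 α f g fy gy fyy gyy ft gt p q) :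
    Rep (sndL (NN h α (TL g) (TL gy))) (fun y => α * (kk u b u1 b1 b y * g y)) :=
  ((TL_rep s.cg).MM _ (contOn_top (h.kk_c h.bc))).smul _

theorem Snap.n1t (h : Prof u b u1 b1 u2 b2 c C) (s : Snap u b u1 b1 u2 b2 α f g fy gy fyy gyy ft gt p q) :
    Rep (fstL (NN h α (TL gt) (TL q))) (fun y => kk u b u1 b1 b y * q y - kk u b u1 b1 b1 y * gt y) :=
  ((TL_rep s.cq).MM _ (contOn_top (h.kk_c h.bc))).sub ((TL_rep s.cgt).MM _ (contOn_top (h.kk_c h.bc1)))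

theorem Snap.n2t (h : Prof u b u1 b1 u2 b2 c C) (s : Snap u b u1 b1 u2 b2 α f g fy gy fyy gyy ft gt p q) :
    Rep (sndL (NN h α (TL gt) (TL q))) (fun y => α * (kk u b u1 b1 b y * gt y)) :=
  ((TL_rep s.cgt).MM _ (contOn_top (h.kk_c h.bc))).smul _

theorem Snap.w_int (h : Prof u b u1 b1 u2 b2 c C) (s : Snap u b u1 b1 u2 b2 α f g fy gy fyy gyy ft gt p q) {y : ℝ} (hy : y ∈ Icc (-1:ℝ) 1) :
    ∫ x in (-1)..y, Complex.I * α * (fy x - m1 u b u1 b1 x * g x - mm u b u1 b1 x * gy x) = et u b u1 b1 α f g y := by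
  rw [(s.w1 h).ftc (s.et_c h) (fun x hx hx0 => s.et_d h hx hx0) hy]
  simp [et, s.bf.1, s.bg.1]

theorem Snap.w_mem (h : Prof u b u1 b1 u2 b2 c C) (s : Snap u b u1 b1 u2 b2 α f g fy gy fyy gyy ft gt p q) :
    WW h α (TL f) (TL fy) (TL g) (TL gy) ∈ GG α := by
  rw [mem_GG]
  constructor
  · refine (s.w2 h).eq ((s.w1 h).VV.smul _) fun y hy _ => ?_
    rw [s.w_int h (Ioo_subset_Icc_self hy), et]
    ring
  · rw [(s.w1 h).inner_one, s.w_int h (by simp)]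
    simp [et, s.bf.2, s.bg.2]

theorem Snap.w_zero (h : Prof u b u1 b1 u2 b2 c C) (s : Snap u b u1 b1 u2 b2 α f g fy gy fyy gyy ft gt p q) :
    ⟪mkL (chi 0, 0), WW h α (TL f) (TL fy) (TL g) (TL gy)⟫ = et u b u1 b1 α f g 0 := by
  rw [YY_inner, fst_mk, snd_mk, inner_zero_left, add_zero, inner_chi _ (by norm_num), prim_eq (s.w1 h) (by simp), s.w_int h (by simp)]

theorem Snap.n_dot (h : Prof u b u1 b1 u2 b2 c C) (hα : α ≠ 0) (s : Snap u b u1 b1 u2 b2 α f g fy gy fyy gyy ft gt p q) (hm : MemLp (hh u b) ⊤ mu) :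
    NN h α (TL gt) (TL q) = dia (MM _ hm) (dia (MM _ hm) (WW h α (TL f) (TL fy) (TL g) (TL gy))) := by
  obtain ⟨e1, e2⟩ := s.gt_eq h hα
  have H : ∀ y ∈ Ioo (-1:ℝ) 1, (hh u b y : ℂ) * hh u b y = b y ^ 2 - u y ^ 2 := fun y hy => by
    exact_mod_cast h.hh_sq (Ioo_subset_Icc_self hy)
  have M : ∀ y ∈ Ioo (-1:ℝ) 1, (mm u b u1 b1 y : ℂ) * b y = u y := fun y hy => by
    exact_mod_cast h.mm_mul (Ioo_subset_Icc_self hy)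
  have M1 : ∀ y ∈ Ioo (-1:ℝ) 1, y ≠ 0 → (b y : ℂ) * m1 u b u1 b1 y = u1 y - mm u b u1 b1 y * b1 y := fun y hy h0 => by
    exact_mod_cast h.m1_mul (Ioo_subset_Icc_self hy) h0
  apply YY_ext
  · rw [fst_dia, fst_dia]
    refine (s.n1t h).eq (((s.w1 h).MM _ hm).MM _ hm) fun y hy h0 => ?_
    rw [e1 y (Ioo_subset_Icc_self hy), e2 y hy, ← mul_assoc (hh u b y : ℂ), H y hy, kk, kk]
    have h1 := M y hy
    have h2 := M1 y hy h0
    push_cast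
    generalize (mm u b u1 b1 y : ℂ) = m at *
    generalize (m1 u b u1 b1 y : ℂ) = n at *
    have h3 : (u1 y : ℂ) = b y * n + m * b1 y := by rw [h2]; ring
    rw [h3, ← h1]
    ring
  · rw [snd_dia, snd_dia]
    refine (s.n2t h).eq (((s.w2 h).MM _ hm).MM _ hm) fun y hy h0 => ?_
    rw [e1 y (Ioo_subset_Icc_self hy), ← mul_assoc (hh u b y : ℂ), H y hy, kk, ← M y hy]
    push_cast
    ring

theorem Snap.w_dot (h : Prof u b u1 b1 u2 b2 c C) (hα : α ≠ 0) (s : Snap u b u1 b1 u2 b2 α f g fy gy fyy gyy ft gt p q) (hu : MemLp u ⊤ mu) :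
    PP α (WW h α (TL ft) (TL p) (TL gt) (TL q) + (2 * Complex.I * α) • dia (MM _ hu) (WW h α (TL f) (TL fy) (TL g) (TL gy))
      + ((α:ℂ) ^ 2) • NN h α (TL g) (TL gy)) = 0 := by
  obtain ⟨e1, e2⟩ := s.gt_eq h hα
  have M : ∀ y ∈ Ioo (-1:ℝ) 1, (mm u b u1 b1 y : ℂ) * b y = u y := fun y hy => by
    exact_mod_cast h.mm_mul (Ioo_subset_Icc_self hy)
  have M1 : ∀ y ∈ Ioo (-1:ℝ) 1, y ≠ 0 → (b y : ℂ) * m1 u b u1 b1 y = u1 y - mm u b u1 b1 y * b1 y := fun y hy h0 => by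
    exact_mod_cast h.m1_mul (Ioo_subset_Icc_self hy) h0
  set a0 : ℝ → ℂ := fun y => p y + Complex.I * α * (u y * fy y - u1 y * f y) - Complex.I * α * (b y * gy y - b1 y * g y) with ha0
  set c0 : ℝ → ℂ := fun y => ft y + Complex.I * α * (u y * f y) - Complex.I * α * (b y * g y) with hc0
  have ha0c : ContinuousOn a0 (Icc (-1) 1) :=
    (s.cp.add (continuousOn_const.mul (((cR h.uc).mul s.cfy).sub ((cR h.uc1).mul s.cf)))).sub
      (continuousOn_const.mul (((cR h.bc).mul s.cgy).sub ((cR h.bc1).mul s.cg)))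
  have ha0d : ∀ y ∈ Ioo (-1:ℝ) 1, y ≠ 0 → HasDerivAt a0 ((α:ℂ) ^ 2 * c0 y) y := fun y hy _ => by
    refine (((s.dp y hy).add ((((h.ud y hy).ofReal_comp.mul (s.dfy y hy)).sub ((h.udd y hy).ofReal_comp.mul (s.df y hy))).const_mul (Complex.I * α))).sub
      ((((h.bd y hy).ofReal_comp.mul (s.dgy y hy)).sub ((h.bdd y hy).ofReal_comp.mul (s.dg y hy))).const_mul (Complex.I * α))).congr_deriv ?_
    simp only [hc0]
    ring
  set V := WW h α (TL ft) (TL p) (TL gt) (TL q) + (2 * Complex.I * α) • dia (MM _ hu) (WW h α (TL f) (TL fy) (TL g) (TL gy))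
      + ((α:ℂ) ^ 2) • NN h α (TL g) (TL gy) with hV
  have r1 : Rep (fstL V) (fun y => Complex.I * α * a0 y) := by
    rw [hV, map_add, map_add, map_smul, map_smul, fst_dia]
    refine (((s.w1t h).add (((s.w1 h).MM _ hu).smul _)).add ((s.n1 h).smul _)).congr fun y hy h0 => ?_
    have h1 := M y hy
    have h2 := M1 y hy h0
    rw [e1 y (Ioo_subset_Icc_self hy), e2 y hy, kk, kk]
    simp only [ha0]
    push_cast
    generalize (mm u b u1 b1 y : ℂ) = m at *
    generalize (m1 u b u1 b1 y : ℂ) = n at *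
    have h3 : (u1 y : ℂ) = b y * n + m * b1 y := by rw [h2]; ring
    rw [h3, ← h1]
    linear_combination (α ^ 2 * (b y * gy y - b1 y * g y) * (1 - m ^ 2) : ℂ) * Complex.I_sq
  have r2 : Rep (sndL V) (fun y => Complex.I * α ^ 2 * c0 y) := by
    rw [hV, map_add, map_add, map_smul, map_smul, snd_dia]
    refine (((s.w2t h).add (((s.w2 h).MM _ hu).smul _)).add ((s.n2 h).smul _)).congr fun y hy h0 => ?_
    have h1 := M y hy
    rw [e1 y (Ioo_subset_Icc_self hy), kk]
    simp only [hc0]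
    push_cast
    rw [← h1]
    ring_nf
    simp only [Complex.I_sq]
    ring
  have hcr : Rep ((α:ℂ) • sndL V) (fun y => Complex.I * α * ((α:ℂ) ^ 2 * c0 y)) :=
    (r2.smul _).congr fun y _ _ => by ring
  rw [PP_zero_iff]
  refine ⟨Complex.I * α * a0 (-1) + α * ⟪one, sndL V⟫, ?_⟩
  refine (r1.add (((rep_one.smul _).sub r2.VV).smul _)).eq (rep_one.smul _) fun y hy _ => ?_
  have := hcr.ftc (F := fun y => Complex.I * α * a0 y) (continuousOn_const.mul ha0c) (fun x hx h0 => (ha0d x hx h0).const_mul _) (Ioo_subset_Icc_self hy)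
  have h2 : ∫ x in (-1)..y, Complex.I * α * ((α:ℂ) ^ 2 * c0 x) = α * ∫ x in (-1)..y, Complex.I * α ^ 2 * c0 x := by
    rw [← intervalIntegral.integral_const_mul]
    congr 1; ext x; ring
  rw [h2] at this
  change Complex.I * α * a0 y + _ = _
  linear_combination -this
end
end MHD

namespace MHD
section
open MeasureTheory
open scoped ComplexInnerProductSpace

variable {u b u1 b1 u2 b2 : ℝ → ℝ} {c C α : ℝ} {f g fy gy fyy gyy ft gt p q : ℝ → ℂ}

def LZ (f : ℝ → ℂ) : Prop := ∃ K, ∀ y ∈ Icc (-1:ℝ) 1, ‖f y - f 0‖ ≤ K * |y|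

theorem LZ.sub {f g : ℝ → ℂ} (h1 : LZ f) (h2 : LZ g) : LZ (fun y => f y - g y) := by
  obtain ⟨K, hK⟩ := h1
  obtain ⟨L, hL⟩ := h2
  refine ⟨K + L, fun y hy => ?_⟩
  calc ‖f y - g y - (f 0 - g 0)‖ = ‖(f y - f 0) - (g y - g 0)‖ := by congr 1; ring
    _ ≤ ‖f y - f 0‖ + ‖g y - g 0‖ := norm_sub_le _ _
    _ ≤ _ := by linarith [hK y hy, hL y hy]

theorem LZ.const (a : ℂ) : LZ (fun _ => a) := ⟨0, fun y _ => by simp⟩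

theorem LZ.mul {f g : ℝ → ℂ} (h1 : LZ f) (h2 : LZ g) : LZ (fun y => f y * g y) := by
  obtain ⟨K, hK⟩ := h1
  obtain ⟨L, hL⟩ := h2
  have hK0 : 0 ≤ K := by simpa using (norm_nonneg _).trans (hK 1 (by simp))
  have hL0 : 0 ≤ L := by simpa using (norm_nonneg _).trans (hL 1 (by simp))
  refine ⟨K * (L + ‖g 0‖) + ‖f 0‖ * L, fun y hy => ?_⟩
  have hy1 : |y| ≤ 1 := abs_le.2 hy
  have hg : ‖g y‖ ≤ L + ‖g 0‖ := by
    have a1 := norm_le_norm_add_norm_sub' (g y) (g 0)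
    have a2 := hL y hy
    nlinarith
  calc ‖f y * g y - f 0 * g 0‖ = ‖(f y - f 0) * g y + f 0 * (g y - g 0)‖ := by congr 1; ring
    _ ≤ ‖f y - f 0‖ * ‖g y‖ + ‖f 0‖ * ‖g y - g 0‖ := (norm_add_le _ _).trans (by rw [norm_mul, norm_mul])
    _ ≤ (K * |y|) * (L + ‖g 0‖) + ‖f 0‖ * (L * |y|) := by
        have := hK y hy
        have := hL y hy
        gcongr
    _ = _ := by ring

/-- vanishing factor times bounded -/
theorem LZ.mul0 {f g : ℝ → ℂ} (h1 : LZ f) (h0 : f 0 = 0) (h2 : ContinuousOn g (Icc (-1) 1)) : LZ (fun y => f y * g y) := by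
  obtain ⟨K, hK⟩ := h1
  have hK0 : 0 ≤ K := by simpa using (norm_nonneg _).trans (hK 1 (by simp))
  obtain ⟨L, hL⟩ := (isCompact_Icc (a := (-1:ℝ)) (b := 1)).exists_bound_of_continuousOn h2
  refine ⟨K * L, fun y hy => ?_⟩
  have := hK y hy
  have h3 := hL y hy
  simp only [h0, zero_mul, sub_zero, norm_mul] at this ⊢
  calc ‖f y‖ * ‖g y‖ ≤ (K * |y|) * L := by gcongr
    _ = _ := by ring

theorem LZ.of_deriv {f f' : ℝ → ℂ} (hf : ContinuousOn f (Icc (-1) 1)) (hd : ∀ x ∈ Ioo (-1:ℝ) 1, HasDerivAt f (f' x) x)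
    (hf' : ContinuousOn f' (Icc (-1) 1)) : LZ f := by
  obtain ⟨L, hL⟩ := (isCompact_Icc (a := (-1:ℝ)) (b := 1)).exists_bound_of_continuousOn hf'
  exact ⟨L, fun y hy => lz hf (fun x hx _ => hd x hx) hy (fun x hx _ _ => hL x (Ioo_subset_Icc_self hx))⟩

theorem LZ.ofReal {f : ℝ → ℝ} {K : ℝ} (h : ∀ y ∈ Icc (-1:ℝ) 1, |f y - f 0| ≤ K * |y|) : LZ (fun y => (f y : ℂ)) :=
  ⟨K, fun y hy => by rw [← Complex.ofReal_sub, Complex.norm_real]; exact h y hy⟩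

theorem Snap.r0 (h : Prof u b u1 b1 u2 b2 c C) (s : Snap u b u1 b1 u2 b2 α f g fy gy fyy gyy ft gt p q) (hm : MemLp (hh u b) ⊤ mu) :
    ∃ τ : LL, PP α (NN h α (TL g) (TL gy) - mkL (MM _ hm τ, 0)) = 0 := by
  set v := sndL (NN h α (TL g) (TL gy)) with hv
  have hn2 := s.n2 h
  rw [← hv] at hn2
  have cn2 : ContinuousOn (fun y => (α:ℂ) * (kk u b u1 b1 b y * g y)) (Icc (-1) 1) :=
    continuousOn_const.mul ((cR (h.kk_c h.bc)).mul s.cg)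
  set F : ℝ → ℂ := fun y => α * prim v y with hF
  have hFc : ContinuousOn F (Icc (-1) 1) := continuousOn_const.mul (prim_cont (LL_int v)).continuousOn
  have hFl : LZ F := LZ.of_deriv hFc (fun x hx => (prim_hasDeriv (LL_int v) hn2 hx (cn2.continuousAt (Icc_mem_nhds hx.1 hx.2))).const_mul _)
    (continuousOn_const.mul cn2)
  set n1 : ℝ → ℂ := fun y => kk u b u1 b1 b y * gy y - kk u b u1 b1 b1 y * g y with hn1
  have hn1c : ContinuousOn n1 (Icc (-1) 1) := ((cR (h.kk_c h.bc)).mul s.cgy).sub ((cR (h.kk_c h.bc1)).mul s.cg)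
  have lm : LZ (fun y => (mm u b u1 b1 y : ℂ)) := LZ.ofReal fun y hy => h.mm_lz hy
  have lk : ∀ {a : ℝ → ℝ}, LZ (fun y => (a y : ℂ)) → LZ (fun y => (kk u b u1 b1 a y : ℂ)) := fun {a} ha => by
    have := ((LZ.const 1).sub (lm.mul lm)).mul ha
    have e : (fun y => (kk u b u1 b1 a y : ℂ)) = fun y => (1 - (mm u b u1 b1 y : ℂ) * mm u b u1 b1 y) * a y := by
      ext y; rw [kk]; push_cast; ring
    rwa [e]
  have lb : LZ (fun y => (b y : ℂ)) := LZ.ofReal fun y hy => by simpa [h.b0] using h.b_le hy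
  have lb1 : LZ (fun y => (b1 y : ℂ)) := LZ.ofReal fun y hy => h.b1_lz hy
  have hn1l : LZ n1 := ((lk lb).mul0 (by simp [kk, h.b0]) s.cgy).sub ((lk lb1).mul (LZ.of_deriv s.cg s.dg s.cgy))
  set T : ℝ → ℂ := fun y => n1 y - F y - (n1 0 - F 0) with hT
  have hTc : ContinuousOn T (Icc (-1) 1) := (hn1c.sub hFc).sub continuousOn_const
  obtain ⟨K, hK⟩ := hn1l.sub hFl
  have hK0 : 0 ≤ K := by simpa using (norm_nonneg _).trans (hK 1 (by simp))
  have hq : MemLp (fun y => T y / (hh u b y : ℂ)) 2 mu := by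
    refine MemLp.of_bound ((contOn_int hTc).aestronglyMeasurable.aemeasurable.div (contOn_int (cR h.hh_c)).aestronglyMeasurable.aemeasurable).aestronglyMeasurable (K / c) ?_
    filter_upwards [mu_nice] with y hy
    have hy' := Ioo_subset_Icc_self hy.1
    have h1 := hK y hy'
    have h2 := h.hh_ge hy'
    have hc := h.hc
    have hp : 0 < c * |y| := mul_pos hc (abs_pos.2 hy.2)
    rw [norm_div, Complex.norm_real, Real.norm_of_nonneg (hp.le.trans h2), div_le_div_iff₀ (hp.trans_le h2) hc]
    calc ‖T y‖ * c ≤ (K * |y|) * c := by gcongr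
      _ = K * (c * |y|) := by ring
      _ ≤ _ := by gcongr
  refine ⟨hq.toLp, ?_⟩
  have hτ : Rep (MM _ hm hq.toLp) T := (Rep.MM (f := fun y => T y / (hh u b y : ℂ)) (MemLp.coeFn_toLp hq) _ hm).congr fun y hy h0 => by
    have : (hh u b y : ℂ) ≠ 0 := by
      have := h.hh_ge (Ioo_subset_Icc_self hy)
      have hp : 0 < c * |y| := mul_pos h.hc (abs_pos.2 h0)
      exact_mod_cast (hp.trans_le this).ne'
    field_simp
  rw [PP_zero_iff, map_sub, map_sub, fst_mk, snd_mk, sub_zero, ← hv]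
  refine ⟨n1 0 - F 0 + α * ⟪one, v⟫, ?_⟩
  refine (((s.n1 h).sub hτ).add (((rep_one.smul _).sub (show Rep (VV v) (prim v) from VV_coe v)).smul _)).eq (rep_one.smul _) fun y hy _ => ?_
  simp only [hT, hF, hn1]
  ring
end
end MHD

namespace MHD
section
open MeasureTheory
open scoped ComplexInnerProductSpace

variable {u b u1 b1 u2 b2 : ℝ → ℝ} {c C α : ℝ}

theorem deriv_clm' {E F : Type*} [NormedAddCommGroup E] [NormedSpace ℂ E] [NormedAddCommGroup F] [NormedSpace ℂ F] (T : E →L[ℂ] F)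
    {c : ℝ → E} {c' : E} {s : Set ℝ} {t : ℝ} (h : HasDerivWithinAt c c' s t) :
    HasDerivWithinAt (fun t => T (c t)) (T c') s t :=
  ((T.restrictScalars ℝ).hasFDerivAt (x := c t)).comp_hasDerivWithinAt t h

theorem WW_d (h : Prof u b u1 b1 u2 b2 c C) {x1 x2 x3 x4 : ℝ → LL} {z1 z2 z3 z4 : LL} {s : Set ℝ} {t : ℝ}
    (d1 : HasDerivWithinAt x1 z1 s t) (d2 : HasDerivWithinAt x2 z2 s t) (d3 : HasDerivWithinAt x3 z3 s t) (d4 : HasDerivWithinAt x4 z4 s t) :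
    HasDerivWithinAt (fun t => WW h α (x1 t) (x2 t) (x3 t) (x4 t)) (WW h α z1 z2 z3 z4) s t :=
  deriv_clm' mkL (HasDerivWithinAt.prodMk
    (((d2.sub (deriv_clm (MM _ h.m1_top) d3)).sub (deriv_clm (MM _ (contOn_top h.mm_c)) d4)).const_smul (Complex.I * α : ℂ))
    ((d1.sub (deriv_clm (MM _ (contOn_top h.mm_c)) d3)).const_smul (Complex.I * α ^ 2 : ℂ)))

theorem NN_d (h : Prof u b u1 b1 u2 b2 c C) {x3 x4 : ℝ → LL} {z3 z4 : LL} {s : Set ℝ} {t : ℝ}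
    (d3 : HasDerivWithinAt x3 z3 s t) (d4 : HasDerivWithinAt x4 z4 s t) :
    HasDerivWithinAt (fun t => NN h α (x3 t) (x4 t)) (NN h α z3 z4) s t :=
  deriv_clm' mkL (HasDerivWithinAt.prodMk
    ((deriv_clm (MM _ (contOn_top (h.kk_c h.bc))) d4).sub (deriv_clm (MM _ (contOn_top (h.kk_c h.bc1))) d3))
    ((deriv_clm (MM _ (contOn_top (h.kk_c h.bc))) d3).const_smul (α:ℂ)))

set_option maxHeartbeats 1000000 in
theorem main_abs (h : Prof u b u1 b1 u2 b2 c C) (hα : α ≠ 0) {ψ φ ψy φy ψyy φyy ψt φt q1 q2 : ℝ → ℝ → ℂ}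
    (S : ∀ t ≥ 0, Snap u b u1 b1 u2 b2 α (ψ t) (φ t) (ψy t) (φy t) (ψyy t) (φyy t) (ψt t) (φt t) (q1 t) (q2 t))
    (D1 : ∀ t ≥ 0, HasDerivWithinAt (fun t => TL (ψ t)) (TL (ψt t)) (Ici 0) t)
    (D2 : ∀ t ≥ 0, HasDerivWithinAt (fun t => TL (ψy t)) (TL (q1 t)) (Ici 0) t)
    (D3 : ∀ t ≥ 0, HasDerivWithinAt (fun t => TL (φ t)) (TL (φt t)) (Ici 0) t)
    (D4 : ∀ t ≥ 0, HasDerivWithinAt (fun t => TL (φy t)) (TL (q2 t)) (Ici 0) t) :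
    Tendsto (fun t => et u b u1 b1 α (ψ t) (φ t) 0) atTop (𝓝 0) := by
  have hu : MemLp u ⊤ mu := contOn_top h.uc
  have hm : MemLp (hh u b) ⊤ mu := contOn_top h.hh_c
  obtain ⟨B, hB, Sx, hSx, hres⟩ := hres_prof h hu hm α
  set U := dia (MM u hu) with hU
  set N := dia (MM _ hm) with hN
  set w : ℝ → YY := fun t => WW h α (TL (ψ t)) (TL (ψy t)) (TL (φ t)) (TL (φy t)) with hw
  set w' : ℝ → YY := fun t => WW h α (TL (ψt t)) (TL (q1 t)) (TL (φt t)) (TL (q2 t)) with hw'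
  set n : ℝ → YY := fun t => NN h α (TL (φ t)) (TL (φy t)) with hn
  have dw : ∀ t ≥ 0, HasDerivWithinAt w (w' t) (Ici 0) t := fun t ht => WW_d h (D1 t ht) (D2 t ht) (D3 t ht) (D4 t ht)
  have dn : ∀ t ≥ 0, HasDerivWithinAt n (N (N (w t))) (Ici 0) t := fun t ht => by
    have := NN_d h (α := α) (D3 t ht) (D4 t ht)
    rwa [(S t ht).n_dot h hα hm] at this
  have hPw : ∀ t ≥ 0, PP α (w t) = w t := fun t ht => (PP_self α _).2 ((S t ht).w_mem h)
  have hPw' : ∀ t ≥ 0, PP α (w' t) = w' t := fun t ht =>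
    (uniqueDiffOn_Ici (0:ℝ) t ht).eq_deriv _ ((deriv_clm' (PP α) (dw t ht)).congr (fun s hs => (hPw s hs).symm) (hPw t ht).symm) (dw t ht)
  have hkey : ∀ t ≥ 0, PP α (w' t + (2 * Complex.I * α) • U (w t) + ((α:ℂ) ^ 2) • n t) = 0 := fun t ht => (S t ht).w_dot h hα hu
  obtain ⟨τ, hτ⟩ := (S 0 le_rfl).r0 h hm
  have hτ : PP α (n 0 - mkL (MM _ hm τ, 0)) = 0 := hτ
  have wc : ContinuousOn w (Ici 0) := fun t ht => (dw t ht).continuousWithinAt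
  have wmc : Continuous (fun s : ℝ => w (max s 0)) :=
    wc.comp_continuous (by fun_prop) (fun s => le_max_right s 0)
  set R : ℝ → YY := fun t => ∫ s in (0:ℝ)..t, w (max s 0) with hR
  have dR : ∀ t ≥ 0, HasDerivAt R (w t) t := fun t ht => by
    have := intervalIntegral.integral_hasDerivAt_right (wmc.intervalIntegrable 0 t) (wmc.stronglyMeasurableAtFilter _ _) wmc.continuousAt
    rwa [max_eq_left ht] at this
  have hNR : ∀ t ≥ 0, N (N (R t)) = n t - n 0 := fun t ht => by
    have dd : ∀ s ≥ 0, HasDerivWithinAt (fun s => N (N (R s)) - n s) 0 (Ici 0) s := fun s hs => by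
      have := (deriv_clm' N (deriv_clm' N (dR s hs).hasDerivWithinAt (s := Ici 0))).sub (dn s hs)
      rwa [sub_self] at this
    have := constant_of_has_deriv_right_zero (f := fun s => N (N (R s)) - n s) (a := 0) (b := t)
      (fun s hs => (dd s hs.1).continuousWithinAt.mono Icc_subset_Ici_self)
      (fun s hs => (dd s hs.1).mono (Ici_subset_Ici.2 hs.1)) t ⟨ht, le_rfl⟩
    have R0 : R 0 = 0 := by simp [hR]
    simp only [R0, map_zero, zero_sub] at this
    rw [sub_eq_iff_eq_add] at this
    rw [this]; abel
  set κ : ℂ := -Complex.I * α with hκ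
  set r : ℝ → YY := fun t => κ • mkL (τ, 0) + κ • N (R t) with hr
  have dr : ∀ t ≥ 0, HasDerivWithinAt r (κ • N (w t)) (Ici 0) t := fun t ht => by
    exact ((deriv_clm' N (dR t ht).hasDerivWithinAt).const_smul κ).const_add _
  have hPN : ∀ t ≥ 0, PP α (N (r t)) = κ • PP α (n t) := fun t ht => by
    have e1 : N (mkL (τ, 0)) = mkL (MM _ hm τ, 0) := by
      apply YY_ext
      · rfl
      · rw [hN, snd_dia, snd_mk, snd_mk, map_zero]
    rw [map_sub, sub_eq_zero] at hτ
    rw [hr]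
    simp only [map_add, map_smul]
    rw [e1, hNR t ht, ← hτ, map_sub]
    module
  have := center_decay (PP α) U N (PP_sa α) (PP_idem α) (dia_sa _ (MM_sa _ _)) (dia_sa _ (MM_sa _ _)) (mkL (chi 0, 0)) B hB Sx hSx hres α hα w r hPw wc
    (fun t ht => (dr t ht).continuousWithinAt)
    (fun t ht => by
      have k := hkey t ht
      rw [map_add, map_add, hPw' t ht, map_smul, map_smul] at k
      refine ((dw t ht).mono (Ici_subset_Ici.2 ht)).congr_deriv ?_
      rw [map_add, map_smul, hPN t ht]
      have k2 : w' t = -((2 * Complex.I * α) • PP α (U (w t))) - ((α:ℂ) ^ 2) • PP α (n t) := by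
        rw [← sub_eq_zero, ← k]; abel
      rw [k2, smul_add, smul_add, smul_smul, smul_smul, smul_smul, smul_smul]
      rw [show (α:ℂ) * -Complex.I * κ = -(α:ℂ) ^ 2 by rw [hκ]; linear_combination (α:ℂ) ^ 2 * Complex.I_sq]
      module)
    (fun t ht => by
      refine ((dr t ht).mono (Ici_subset_Ici.2 ht)).congr_deriv ?_
      rw [smul_smul, hκ, mul_comm])
  refine this.congr' ?_
  filter_upwards [eventually_ge_atTop 0] with t ht
  exact (S t ht).w_zero h
end
end MHD

namespace MHD
section
open MeasureTheory

theorem der_pack {u : ℝ → ℝ} (hu : ContDiffOn ℝ 5 u (Icc (-1) 1)) : ∃ u1 u2 : ℝ → ℝ,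
    ContinuousOn u1 (Icc (-1) 1) ∧ ContinuousOn u2 (Icc (-1) 1) ∧
    ∀ y ∈ Ioo (-1:ℝ) 1, HasDerivAt u (u1 y) y ∧ HasDerivAt u1 (u2 y) y ∧ deriv u y = u1 y ∧ deriv (deriv u) y = u2 y := by
  have hI : UniqueDiffOn ℝ (Icc (-1:ℝ) 1) := uniqueDiffOn_Icc (by norm_num)
  have h1 : ContDiffOn ℝ 1 (derivWithin u (Icc (-1) 1)) (Icc (-1) 1) := hu.derivWithin hI (by norm_num)
  have h2 : ContDiffOn ℝ 0 (derivWithin (derivWithin u (Icc (-1) 1)) (Icc (-1) 1)) (Icc (-1) 1) := h1.derivWithin hI (by norm_num)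
  have d1 : ∀ y ∈ Ioo (-1:ℝ) 1, HasDerivAt u (derivWithin u (Icc (-1) 1) y) y := fun y hy =>
    ((hu.differentiableOn (by norm_num)) y (Ioo_subset_Icc_self hy)).hasDerivWithinAt.hasDerivAt (Icc_mem_nhds hy.1 hy.2)
  have d2 : ∀ y ∈ Ioo (-1:ℝ) 1, HasDerivAt (derivWithin u (Icc (-1) 1)) (derivWithin (derivWithin u (Icc (-1) 1)) (Icc (-1) 1) y) y := fun y hy =>
    ((h1.differentiableOn (by norm_num)) y (Ioo_subset_Icc_self hy)).hasDerivWithinAt.hasDerivAt (Icc_mem_nhds hy.1 hy.2)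
  refine ⟨_, _, h1.continuousOn, h2.continuousOn, fun y hy => ⟨d1 y hy, d2 y hy, (d1 y hy).deriv, ?_⟩⟩
  refine HasDerivAt.deriv ((d2 y hy).congr_of_eventuallyEq ?_)
  filter_upwards [Ioo_mem_nhds hy.1 hy.2] with s hs using (d1 s hs).deriv

theorem mk_prof {u b : ℝ → ℝ} (hu : ContDiffOn ℝ 5 u (Icc (-1) 1)) (hb : ContDiffOn ℝ 5 b (Icc (-1) 1))
    (hu0 : u 0 = 0) (hb0 : b 0 = 0)
    (hmono : ∃ c₀ > 0, ∀ y ∈ Icc (-1:ℝ) 1, c₀ ≤ deriv b y - |deriv u y|) :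
    ∃ u1 b1 u2 b2 : ℝ → ℝ, ∃ c C : ℝ, Prof u b u1 b1 u2 b2 c C ∧
      ∀ y ∈ Ioo (-1:ℝ) 1, deriv u y = u1 y ∧ deriv (deriv u) y = u2 y ∧ deriv b y = b1 y ∧ deriv (deriv b) y = b2 y := by
  obtain ⟨u1, u2, cu1, cu2, du⟩ := der_pack hu
  obtain ⟨b1, b2, cb1, cb2, db⟩ := der_pack hb
  obtain ⟨c, hc, hmono⟩ := hmono
  obtain ⟨C1, hC1⟩ := (isCompact_Icc (a := (-1:ℝ)) (b := 1)).exists_bound_of_continuousOn (cb1.add cu1.abs)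
  obtain ⟨C2, hC2⟩ := (isCompact_Icc (a := (-1:ℝ)) (b := 1)).exists_bound_of_continuousOn (cb2.abs.add cu2.abs)
  have hcl : closure (Ioo (-1:ℝ) 1) = Icc (-1) 1 := closure_Ioo (by norm_num)
  refine ⟨u1, b1, u2, b2, c, max C1 C2, ?_, fun y hy => ⟨(du y hy).2.2.1, (du y hy).2.2.2, (db y hy).2.2.1, (db y hy).2.2.2⟩⟩
  exact
    { hc := hc
      u0 := hu0
      b0 := hb0
      uc := hu.continuousOn
      bc := hb.continuousOn
      uc1 := cu1
      bc1 := cb1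
      ud := fun y hy => (du y hy).1
      bd := fun y hy => (db y hy).1
      udd := fun y hy => (du y hy).2.1
      bdd := fun y hy => (db y hy).2.1
      low := fun y hy => by
        refine le_on_closure (s := Ioo (-1:ℝ) 1) (f := fun _ => c) (g := fun y => b1 y - |u1 y|) (fun x hx => ?_) continuousOn_const ?_ (by rwa [hcl])
        · have := hmono x (Ioo_subset_Icc_self hx)
          rwa [(du x hx).2.2.1, (db x hx).2.2.1] at this
        · rw [hcl]; exact cb1.sub cu1.abs
      up := fun y hy => ((le_abs_self _).trans (hC1 y hy)).trans (le_max_left _ _)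
      up2 := fun y hy => ((le_abs_self _).trans (hC2 y (Ioo_subset_Icc_self hy))).trans (le_max_right _ _) }
end
end MHD

/-- Long-time behavior at the center of the magnetic island: `φ(t,0)` is conserved and
`ψ(t,0) → (u'(0)/b'(0)) φ₀(0)` as `t → +∞`. -/
theorem mhd_longtime_center (u b : ℝ → ℝ) (α : ℤ) (hα : α ≠ 0)
    (hu : ContDiffOn ℝ 5 u (Icc (-1) 1)) (hb : ContDiffOn ℝ 5 b (Icc (-1) 1))
    (hu0 : u 0 = 0) (hb0 : b 0 = 0)
    (hmono : ∃ c₀ > 0, ∀ y ∈ Icc (-1:ℝ) 1, c₀ ≤ deriv b y - |deriv u y|)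
    (ψ φ : ℝ → ℝ → ℂ) (hsol : IsMHDSolution u b α ψ φ)
    (hψ0 : ContDiffOn ℝ 3 (ψ 0) (Icc (-1) 1))
    (hφ0 : ContDiffOn ℝ 4 (φ 0) (Icc (-1) 1)) :
    (∀ t : ℝ, 0 ≤ t → φ t 0 = φ 0 0) ∧
      Tendsto (fun t => ψ t 0) atTop
        (𝓝 (((deriv u 0 / deriv b 0 : ℝ) : ℂ) * φ 0 0)) := by
  obtain ⟨u1, b1, u2, b2, c, C, hP, hder⟩ := MHD.mk_prof hu hb hu0 hb0 hmono
  have hα' : (α:ℝ) ≠ 0 := by exact_mod_cast hα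
  have dt1 : ∀ t ≥ 0, ∀ y ∈ Icc (-1:ℝ) 1, HasDerivAt (fun s => ψ s y) (deriv (fun s => ψ s y) t) t :=
    fun t ht y hy => (hsol.diff_psi_t t ht y hy).hasDerivAt
  have dt2 : ∀ t ≥ 0, ∀ y ∈ Icc (-1:ℝ) 1, HasDerivAt (fun s => φ s y) (deriv (fun s => φ s y) t) t :=
    fun t ht y hy => (hsol.diff_phi_t t ht y hy).hasDerivAt
  have e1 : ∀ t ≥ 0, ∀ y ∈ Icc (-1:ℝ) 1, HasDerivAt (fun s => deriv (deriv (ψ s)) y) _ t := fun t ht y hy => by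
    have := (hsol.eqn_psi t ht y hy).add ((dt1 t ht y hy).const_mul ((α:ℂ)^2))
    refine this.congr_of_eventuallyEq (Eventually.of_forall fun s => ?_)
    simp
  have e2 : ∀ t ≥ 0, ∀ y ∈ Icc (-1:ℝ) 1, HasDerivAt (fun s => deriv (deriv (φ s)) y) _ t := fun t ht y hy => by
    have := (hsol.eqn_phi t ht y hy).add ((dt2 t ht y hy).const_mul ((α:ℂ)^2))
    refine this.congr_of_eventuallyEq (Eventually.of_forall fun s => ?_)
    simp
  obtain ⟨q1, hq1⟩ := MHD.field (ψ := ψ) (ψy := fun t y => deriv (ψ t) y) (ψyy := fun t y => deriv (deriv (ψ t)) y)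
    (ψt := fun t y => deriv (fun s => ψ s y) t) (ψyyt := fun t y => deriv (fun s => deriv (deriv (ψ s)) y) t)
    hsol.cont_psi hsol.cont_psi_y hsol.cont_psi_yy hsol.cont_psi_t hsol.cont_psi_yyt
    (fun t ht y hy => (hsol.diff_psi_y t ht y hy).hasDerivAt) (fun t ht y hy => (hsol.diff_psi_yy t ht y hy).hasDerivAt)
    dt1 (fun t ht y hy => (e1 t ht y hy).differentiableAt.hasDerivAt) hsol.bc_psi
  obtain ⟨q2, hq2⟩ := MHD.field (ψ := φ) (ψy := fun t y => deriv (φ t) y) (ψyy := fun t y => deriv (deriv (φ t)) y)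
    (ψt := fun t y => deriv (fun s => φ s y) t) (ψyyt := fun t y => deriv (fun s => deriv (deriv (φ s)) y) t)
    hsol.cont_phi hsol.cont_phi_y hsol.cont_phi_yy hsol.cont_phi_t hsol.cont_phi_yyt
    (fun t ht y hy => (hsol.diff_phi_y t ht y hy).hasDerivAt) (fun t ht y hy => (hsol.diff_phi_yy t ht y hy).hasDerivAt)
    dt2 (fun t ht y hy => (e2 t ht y hy).differentiableAt.hasDerivAt) hsol.bc_phi
  have S : ∀ t ≥ 0, MHD.Snap u b u1 b1 u2 b2 α (ψ t) (φ t) (deriv (ψ t)) (deriv (φ t)) (deriv (deriv (ψ t))) (deriv (deriv (φ t)))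
      (fun y => deriv (fun s => ψ s y) t) (fun y => deriv (fun s => φ s y) t) (q1 t) (q2 t) := fun t ht => by
    obtain ⟨k1, k2, k3, k4, k5, -, -⟩ := hq1 t ht
    obtain ⟨l1, l2, l3, l4, l5, -, -⟩ := hq2 t ht
    exact
      { cf := MHD.slice hsol.cont_psi ht
        cg := MHD.slice hsol.cont_phi ht
        cfy := MHD.slice (F := fun t y => deriv (ψ t) y) hsol.cont_psi_y ht
        cgy := MHD.slice (F := fun t y => deriv (φ t) y) hsol.cont_phi_y ht
        cft := MHD.slice (F := fun t y => deriv (fun s => ψ s y) t) hsol.cont_psi_t ht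
        cgt := MHD.slice (F := fun t y => deriv (fun s => φ s y) t) hsol.cont_phi_t ht
        cp := k1
        cq := l1
        df := fun y hy => (hsol.diff_psi_y t ht y (Ioo_subset_Icc_self hy)).hasDerivAt
        dg := fun y hy => (hsol.diff_phi_y t ht y (Ioo_subset_Icc_self hy)).hasDerivAt
        dfy := fun y hy => (hsol.diff_psi_yy t ht y (Ioo_subset_Icc_self hy)).hasDerivAt
        dgy := fun y hy => (hsol.diff_phi_yy t ht y (Ioo_subset_Icc_self hy)).hasDerivAt
        dft := k2
        dgt := l2
        dp := fun y hy => by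
          refine (k3 y hy).congr_deriv ?_
          rw [(e1 t ht y (Ioo_subset_Icc_self hy)).deriv, (hder y hy).2.1, (hder y hy).2.2.2]
          push_cast
          ring
        dq := fun y hy => by
          refine (l3 y hy).congr_deriv ?_
          rw [(e2 t ht y (Ioo_subset_Icc_self hy)).deriv, (hder y hy).2.1, (hder y hy).2.2.2, (hder y hy).1, (hder y hy).2.2.1]
          push_cast
          ring
        bf := hsol.bc_psi t ht
        bg := hsol.bc_phi t ht
        bft := ⟨k4, k5⟩
        bgt := ⟨l4, l5⟩ }
  have h0 : (0:ℝ) ∈ Icc (-1:ℝ) 1 := by simp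
  have hphi : ∀ t : ℝ, 0 ≤ t → φ t 0 = φ 0 0 := fun t ht => by
    have hd : ∀ s ≥ 0, HasDerivAt (fun s => φ s 0) 0 s := fun s hs => by
      have k := ((S s hs).gt_eq hP hα').1 0 h0
      simp only [hu0, hb0, Complex.ofReal_zero, zero_mul, sub_zero, mul_zero] at k
      have := dt2 s hs 0 h0
      rwa [k] at this
    exact constant_of_has_deriv_right_zero (f := fun s => φ s 0) (a := 0) (b := t)
      (fun s hs => (hd s hs.1).continuousAt.continuousWithinAt)
      (fun s hs => (hd s hs.1).hasDerivWithinAt) t ⟨ht, le_rfl⟩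
  refine ⟨hphi, ?_⟩
  have key := MHD.main_abs hP hα' S (fun t ht => (hq1 t ht).2.2.2.2.2.1) (fun t ht => (hq1 t ht).2.2.2.2.2.2)
    (fun t ht => (hq2 t ht).2.2.2.2.2.1) (fun t ht => (hq2 t ht).2.2.2.2.2.2)
  have hIα : (Complex.I * ((α:ℝ):ℂ)) ≠ 0 := mul_ne_zero Complex.I_ne_zero (by exact_mod_cast hα')
  have key2 := (key.const_mul (Complex.I * ((α:ℝ):ℂ))⁻¹).add_const (((u1 0 / b1 0 : ℝ) : ℂ) * φ 0 0)
  rw [mul_zero, zero_add] at key2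
  have hd0 := hder 0 (by simp)
  rw [hd0.1, hd0.2.2.1]
  refine key2.congr' ?_
  filter_upwards [eventually_ge_atTop 0] with t ht
  rw [MHD.et, inv_mul_cancel_left₀ hIα, hphi t ht, MHD.mm, if_pos rfl]
  ring
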